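/- Let M = M_1 *_B M_2 be an amalgamated free product of σ-finite von Neumann algebras. If B is a von Neumann algebra of type I, and M_1 is amenable and has no type I direct summand, then M_1 is maximal amenable with expectation inside M: whenever Q ⊆ M is an amenable von Neumann subalgebra with expectation satisfying M_1 ⊆ Q, one has Q = M_1. -/

import Mathlib

/- Framework: von Neumann algebras are modeled concretely as `VonNeumannAlgebra H` for a
complex Hilbert space `H` (in the relevant statements, `H` plays the role of the standard
form Hilbert space `L²(M)`).  Conditional expectations, normality (complete additivity,
phrased via preservation of suprema of upward-directed sets in the Loewner order),
faithfulness, σ-finiteness, standard forms, Jones basic constructions `⟨M, Q⟩ = (JQJ)'`,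
amalgamated free products, Popa's intertwining relation `A ≼_M B` and relative amenability
are all defined below. -/

open scoped InnerProductSpace ComplexOrder

noncomputable section

namespace AFP

variable {H : Type*} [NormedAddCommGroup H] [InnerProductSpace ℂ H] [CompleteSpace H]

abbrev BH (H : Type*) [NormedAddCommGroup H] [InnerProductSpace ℂ H] [CompleteSpace H] :=
  H →L[ℂ] H

/-- A (self-adjoint) projection in `B(H)`. -/
def IsProjection (p : BH H) : Prop := IsSelfAdjoint p ∧ IsIdempotentElem p

/-- A map defined (at least) on `N ⊆ B(H)` is *normal* on `N` if it preserves suprema of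
upward-directed subsets of `N` (with respect to the Loewner order on `B(H)`). -/
def IsNormalOn (N : Set (BH H)) (Φ : BH H → BH H) : Prop :=
  ∀ S : Set (BH H), S ⊆ N → S.Nonempty → DirectedOn (· ≤ ·) S →
    ∀ x ∈ N, IsLUB S x → IsLUB (Φ '' S) (Φ x)

/-- A complex-valued functional is normal on `N` if it preserves suprema of upward-directed
subsets of `N` (using the standard partial order on `ℂ`). -/
def IsNormalFunctionalOn (N : Set (BH H)) (φ : BH H → ℂ) : Prop :=
  ∀ S : Set (BH H), S ⊆ N → S.Nonempty → DirectedOn (· ≤ ·) S →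
    ∀ x ∈ N, IsLUB S x → IsLUB (φ '' S) (φ x)

/-- A map is faithful on `N` if it kills no nonzero positive element of `N`. -/
def FaithfulOn (N : Set (BH H)) (Φ : BH H → BH H) : Prop :=
  ∀ x ∈ N, 0 ≤ x → Φ x = 0 → x = 0

/-- A conditional expectation from `N` onto `P ⊆ N` (as subsets of `B(H)`):
a unital positive `P`-bimodular projection of `N` onto `P`. -/
structure IsCondExp (N P : Set (BH H)) (Φ : BH H → BH H) : Prop where
  subset : P ⊆ N
  map_add : ∀ x ∈ N, ∀ y ∈ N, Φ (x + y) = Φ x + Φ y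
  map_smul : ∀ (c : ℂ), ∀ x ∈ N, Φ (c • x) = c • Φ x
  maps_to : ∀ x ∈ N, Φ x ∈ P
  fixes : ∀ x ∈ P, Φ x = x
  pos : ∀ x ∈ N, 0 ≤ x → 0 ≤ Φ x
  bimod : ∀ a ∈ P, ∀ b ∈ P, ∀ x ∈ N, Φ (a * x * b) = a * Φ x * b

/-- The inclusion `P ⊆ N` is *with expectation*: there is a faithful normal conditional
expectation of `N` onto `P`. -/
def WithExpectation (N P : Set (BH H)) : Prop :=
  ∃ Φ : BH H → BH H, IsCondExp N P Φ ∧ FaithfulOn N Φ ∧ IsNormalOn N Φ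

/-- σ-finiteness (countable decomposability) of a von Neumann algebra viewed as a subset
of `B(H)`: any family of pairwise orthogonal nonzero projections in it is countable. -/
def SigmaFinite (N : Set (BH H)) : Prop :=
  ∀ F : Set (BH H), F ⊆ N → (∀ p ∈ F, IsProjection p ∧ p ≠ 0) →
    (∀ p ∈ F, ∀ q ∈ F, p ≠ q → p * q = 0) → F.Countable

/-- Conjugation `T ↦ J T J` of a bounded operator by a conjugate-linear isometric involution. -/
def conjJ (J : H ≃ₗᵢ⋆[ℂ] H) (T : BH H) : BH H where
  toFun := fun ξ => J (T (J.symm ξ))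
  map_add' := by intro ξ η; simp
  map_smul' := by intro c ξ; simp [map_smulₛₗ]
  cont := J.continuous.comp (T.continuous.comp J.symm.continuous)

/-- Standard form data for a von Neumann algebra `M ⊆ B(H)`: the modular conjugation `J`
and the self-dual positive cone `L²(M)₊`, with their basic properties. -/
structure StandardForm (M : VonNeumannAlgebra H) where
  J : H ≃ₗᵢ⋆[ℂ] H
  cone : Set H
  J_involutive : ∀ ξ, J (J ξ) = ξ
  J_fixes_cone : ∀ ξ ∈ cone, J ξ = ξ
  commutant_eq : Set.centralizer (M : Set (BH H)) = conjJ J '' (M : Set (BH H))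
  selfdual : cone = {ξ : H | ∀ η ∈ cone, 0 ≤ ⟪ξ, η⟫_ℂ}
  cone_invariant : ∀ x ∈ (M : Set (BH H)), ∀ ξ ∈ cone, x (conjJ J x ξ) ∈ cone

/-- The Jones basic construction `⟨M, Q⟩ = (JQJ)'` associated with a subalgebra `Q ⊆ M`,
where `J` is the modular conjugation of `M` in its standard form `H = L²(M)`. -/
def basicConstruction (J : H ≃ₗᵢ⋆[ℂ] H) (Q : Set (BH H)) : Set (BH H) :=
  Set.centralizer (conjJ J '' Q)

/-- The corner `e N e` of a subset `N ⊆ B(H)` by a projection `e`. -/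
def Corner (e : BH H) (N : Set (BH H)) : Set (BH H) := {x | x ∈ N ∧ e * x * e = x}

/-- Popa's intertwining relation `A ≼_N C`: `A` embeds with expectation into `C` inside `N`.
There are projections `e ∈ A`, `f ∈ C`, a nonzero partial isometry `v ∈ eNf` and a unital
normal *-homomorphism `θ : eAe → fCf` such that `θ(eAe) ⊆ fCf` is with expectation and
`a v = v θ(a)` for all `a ∈ eAe`. -/
def EmbedsWE (N A C : Set (BH H)) : Prop :=
  ∃ (e f v : BH H) (θ : BH H → BH H),
    e ∈ A ∧ IsProjection e ∧
    f ∈ C ∧ IsProjection f ∧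
    v ∈ N ∧ v ≠ 0 ∧ v * star v * v = v ∧ e * v = v ∧ v * f = v ∧
    (∀ x ∈ Corner e A, θ x ∈ Corner f C) ∧
    (∀ x ∈ Corner e A, ∀ y ∈ Corner e A, θ (x + y) = θ x + θ y) ∧
    (∀ (c : ℂ), ∀ x ∈ Corner e A, θ (c • x) = c • θ x) ∧
    (∀ x ∈ Corner e A, ∀ y ∈ Corner e A, θ (x * y) = θ x * θ y) ∧
    (∀ x ∈ Corner e A, θ (star x) = star (θ x)) ∧
    θ e = f ∧
    IsNormalOn (Corner e A) θ ∧
    WithExpectation (Corner f C) (θ '' Corner e A) ∧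
    (∀ a ∈ Corner e A, a * v = v * θ a)

/-- Amalgamated free product structure `M = M₁ *_B M₂`: `M` is generated by `M₁` and `M₂`,
which both contain `B`, and `E : M → B` is a faithful normal conditional expectation with
respect to which `M₁` and `M₂` are freely independent with amalgamation over `B`
(`E` kills every reduced word with letters alternating between `ker E ∩ M₁` and
`ker E ∩ M₂`; `E` restricts to the given expectations `Eᵢ : Mᵢ → B`). -/
structure IsAFP (M M₁ M₂ B : VonNeumannAlgebra H) (E : BH H → BH H) : Prop where
  le₁ : (B : Set (BH H)) ⊆ (M₁ : Set (BH H))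
  le₂ : (B : Set (BH H)) ⊆ (M₂ : Set (BH H))
  le₁M : (M₁ : Set (BH H)) ⊆ (M : Set (BH H))
  le₂M : (M₂ : Set (BH H)) ⊆ (M : Set (BH H))
  generated : Set.centralizer (Set.centralizer ((M₁ : Set (BH H)) ∪ (M₂ : Set (BH H)))) = M
  condExp : IsCondExp (M : Set (BH H)) (B : Set (BH H)) E
  faithful : FaithfulOn (M : Set (BH H)) E
  normal : IsNormalOn (M : Set (BH H)) E
  free : ∀ (n : ℕ) (x : Fin n → BH H) (ι : Fin n → Bool), 0 < n →
    (∀ k, x k ∈ (if ι k then (M₁ : Set (BH H)) else (M₂ : Set (BH H))) ∧ E (x k) = 0) →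
    (∀ (k : ℕ) (h : k + 1 < n), ι ⟨k, Nat.lt_of_succ_lt h⟩ ≠ ι ⟨k + 1, h⟩) →
    E (List.ofFn x).prod = 0

/-- `P` is amenable relative to `Q` inside `M` (all sitting in `B(L²(M))`, `J` being the
modular conjugation of `M`): there is a conditional expectation `Φ : ⟨M, Q⟩ → P` whose
restriction to `M` is faithful and normal. -/
def AmenableRel (J : H ≃ₗᵢ⋆[ℂ] H) (Mset P Q : Set (BH H)) : Prop :=
  ∃ Φ : BH H → BH H, IsCondExp (basicConstruction J Q) P Φ ∧
    FaithfulOn Mset Φ ∧ IsNormalOn Mset Φ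

/-- Amenability (injectivity) of a von Neumann algebra `P ⊆ B(H)`: there is a conditional
expectation from all of `B(H)` onto `P`. -/
def IsAmenableVN (P : Set (BH H)) : Prop :=
  ∃ Φ : BH H → BH H, IsCondExp (Set.univ) P Φ

/-- A central projection of `N ⊆ B(H)`. -/
def IsCentralProjection (N : Set (BH H)) (z : BH H) : Prop :=
  IsProjection z ∧ z ∈ N ∧ ∀ x ∈ N, z * x = x * z

/-- An abelian projection of `N ⊆ B(H)`: `p N p` is commutative. -/
def IsAbelianProjection (N : Set (BH H)) (p : BH H) : Prop :=
  IsProjection p ∧ p ∈ N ∧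
    ∀ x ∈ N, ∀ y ∈ N, (p * x * p) * (p * y * p) = (p * y * p) * (p * x * p)

/-- A von Neumann algebra is of type I if every nonzero central projection dominates a
nonzero abelian projection. -/
def IsTypeI (N : Set (BH H)) : Prop :=
  ∀ z, IsCentralProjection N z → z ≠ 0 →
    ∃ p, IsAbelianProjection N p ∧ p ≠ 0 ∧ p * z = p

/-- `N` has no type I direct summand: no nonzero central corner of `N` is of type I. -/
def HasNoTypeIDirectSummand (N : Set (BH H)) : Prop :=
  ∀ z, IsCentralProjection N z → z ≠ 0 → ¬ IsTypeI (Corner z N)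

/-- Murray–von Neumann equivalence of projections inside `N`. -/
def MvNEquiv (N : Set (BH H)) (p q : BH H) : Prop :=
  ∃ v ∈ N, star v * v = p ∧ v * star v = q

/-- A finite projection of `N`: not equivalent to a proper subprojection of itself. -/
def IsFiniteProjection (N : Set (BH H)) (p : BH H) : Prop :=
  IsProjection p ∧ p ∈ N ∧
    ∀ q, IsProjection q → q ∈ N → q * p = q → MvNEquiv N p q → q = p

/-- A von Neumann algebra is semifinite if every nonzero central projection dominates a
nonzero finite projection. -/
def IsSemifiniteVN (N : Set (BH H)) : Prop :=
  ∀ z, IsCentralProjection N z → z ≠ 0 →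
    ∃ p, p ≠ 0 ∧ p * z = p ∧ IsFiniteProjection N p

/-- A von Neumann algebra is of type III if it has no nonzero finite projection. -/
def IsTypeIII (N : Set (BH H)) : Prop :=
  ∀ p, IsFiniteProjection N p → p = 0

abbrev pr (K : Submodule ℂ H) : BH H := K.topologicalClosure.starProjection

lemma pr_isProj (K : Submodule ℂ H) : IsProjection (pr K) :=
  ⟨(isStarProjection_starProjection).isSelfAdjoint, (isStarProjection_starProjection).isIdempotentElem⟩

lemma pr_fix {K : Submodule ℂ H} {x : H} (hx : x ∈ K) : pr K x = x :=
  Submodule.starProjection_eq_self_iff.mpr (K.le_topologicalClosure hx)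

lemma pr_mem (K : Submodule ℂ H) (x : H) : pr K x ∈ K.topologicalClosure :=
  Submodule.starProjection_apply_mem _ _

lemma kill_closure {G : Type*} [NormedAddCommGroup G] [NormedSpace ℂ G] {K : Submodule ℂ H} {z : H →L[ℂ] G} (hz : ∀ k ∈ K, z k = 0) {x : H}
    (hx : x ∈ K.topologicalClosure) : z x = 0 := by
  have h : K.topologicalClosure ≤ z.toLinearMap.ker := by
    apply Submodule.topologicalClosure_minimal
    · intro k hk; exact hz k hk
    · exact ContinuousLinearMap.isClosed_ker z
  exact h hx

lemma kill_pr {K : Submodule ℂ H} {z : BH H} (hz : ∀ k ∈ K, z k = 0) : z * pr K = 0 := by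
  ext x
  exact kill_closure hz (pr_mem K x)

lemma star_sa {x : BH H} (h : IsSelfAdjoint x) : star x = x := h

lemma pr_inv {K : Submodule ℂ H} {y : BH H} (hy : ∀ k ∈ K, y k ∈ K) : y * pr K = pr K * y * pr K := by
  have : (y - pr K * y) * pr K = 0 := by
    apply kill_pr
    intro k hk
    simp [pr_fix (hy k hk)]
  rw [sub_mul, sub_eq_zero] at this
  exact this

lemma pr_comm {K : Submodule ℂ H} {y : BH H} (hy : ∀ k ∈ K, y k ∈ K) (hy' : ∀ k ∈ K, star y k ∈ K) :
    Commute y (pr K) := by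
  have h1 := pr_inv hy
  have h2 := congrArg star (pr_inv hy')
  simp only [star_mul, star_star, star_sa (pr_isProj K).1] at h2
  rw [← mul_assoc] at h2
  show y * pr K = pr K * y
  rw [h1, ← h2]

lemma mem_vn {M : VonNeumannAlgebra H} {x : BH H}
    (h : ∀ y, (∀ m ∈ M, m * y = y * m) → y * x = x * y) : x ∈ M := by
  rw [← VonNeumannAlgebra.commutant_commutant M, VonNeumannAlgebra.mem_commutant_iff]
  intro g hg
  exact h g (VonNeumannAlgebra.mem_commutant_iff.mp hg)

lemma star_comm_of {M : VonNeumannAlgebra H} {y : BH H} (hy : ∀ m ∈ M, m * y = y * m) :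
    ∀ m ∈ M, m * star y = star y * m := by
  intro m hm
  have := congrArg star (hy (star m) (star_mem hm))
  simpa using this.symm

lemma pr_mem_vn {M : VonNeumannAlgebra H} {K : Submodule ℂ H}
    (h : ∀ y, (∀ m ∈ M, m * y = y * m) → ∀ k ∈ K, y k ∈ K) : pr K ∈ M := by
  apply mem_vn
  intro y hy
  exact pr_comm (h y hy) (h _ (star_comm_of hy))

lemma cfc_mem {M : VonNeumannAlgebra H} {a : BH H} (ha : a ∈ M) (hsa : IsSelfAdjoint a) (f : ℝ → ℝ) :
    cfc f a ∈ M := by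
  apply mem_vn
  intro y hy
  exact (IsSelfAdjoint.commute_cfc hsa (hy a ha) f).symm

lemma proj_nonneg {p : BH H} (hp : IsProjection p) : 0 ≤ p :=
  (IsStarProjection.mk hp.2 hp.1).nonneg

lemma proj_one_sub {p : BH H} (hp : IsProjection p) : IsProjection (1 - p) :=
  ⟨(IsStarProjection.mk hp.2 hp.1).one_sub.isSelfAdjoint, (IsStarProjection.mk hp.2 hp.1).one_sub.isIdempotentElem⟩

lemma proj_le_one {p : BH H} (hp : IsProjection p) : p ≤ 1 := by
  have := proj_nonneg (proj_one_sub hp)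
  exact sub_nonneg.mp this

lemma conj_nonneg' {a : BH H} (h : 0 ≤ a) (x : BH H) : 0 ≤ star x * a * x := star_left_conjugate_nonneg h x
lemma conj_nonneg {a : BH H} (h : 0 ≤ a) (x : BH H) : 0 ≤ x * a * star x := star_right_conjugate_nonneg h x

lemma inner_nonneg_of {a : BH H} (h : 0 ≤ a) (x : H) : 0 ≤ ⟪x, a x⟫_ℂ := by
  have := (ContinuousLinearMap.nonneg_iff_isPositive a).mp h
  exact this.inner_nonneg_right x

lemma re_nonneg_of {a : BH H} (h : 0 ≤ a) (x : H) : 0 ≤ (⟪x, a x⟫_ℂ).re := 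
  (Complex.le_def.mp (inner_nonneg_of h x)).1

lemma nonneg_of_inner {a : BH H} (h : ∀ x, 0 ≤ ⟪x, a x⟫_ℂ) : 0 ≤ a := by
  rw [ContinuousLinearMap.nonneg_iff_isPositive, ContinuousLinearMap.isPositive_iff_complex]
  intro x
  have h1 := h x
  rw [Complex.le_def] at h1
  have h2 : ⟪a x, x⟫_ℂ = (starRingEnd ℂ) ⟪x, a x⟫_ℂ := (inner_conj_symm _ _).symm
  have h3 : (⟪x, a x⟫_ℂ).im = 0 := h1.2.symm
  have h4 : 0 ≤ (⟪x, a x⟫_ℂ).re := h1.1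
  have h5 : (⟪a x, x⟫_ℂ).re = (⟪x, a x⟫_ℂ).re := by rw [h2]; rfl
  have h6 : (⟪a x, x⟫_ℂ).im = 0 := by rw [h2, Complex.conj_im, h3, neg_zero]
  constructor
  · apply Complex.ext <;> simp [h6]
  · simpa [h5] using h4

lemma nonneg_of_re {a : BH H} (hsa : IsSelfAdjoint a) (h : ∀ x, 0 ≤ (⟪x, a x⟫_ℂ).re) : 0 ≤ a := by
  apply nonneg_of_inner
  intro x
  rw [Complex.le_def]
  refine ⟨h x, ?_⟩
  have : (starRingEnd ℂ) ⟪x, a x⟫_ℂ = ⟪x, a x⟫_ℂ := by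
    rw [inner_conj_symm]
    have := hsa.isSymmetric x x
    exact this
  exact (Complex.conj_eq_iff_im.mp this).symm

lemma inner_star (a : BH H) (x y : H) : ⟪star a x, y⟫_ℂ = ⟪x, a y⟫_ℂ := by
  rw [ContinuousLinearMap.star_eq_adjoint]
  exact ContinuousLinearMap.adjoint_inner_left _ _ _

lemma inner_star' (a : BH H) (x y : H) : ⟪x, star a y⟫_ℂ = ⟪a x, y⟫_ℂ := by
  rw [ContinuousLinearMap.star_eq_adjoint]
  exact ContinuousLinearMap.adjoint_inner_right _ _ _

lemma proj_mul_eq_zero {p x : BH H} (hp : IsProjection p) (h : star x * p * x = 0) : p * x = 0 := by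
  have : star (p * x) * (p * x) = 0 := by
    rw [star_mul, star_sa hp.1]
    calc star x * p * (p * x) = star x * (p * p) * x := by noncomm_ring
      _ = 0 := by rw [hp.2.eq, h]
  exact CStarRing.star_mul_self_eq_zero_iff _ |>.mp this

lemma SP {a : BH H} (hsa : IsSelfAdjoint a) (t : ℝ) :
    ∃ s : BH H, IsProjection s ∧ (∀ y, Commute y a → Commute y s) ∧
      ((t : ℂ) • s ≤ s * a) ∧ ((1 - s) * a ≤ (t:ℂ) • (1 - s)) ∧
      (s = 0 → a ≤ (t:ℂ) • 1) ∧ cfc (fun r : ℝ => max (t - r) 0) a * s = 0 := by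
  set gp := cfc (fun r : ℝ => max (r - t) 0) a with hgp
  set gm := cfc (fun r : ℝ => max (t - r) 0) a with hgm
  have hpm : gm * gp = 0 := by
    rw [hgp, hgm, ← cfc_mul _ _ a]
    have : (fun x : ℝ => max (t - x) 0 * max (x - t) 0) = fun _ => 0 := by
      funext x
      rcases le_total x t with h | h
      · rw [max_eq_right (a := x - t) (by linarith), mul_zero]
      · rw [max_eq_right (a := t - x) (by linarith), zero_mul]
    rw [this]; exact cfc_const_zero ℝ a
  have hdiff : gp - gm = a - (t:ℂ) • 1 := by
    rw [hgp, hgm, ← cfc_sub _ _ a]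
    have : (fun x : ℝ => max (x - t) 0 - max (t - x) 0) = fun x => x - t := by
      funext x
      rcases le_total x t with h | h
      · rw [max_eq_right (a := x - t) (by linarith), max_eq_left (a := t - x) (by linarith)]; ring
      · rw [max_eq_right (a := t - x) (by linarith), max_eq_left (a := x - t) (by linarith)]; ring
    rw [this, cfc_sub (fun x : ℝ => x) (fun _ => t) a, cfc_id' ℝ a, cfc_const t a]
    congr 1
  have hgp0 : 0 ≤ gp := cfc_nonneg (fun x _ => le_max_right _ _)
  have hgm0 : 0 ≤ gm := cfc_nonneg (fun x _ => le_max_right _ _)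
  have gpsa : star gp = gp := (IsSelfAdjoint.of_nonneg hgp0)
  have gmsa : star gm = gm := (IsSelfAdjoint.of_nonneg hgm0)
  set s := pr gp.toLinearMap.range with hs
  have hsP := pr_isProj gp.toLinearMap.range
  have sgp : s * gp = gp := by
    ext x; exact pr_fix ⟨x, rfl⟩
  have gms : gm * s = 0 := by
    apply kill_pr
    rintro _ ⟨x, rfl⟩
    exact DFunLike.congr_fun hpm x
  have sgm : s * gm = 0 := by
    have := congrArg star gms
    rw [star_mul, gmsa, star_sa hsP.1, star_zero] at this
    exact this
  have ha : a = gp - gm + (t:ℂ) • 1 := by rw [hdiff]; simp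
  have e1 : s * a = gp + (t:ℂ) • s := by
    rw [ha, mul_add, mul_sub, sgp, sgm]; simp
  refine ⟨s, hsP, ?_, ?_, ?_, ?_, gms⟩
  · intro y hy
    have hy' : Commute (star y) a := by
      have := congrArg star hy.eq
      simp only [star_mul, star_sa hsa] at this
      exact this.symm
    have c1 : Commute y gp := (IsSelfAdjoint.commute_cfc hsa hy.symm _).symm
    have c2 : Commute (star y) gp := (IsSelfAdjoint.commute_cfc hsa hy'.symm _).symm
    apply pr_comm
    · rintro _ ⟨x, rfl⟩
      exact ⟨y x, (DFunLike.congr_fun c1.eq x).symm⟩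
    · rintro _ ⟨x, rfl⟩
      exact ⟨star y x, (DFunLike.congr_fun c2.eq x).symm⟩
  · rw [e1]; simpa using hgp0
  · have : (1 - s) * a = (t:ℂ) • (1 - s) - gm := by
      rw [sub_mul, one_mul, e1, ha]; simp [smul_sub]; abel
    rw [this]; simpa using hgm0
  · intro h0
    have : gp = 0 := by rw [← sgp, h0, zero_mul]
    rw [ha, this]; simpa using hgm0

lemma SP_mem {M : VonNeumannAlgebra H} {a s : BH H} (ha : a ∈ M)
    (hs : ∀ y, Commute y a → Commute y s) : s ∈ M := by
  apply mem_vn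
  intro y hy
  exact hs y (hy a ha).symm

lemma nonneg_smul {a : BH H} (h : 0 ≤ a) {t : ℝ} (ht : 0 ≤ t) : 0 ≤ (t:ℂ) • a :=
  smul_nonneg (by exact_mod_cast ht) h

lemma SP_supp {a s r : BH H} (t : ℝ) (ht : 0 < t) (hs : IsProjection s) (hr : IsProjection r)
    (h1 : (t:ℂ) • s ≤ s * a) (har : a * r = a) : r * s = s := by
  have hr' := proj_one_sub hr
  have h2 : 0 ≤ star (1 - r) * (s * a - (t:ℂ) • s) * (1 - r) := conj_nonneg' (sub_nonneg.mpr h1) _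
  have h0 : a * (1 - r) = 0 := by rw [mul_sub, har]; simp
  have h3 : star (1 - r) * (s * a - (t:ℂ) • s) * (1 - r) = - ((t:ℂ) • (star (1 - r) * s * (1 - r))) := by
    have : star (1 - r) * (s * a - (t:ℂ) • s) * (1 - r) = star (1-r) * s * (a * (1 - r)) - (t:ℂ) • (star (1 - r) * s * (1 - r)) := by
      simp only [mul_sub, sub_mul, smul_mul_assoc, mul_smul_comm, mul_assoc]
      simp only [smul_sub]; abel
    rw [this, h0]; simp
  have h4 : 0 ≤ star (1 - r) * s * (1 - r) := conj_nonneg' (proj_nonneg hs) _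
  rw [h3] at h2
  have h5 : (t:ℂ) • (star (1 - r) * s * (1 - r)) = 0 :=
    le_antisymm (by simpa using h2) (nonneg_smul h4 ht.le)
  have h6 := (smul_eq_zero.mp h5).resolve_left (by exact_mod_cast ht.ne')
  have h7 := proj_mul_eq_zero hs h6
  have h8 := congrArg star h7
  simp only [star_mul, star_sa hr'.1, star_sa hs.1, star_zero, sub_mul, one_mul] at h8
  exact (sub_eq_zero.mp h8).symm

lemma sa_of_nonneg {a : BH H} (h : 0 ≤ a) : IsSelfAdjoint a := IsSelfAdjoint.of_nonneg h

lemma le_one_mul_proj {a s : BH H} (h0 : 0 ≤ a) (hs : IsProjection s) (hc : Commute s a) :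
    0 ≤ s * a := by
  have := conj_nonneg h0 s
  rw [star_sa hs.1, hc.eq, mul_assoc, hs.2.eq, ← hc.eq] at this
  exact this

/-- dyadic principle -/
lemma dyadic {M : VonNeumannAlgebra H} {r : BH H} (hr : IsProjection r) (F : BH H → ℝ) (K : ℝ)
    (hF : ∀ s a, s ∈ M → a ∈ M → r * s = s → s * r = s → r * a = a → a * r = a → 
      (F s + F a) / 2 ≤ F ((1/2 : ℂ) • (s + a)))
    (hK : ∀ a ∈ M, r * a = a → a * r = a → 0 ≤ a → a ≤ 1 → - K ≤ F a)
    (hP : ∀ s ∈ M, IsProjection s → r * s = s → 0 ≤ F s) :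
    ∀ a ∈ M, r * a = a → 0 ≤ a → a ≤ 1 → 0 ≤ F a := by
  have key : ∀ n : ℕ, ∀ a ∈ M, r * a = a → 0 ≤ a → a ≤ 1 → - (K / 2 ^ n) ≤ F a := by
    intro n
    induction n with
    | zero =>
      intro a ha hra h0 h1
      have har : a * r = a := by
        have := congrArg star hra
        simpa [star_sa hr.1, star_sa (sa_of_nonneg h0)] using this
      simpa using hK a ha hra har h0 h1
    | succ n ih =>
      intro a ha hra h0 h1
      have har : a * r = a := by
        have := congrArg star hra
        simpa [star_sa hr.1, star_sa (sa_of_nonneg h0)] using this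
      obtain ⟨s, hs, hsc, hs1, hs2, -, -⟩ := SP (sa_of_nonneg h0) (1/2)
      have hsM := SP_mem ha hsc
      have hca : Commute s a := (hsc a (Commute.refl a)).symm
      have hrs : r * s = s := SP_supp (1/2) (by norm_num) hs hr hs1 har
      have hsr : s * r = s := by
        have := congrArg star hrs
        simpa [star_sa hr.1, star_sa hs.1] using this
      set a₁ := (2:ℂ) • a - s with ha₁
      have hb : a = (1/2 : ℂ) • (s + a₁) := by
        rw [ha₁]; simp [smul_smul]
      have hp1 : 0 ≤ a₁ := by
        have e : a₁ = (2:ℂ) • (s * a - ((1/2:ℝ):ℂ) • s) + (2:ℂ) • ((1 - s) * a) := by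
          rw [ha₁, smul_sub, smul_smul]; simp [sub_mul, smul_sub]
        rw [e]
        have q1 := nonneg_smul (sub_nonneg.mpr hs1) (t := 2) (by norm_num)
        have q2 := nonneg_smul (le_one_mul_proj h0 (proj_one_sub hs) ((Commute.one_left a).sub_left hca)) (t := 2) (by norm_num)
        exact_mod_cast add_nonneg q1 q2
      have hp2 : a₁ ≤ 1 := by
        have e : 1 - a₁ = (2:ℂ) • (s * (1 - a)) + (2:ℂ) • (((1/2:ℝ):ℂ) • (1 - s) - (1 - s) * a) := by
          rw [ha₁, smul_sub, smul_smul]; simp [sub_mul, smul_sub, mul_sub, two_smul]; abel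
        rw [← sub_nonneg, e]
        have q1 := nonneg_smul (sub_nonneg.mpr hs2) (t := 2) (by norm_num)
        have q2 := nonneg_smul (le_one_mul_proj (sub_nonneg.mpr h1) hs ((Commute.one_right s).sub_right hca)) (t := 2) (by norm_num)
        exact_mod_cast add_nonneg q2 q1
      have hM1 : a₁ ∈ M := sub_mem (M.smul_mem ha _) hsM
      have hr1 : r * a₁ = a₁ := by rw [ha₁, mul_sub, mul_smul_comm, hra, hrs]
      have h1r : a₁ * r = a₁ := by rw [ha₁, sub_mul, smul_mul_assoc, har, hsr]
      have i1 := ih a₁ hM1 hr1 hp1 hp2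
      have i2 := hP s hsM hs hrs
      have i3 := hF s a₁ hsM hM1 hrs hsr hr1 h1r
      rw [← hb] at i3
      have : K / 2^(n+1) = (K / 2^n)/2 := by rw [pow_succ]; field_simp
      rw [this]; linarith
  intro a ha hra h0 h1
  have lim : Filter.Tendsto (fun n : ℕ => -(K / 2 ^ n)) Filter.atTop (nhds 0) := by
    have : Filter.Tendsto (fun n : ℕ => K * (1/2:ℝ) ^ n) Filter.atTop (nhds (K * 0)) :=
      (tendsto_pow_atTop_nhds_zero_of_lt_one (by norm_num) (by norm_num)).const_mul K
    simp only [mul_zero] at this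
    have h := this.neg
    simp only [neg_zero] at h
    refine h.congr (fun n => ?_)
    simp [div_eq_mul_inv]
  exact le_of_tendsto' lim (fun n => key n a ha hra h0 h1)

lemma norm_le_of_le {a : BH H} {t : ℝ} (ht : 0 ≤ t) (h0 : 0 ≤ a) (h : a ≤ (t:ℂ) • 1) : ‖a‖ ≤ t := by
  rw [CStarAlgebra.norm_le_iff_le_algebraMap a ht h0, Algebra.algebraMap_eq_smul_one]
  exact h

lemma le_norm {a : BH H} (h0 : IsSelfAdjoint a) : a ≤ (‖a‖:ℂ) • 1 := by
  have := h0.le_algebraMap_norm_self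
  rw [Algebra.algebraMap_eq_smul_one] at this
  exact this

lemma PI {M : VonNeumannAlgebra H} {x : BH H} (hx : x ∈ M) (hx0 : x ≠ 0) :
    ∃ v ∈ M, IsProjection (star v * v) ∧ v ≠ 0 ∧ (∀ h, h * x = x → h * v = v) ∧
      (∀ k, IsSelfAdjoint k → x * k = x → v * k = v) := by
  set a := star x * x with ha
  have haM : a ∈ M := mul_mem (star_mem hx) hx
  have ha0 : 0 ≤ a := star_mul_self_nonneg x
  have hsa := sa_of_nonneg ha0
  have hane : a ≠ 0 := fun h => hx0 (CStarRing.star_mul_self_eq_zero_iff x |>.mp h)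
  have hn : 0 < ‖a‖ := norm_pos_iff.mpr hane
  set t := ‖a‖ / 2 with ht
  have ht0 : 0 < t := by positivity
  obtain ⟨s, hs, hsc, hs1, hs2, hs3, hs4⟩ := SP hsa t
  have hsM := SP_mem haM hsc
  have hsne : s ≠ 0 := by
    intro h
    have := norm_le_of_le ht0.le ha0 (hs3 h)
    rw [ht] at this; linarith
  set w := cfc (fun r : ℝ => (Real.sqrt (max r t))⁻¹) a with hw
  have hmax : ∀ r : ℝ, 0 < max r t := fun r => lt_max_of_lt_right ht0
  have hcont : Continuous (fun r : ℝ => (Real.sqrt (max r t))⁻¹) := by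
    apply Continuous.inv₀ (by fun_prop)
    intro r
    exact (Real.sqrt_pos.mpr (hmax r)).ne'
  have hwsa : star w = w := (cfc_predicate (p := IsSelfAdjoint) (fun r : ℝ => (Real.sqrt (max r t))⁻¹) a : IsSelfAdjoint _)
  have hwM : w ∈ M := cfc_mem haM hsa _
  have hwa : ∀ y, Commute y a → Commute y w := fun y hy => (IsSelfAdjoint.commute_cfc hsa hy.symm _).symm
  have hcont2 : Continuous (fun r : ℝ => (max r t)⁻¹) := by
    apply Continuous.inv₀ (by fun_prop)
    intro r
    exact (hmax r).ne'
  have hwaw : 1 - w * a * w = cfc (fun r : ℝ => (max r t)⁻¹) a * cfc (fun r : ℝ => max (t - r) 0) a := by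
    have e1 : w * a * w = cfc (fun r : ℝ => (Real.sqrt (max r t))⁻¹ * r * (Real.sqrt (max r t))⁻¹) a := by
      rw [cfc_mul (fun r : ℝ => (Real.sqrt (max r t))⁻¹ * r) (fun r : ℝ => (Real.sqrt (max r t))⁻¹) a (hcont.mul continuous_id).continuousOn hcont.continuousOn, cfc_mul (fun r : ℝ => (Real.sqrt (max r t))⁻¹) (fun r => r) a hcont.continuousOn continuous_id.continuousOn, cfc_id' ℝ a]
    rw [e1, ← cfc_mul _ _ a hcont2.continuousOn (by fun_prop), ← cfc_const_one ℝ a, ← cfc_sub (fun _ => 1) (fun r : ℝ => (Real.sqrt (max r t))⁻¹ * r * (Real.sqrt (max r t))⁻¹) a (by fun_prop) ((hcont.mul continuous_id).mul hcont).continuousOn]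
    congr 1
    funext r
    have h1 : (Real.sqrt (max r t))⁻¹ * r * (Real.sqrt (max r t))⁻¹ = r / max r t := by
      have := Real.mul_self_sqrt (hmax r).le
      have h3 := (hmax r).ne'
      have h4 := (Real.sqrt_pos.mpr (hmax r)).ne'
      field_simp
      rw [sq, this, mul_comm]
    rw [h1]
    rcases le_total r t with h | h
    · rw [max_eq_right h, max_eq_left (a := t - r) (by linarith)]
      field_simp
    · rw [max_eq_left h, max_eq_right (a := t - r) (by linarith)]
      have : r ≠ 0 := by linarith
      field_simp; simp
  have hws : w * a * w * s = s := by
    have : (1 - w * a * w) * s = 0 := by rw [hwaw, mul_assoc, hs4, mul_zero]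
    rw [sub_mul, one_mul, sub_eq_zero] at this
    exact this.symm
  have hvv : star (x * w * s) * (x * w * s) = s := by
    rw [star_mul, star_mul, hwsa, star_sa hs.1]
    calc s * (w * star x) * (x * w * s) = s * (w * (star x * x) * w * s) := by noncomm_ring
      _ = s * s := by rw [← ha, hws]
      _ = s := hs.2.eq
  refine ⟨x * w * s, mul_mem (mul_mem hx hwM) hsM, ?_, ?_, ?_, ?_⟩
  · rw [hvv]; exact hs
  · intro h
    rw [h] at hvv
    simp at hvv
    exact hsne hvv.symm
  · intro h hh
    rw [← mul_assoc, ← mul_assoc, hh]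
  · intro k hk hxk
    have hka : Commute k a := by
      have h1 : a * k = a := by rw [ha, mul_assoc, hxk]
      have h2 := congrArg star h1
      rw [star_mul, star_sa hk, star_sa hsa] at h2
      show k * a = a * k
      rw [h1, h2]
    rw [mul_assoc, ← (hsc k hka).eq, ← mul_assoc, mul_assoc x, ← (hwa k hka).eq, ← mul_assoc, hxk]

/-- projection order -/
lemma proj_le_iff {p q : BH H} (hp : IsProjection p) (hq : IsProjection q) : p ≤ q ↔ q * p = p := by
  constructor
  · intro h
    have h1 := conj_nonneg' (sub_nonneg.mpr h) (1 - q)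
    have hq' := proj_one_sub hq
    have h2 : star (1 - q) * (q - p) * (1 - q) = - (star (1 - q) * p * (1 - q)) := by
      rw [star_sa hq'.1]
      have : q * (1 - q) = 0 := by rw [mul_sub, hq.2.eq]; simp
      have h3 : (1 - q) * (q - p) * (1 - q) = (1 - q) * (q * (1 - q)) - (1 - q) * p * (1 - q) := by noncomm_ring
      rw [h3, this]; simp
    rw [h2] at h1
    have h3 := conj_nonneg' (proj_nonneg hp) (1 - q)
    have h4 : star (1 - q) * p * (1 - q) = 0 := le_antisymm (by simpa using h1) h3
    have h5 := proj_mul_eq_zero hp h4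
    have h6 := congrArg star h5
    simp only [star_mul, star_sa hq'.1, star_sa hp.1, star_zero, sub_mul, one_mul] at h6
    exact (sub_eq_zero.mp h6).symm
  · intro h
    have h2 := congrArg star h
    rw [star_mul, star_sa hp.1, star_sa hq.1] at h2
    have : IsProjection (q - p) := by
      refine ⟨hq.1.sub hp.1, ?_⟩
      show (q - p) * (q - p) = q - p
      rw [sub_mul, mul_sub, mul_sub, hq.2.eq, hp.2.eq, h, h2]; abel
    exact sub_nonneg.mp (proj_nonneg this)

lemma proj_mul_comm_of {p q : BH H} (hp : IsProjection p) (hq : IsProjection q) (h : q * p = p) : p * q = p := by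
  have h2 := congrArg star h
  rwa [star_mul, star_sa hp.1, star_sa hq.1] at h2

lemma proj_sub {p q : BH H} (hp : IsProjection p) (hq : IsProjection q) (h : q * p = p) : IsProjection (q - p) := by
  refine ⟨hq.1.sub hp.1, ?_⟩
  show (q - p) * (q - p) = q - p
  rw [sub_mul, mul_sub, mul_sub, hq.2.eq, hp.2.eq, h, proj_mul_comm_of hp hq h]; abel

lemma proj_add {p q : BH H} (hp : IsProjection p) (hq : IsProjection q) (h : q * p = 0) : IsProjection (q + p) := by
  have h2 := congrArg star h
  rw [star_mul, star_sa hp.1, star_sa hq.1, star_zero] at h2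
  refine ⟨hq.1.add hp.1, ?_⟩
  show (q + p) * (q + p) = q + p
  rw [add_mul, mul_add, mul_add, hq.2.eq, hp.2.eq, h, h2]; abel

/-- sup of a directed set of projections -/
lemma proj_sup {M : VonNeumannAlgebra H} {S : Set (BH H)} (hS : ∀ p ∈ S, IsProjection p ∧ p ∈ M)
    (hne : S.Nonempty) (hdir : DirectedOn (· ≤ ·) S) :
    ∃ q ∈ M, IsProjection q ∧ (∀ p ∈ S, p ≤ q) ∧ IsLUB S q := by
  set K : Submodule ℂ H := ⨆ p ∈ S, (p : BH H).toLinearMap.range with hK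
  have hpr := pr_isProj K
  have hle : ∀ p ∈ S, p ≤ pr K := by
    intro p hp
    rw [proj_le_iff (hS p hp).1 hpr]
    ext x
    apply pr_fix
    apply Submodule.mem_iSup_of_mem p
    apply Submodule.mem_iSup_of_mem hp
    exact ⟨x, rfl⟩
  refine ⟨pr K, ?_, hpr, hle, hle, ?_⟩
  · apply pr_mem_vn
    intro y hy
    have : K ≤ K.comap y.toLinearMap := by
      conv_lhs => rw [hK]
      apply iSup₂_le
      rintro p hp _ ⟨x, rfl⟩
      show y (p x) ∈ K
      have := DFunLike.congr_fun (hy p (hS p hp).2) x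
      change p (y x) = y (p x) at this
      rw [← this]
      apply Submodule.mem_iSup_of_mem p
      apply Submodule.mem_iSup_of_mem hp
      exact ⟨y x, rfl⟩
    exact this
  · intro u hu
    obtain ⟨p₀, hp₀⟩ := hne
    -- u is self-adjoint, for k in K, eventually p k = k
    have hu0 : 0 ≤ u := le_trans (proj_nonneg (hS p₀ hp₀).1) (hu hp₀)
    have husa := sa_of_nonneg hu0
    have hKd : ∀ k ∈ K, ∃ p ∈ S, p k = k := by
      intro k hk
      rw [hK, iSup_subtype'] at hk
      haveI : Nonempty S := ⟨⟨p₀, hp₀⟩⟩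
      rw [Submodule.mem_iSup_of_directed] at hk
      · obtain ⟨⟨p, hp⟩, x, rfl⟩ := hk
        exact ⟨p, hp, DFunLike.congr_fun (hS p hp).1.2.eq x⟩
      · rintro ⟨p, hp⟩ ⟨q, hq⟩
        obtain ⟨r, hr, h1, h2⟩ := hdir p hp q hq
        refine ⟨⟨r, hr⟩, ?_, ?_⟩
        · rintro _ ⟨x, rfl⟩
          exact ⟨p x, DFunLike.congr_fun ((proj_le_iff (hS p hp).1 (hS r hr).1).mp h1) x⟩
        · rintro _ ⟨x, rfl⟩
          exact ⟨q x, DFunLike.congr_fun ((proj_le_iff (hS q hq).1 (hS r hr).1).mp h2) x⟩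
    -- for each x, ⟨x, u x⟩ ≥ ⟨x,p x⟩ = ‖p x‖², p x → pr K x
    rw [← sub_nonneg]
    apply nonneg_of_re (husa.sub hpr.1)
    intro x
    apply le_of_forall_pos_lt_add
    intro ε hε
    have hcl : pr K x ∈ closure (K : Set H) := by
      have := pr_mem K x; rwa [← SetLike.mem_coe, Submodule.topologicalClosure_coe] at this
    have hpk : ∀ ε > 0, ∃ p ∈ S, ‖pr K x - p x‖ < ε := by
      intro ε hε
      obtain ⟨k, hk, hkd⟩ := Metric.mem_closure_iff.mp hcl ε hε
      obtain ⟨p, hp, hpk⟩ := hKd k hk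
      refine ⟨p, hp, ?_⟩
      -- p x = p (pr K x), minimal distance
      have hpp : p * pr K = p := proj_mul_comm_of (hS p hp).1 hpr ((proj_le_iff (hS p hp).1 hpr).mp (hle p hp))
      have e : pr K x - p x = (1 - p) (pr K x - k) := by
        have h1 : p (pr K x) = p x := DFunLike.congr_fun hpp x
        simp [map_sub, h1, hpk]
      rw [e]
      calc ‖(1 - p) (pr K x - k)‖ ≤ ‖(1 - p)‖ * ‖pr K x - k‖ := ContinuousLinearMap.le_opNorm _ _
        _ ≤ 1 * ‖pr K x - k‖ := by
          gcongr
          apply norm_le_of_le zero_le_one (proj_nonneg (proj_one_sub (hS p hp).1))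
          simpa using proj_le_one (proj_one_sub (hS p hp).1)
        _ < ε := by rw [one_mul, ← dist_eq_norm]; exact hkd
    obtain ⟨p, hp, hpx⟩ := hpk (ε / (‖x‖ + 1)) (by positivity)
    have h1 := re_nonneg_of (sub_nonneg.mpr (hu hp)) x
    have h2 : (⟪x, (u - pr K) x⟫_ℂ).re = (⟪x, (u - p) x⟫_ℂ).re - (⟪x, pr K x - p x⟫_ℂ).re := by
      simp [inner_sub_right]
    have h3 : (⟪x, pr K x - p x⟫_ℂ).re < ε := by
      calc _ ≤ ‖⟪x, pr K x - p x⟫_ℂ‖ := Complex.re_le_norm _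
        _ ≤ ‖x‖ * ‖pr K x - p x‖ := norm_inner_le_norm _ _
        _ ≤ ‖x‖ * (ε / (‖x‖ + 1)) := by gcongr
        _ < ε := by
          rw [mul_div_assoc', div_lt_iff₀ (by positivity)]
          nlinarith
    linarith

section CondExp
variable {N : VonNeumannAlgebra H} {P : VonNeumannAlgebra H} {Φ : BH H → BH H}

lemma ce_zero (h : IsCondExp (N : Set (BH H)) P Φ) : Φ 0 = 0 := h.fixes 0 (zero_mem P)
lemma ce_one (h : IsCondExp (N : Set (BH H)) P Φ) : Φ 1 = 1 := h.fixes 1 (one_mem P)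
lemma ce_neg (h : IsCondExp (N : Set (BH H)) P Φ) {x : BH H} (hx : x ∈ N) : Φ (-x) = - Φ x := by
  have := h.map_smul (-1) x hx
  simpa using this
lemma ce_sub (h : IsCondExp (N : Set (BH H)) P Φ) {x y : BH H} (hx : x ∈ N) (hy : y ∈ N) :
    Φ (x - y) = Φ x - Φ y := by
  rw [sub_eq_add_neg, h.map_add x hx (-y) (neg_mem hy), ce_neg h hy, sub_eq_add_neg]
lemma ce_mono (h : IsCondExp (N : Set (BH H)) P Φ) {x y : BH H} (hx : x ∈ N) (hy : y ∈ N) (hxy : x ≤ y) :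
    Φ x ≤ Φ y := by
  rw [← sub_nonneg, ← ce_sub h hy hx]
  exact h.pos _ (sub_mem hy hx) (sub_nonneg.mpr hxy)
lemma ce_sum (h : IsCondExp (N : Set (BH H)) P Φ) {ι : Type*} (s : Finset ι) (f : ι → BH H)
    (hf : ∀ i ∈ s, f i ∈ N) : Φ (∑ i ∈ s, f i) = ∑ i ∈ s, Φ (f i) := by
  classical
  induction s using Finset.induction_on with
  | empty => simpa using ce_zero h
  | insert a s ha ih =>
    rw [Finset.sum_insert ha, Finset.sum_insert ha, h.map_add _ (hf a (by simp)) _ (sum_mem (fun i hi => hf i (by simp [hi]))),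
      ih (fun i hi => hf i (by simp [hi]))]
lemma ce_left (h : IsCondExp (N : Set (BH H)) P Φ) {a x : BH H} (ha : a ∈ P) (hx : x ∈ N) :
    Φ (a * x) = a * Φ x := by
  have := h.bimod a ha 1 (one_mem P) x hx
  simpa using this
lemma ce_right (h : IsCondExp (N : Set (BH H)) P Φ) {b x : BH H} (hb : b ∈ P) (hx : x ∈ N) :
    Φ (x * b) = Φ x * b := by
  have := h.bimod 1 (one_mem P) b hb x hx
  simpa using this
lemma ce_sa (h : IsCondExp (N : Set (BH H)) P Φ) {x : BH H} (hx : x ∈ N) (hsa : IsSelfAdjoint x) :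
    IsSelfAdjoint (Φ x) := by
  have h1 : (‖x‖:ℂ) • (1 : BH H) ∈ N := N.smul_mem (one_mem N) _
  have h2 := h.pos _ (sub_mem h1 hx) (sub_nonneg.mpr (le_norm hsa))
  rw [ce_sub h h1 hx, h.map_smul _ _ (one_mem N), ce_one h] at h2
  have h3 := sa_of_nonneg h2
  have h4 : IsSelfAdjoint ((‖x‖:ℂ) • (1 : BH H)) := by
    show star _ = _
    simp [star_smul]
  have := h4.sub h3
  simpa using this
lemma ce_star (h : IsCondExp (N : Set (BH H)) P Φ) {x : BH H} (hx : x ∈ N) : Φ (star x) = star (Φ x) := by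
  have hs := star_mem hx
  have e1 := ce_sa h (add_mem hx hs) (show star (x + star x) = x + star x by simp [add_comm])
  have e2 := ce_sa h (N.smul_mem (sub_mem hx hs) Complex.I) 
    (show star (Complex.I • (x - star x)) = Complex.I • (x - star x) by simp [star_smul, smul_sub]; abel)
  rw [h.map_add x hx _ hs] at e1
  rw [h.map_smul _ _ (sub_mem hx hs), ce_sub h hx hs] at e2
  have e1' := e1.star_eq
  have e2' := e2.star_eq
  simp only [star_add, star_sub, star_smul] at e1' e2'
  have e3 : star (Φ x) - star (Φ (star x)) = -(Φ x - Φ (star x)) := by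
    have h1 : star Complex.I = -Complex.I := Complex.conj_I
    rw [h1] at e2'
    have h2 := congrArg (fun z => Complex.I • z) e2'
    simp only [smul_smul, neg_smul, mul_neg, smul_neg, Complex.I_mul_I, neg_neg, one_smul] at h2
    rw [h2]
  have e4 : (2:ℂ) • Φ (star x) = (2:ℂ) • star (Φ x) := by
    rw [two_smul, two_smul]
    have a1 : star (Φ (star x)) = Φ x + Φ (star x) - star (Φ x) := by rw [← e1']; abel
    rw [a1] at e3
    have : star (Φ x) + star (Φ x) = (star (Φ x) - (Φ x + Φ (star x) - star (Φ x))) + (Φ x + Φ (star x)) := by abel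
    rw [this, e3]; abel
  exact smul_right_injective _ (two_ne_zero) e4
lemma ce_norm_sa (h : IsCondExp (N : Set (BH H)) P Φ) {x : BH H} (hx : x ∈ N) (hsa : IsSelfAdjoint x) :
    Φ x ≤ (‖x‖:ℂ) • 1 := by
  have h1 : (‖x‖:ℂ) • (1 : BH H) ∈ N := N.smul_mem (one_mem N) _
  have := ce_mono h hx h1 (le_norm hsa)
  rwa [h.map_smul _ _ (one_mem N), ce_one h] at this
/-- Kadison–Schwarz for conditional expectations -/
lemma ce_schwarz (h : IsCondExp (N : Set (BH H)) P Φ) {x : BH H} (hx : x ∈ N) :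
    star (Φ x) * Φ x ≤ Φ (star x * x) := by
  have hP := h.maps_to x hx
  have hN := h.subset hP
  have h1 := h.pos _ (mul_mem (star_mem (sub_mem hx hN)) (sub_mem hx hN)) (star_mul_self_nonneg (x - Φ x))
  have e : star (x - Φ x) * (x - Φ x) = star x * x - star x * Φ x - star (Φ x) * x + star (Φ x) * Φ x := by
    rw [star_sub]; noncomm_ring
  have m1 : star x * x ∈ N := mul_mem (star_mem hx) hx
  have m2 : star x * Φ x ∈ N := mul_mem (star_mem hx) hN
  have m3 : star (Φ x) * x ∈ N := mul_mem (star_mem hN) hx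
  have m4 : star (Φ x) * Φ x ∈ N := mul_mem (star_mem hN) hN
  rw [e, h.map_add _ (sub_mem (sub_mem m1 m2) m3) _ m4, ce_sub h (sub_mem m1 m2) m3, ce_sub h m1 m2,
    ce_right h hP (star_mem hx), ce_left h (star_mem hP) hx, ce_star h hx,
    h.fixes _ (mul_mem (star_mem hP) hP)] at h1
  rw [← sub_nonneg]
  convert h1 using 1
  abel
lemma ce_norm (h : IsCondExp (N : Set (BH H)) P Φ) {x : BH H} (hx : x ∈ N) : ‖Φ x‖ ≤ ‖x‖ := by
  have h1 := ce_schwarz h hx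
  have h2 := ce_norm_sa h (mul_mem (star_mem hx) hx) (IsSelfAdjoint.star_mul_self x)
  have h3 := norm_le_of_le (norm_nonneg _) (star_mul_self_nonneg (Φ x)) (h1.trans h2)
  rw [CStarRing.norm_star_mul_self, CStarRing.norm_star_mul_self] at h3
  nlinarith [norm_nonneg x, norm_nonneg (Φ x)]
end CondExp

lemma op_of_form (L : H → H → ℂ) (C : ℝ)
    (h1 : ∀ x x' y, L (x + x') y = L x y + L x' y) (h2 : ∀ (c : ℂ) x y, L (c • x) y = (starRingEnd ℂ) c * L x y)
    (h3 : ∀ x y y', L x (y + y') = L x y + L x y') (h4 : ∀ (c : ℂ) x y, L x (c • y) = c * L x y)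
    (hb : ∀ x y, ‖L x y‖ ≤ C * ‖x‖ * ‖y‖) : ∃ R : BH H, ∀ x y, ⟪x, R y⟫_ℂ = L x y := by
  let B : H →L⋆[ℂ] H →L[ℂ] ℂ := LinearMap.mkContinuous₂ (LinearMap.mk₂'ₛₗ (starRingEnd ℂ) (RingHom.id ℂ) L h1 h2 h3 h4) C hb
  refine ⟨star (InnerProductSpace.continuousLinearMapOfBilin B), fun x y => ?_⟩
  rw [inner_star', InnerProductSpace.continuousLinearMapOfBilin_apply]
  rfl

lemma norm_le_of_form {R : BH H} {C : ℝ} (hC : 0 ≤ C) (hb : ∀ x y, ‖⟪x, R y⟫_ℂ‖ ≤ C * ‖x‖ * ‖y‖) : ‖R‖ ≤ C := by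
  apply ContinuousLinearMap.opNorm_le_bound _ hC
  intro y
  have := hb (R y) y
  rw [inner_self_eq_norm_sq_to_K] at this
  simp only [Complex.coe_algebraMap, norm_pow, Complex.norm_real, norm_norm] at this
  by_cases h : ‖R y‖ = 0
  · rw [h]; positivity
  · have hp : 0 < ‖R y‖ := lt_of_le_of_ne (norm_nonneg _) (Ne.symm h)
    nlinarith

lemma uf_lim {ι : Type*} (U : Ultrafilter ι) (T : ι → BH H) (C : ℝ) (hC : ∀ i, ‖T i‖ ≤ C) :
    ∃ R : BH H, ‖R‖ ≤ C ∧ ∀ x y, Filter.Tendsto (fun i => ⟪x, T i y⟫_ℂ) U (nhds ⟪x, R y⟫_ℂ) := by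
  have hC0 : 0 ≤ C := by
    obtain ⟨i⟩ := U.neBot.nonempty
    exact (norm_nonneg _).trans (hC i)
  have hbd : ∀ x y i, ‖⟪x, T i y⟫_ℂ‖ ≤ C * ‖x‖ * ‖y‖ := by
    intro x y i
    calc ‖⟪x, T i y⟫_ℂ‖ ≤ ‖x‖ * ‖T i y‖ := norm_inner_le_norm _ _
      _ ≤ ‖x‖ * (C * ‖y‖) := by
        gcongr
        exact (ContinuousLinearMap.le_opNorm _ _).trans (by gcongr; exact hC i)
      _ = _ := by ring
  have hex : ∀ x y, ∃ l : ℂ, ‖l‖ ≤ C * ‖x‖ * ‖y‖ ∧ Filter.Tendsto (fun i => ⟪x, T i y⟫_ℂ) U (nhds l) := by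
    intro x y
    have hcpt := isCompact_closedBall (0:ℂ) (C * ‖x‖ * ‖y‖)
    obtain ⟨l, hl, hlim⟩ := hcpt.ultrafilter_le_nhds (U.map (fun i => ⟪x, T i y⟫_ℂ)) (by
      rw [Filter.le_principal_iff]
      apply Filter.mem_map.mpr
      apply Filter.mem_of_superset Filter.univ_mem
      intro i _
      simpa using hbd x y i)
    exact ⟨l, by simpa using hl, hlim⟩
  choose L hL1 hL2 using hex
  obtain ⟨R, hR⟩ := op_of_form L C
    (fun x x' y => tendsto_nhds_unique (hL2 _ _) (((hL2 x y).add (hL2 x' y)).congr (fun i => by rw [inner_add_left])))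
    (fun c x y => tendsto_nhds_unique (hL2 _ _) (((hL2 x y).const_mul _).congr (fun i => by rw [inner_smul_left])))
    (fun x y y' => tendsto_nhds_unique (hL2 _ _) (((hL2 x y).add (hL2 x y')).congr (fun i => by rw [map_add, inner_add_right])))
    (fun c x y => tendsto_nhds_unique (hL2 _ _) (((hL2 x y).const_mul _).congr (fun i => by rw [map_smul, inner_smul_right])))
    hL1
  refine ⟨R, norm_le_of_form hC0 (fun x y => by rw [hR]; exact hL1 x y), fun x y => ?_⟩
  rw [hR]; exact hL2 x y

lemma eq_of_inner {R T : BH H} (h : ∀ x y, ⟪x, R y⟫_ℂ = ⟪x, T y⟫_ℂ) : R = T := by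
  ext y
  exact ext_inner_left ℂ (fun x => h x y)

lemma lim_mem_vn {ι : Type*} {M : VonNeumannAlgebra H} {U : Filter ι} [U.NeBot] {T : ι → BH H} {R : BH H}
    (hT : ∀ i, T i ∈ M) (h : ∀ x y, Filter.Tendsto (fun i => ⟪x, T i y⟫_ℂ) U (nhds ⟪x, R y⟫_ℂ)) : R ∈ M := by
  apply mem_vn
  intro y hy
  apply eq_of_inner
  intro u v
  have h1 := h (star y u) v
  have h2 := h u (y v)
  have : (fun i => ⟪star y u, T i v⟫_ℂ) = fun i => ⟪u, T i (y v)⟫_ℂ := by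
    funext i
    rw [inner_star]
    have := DFunLike.congr_fun (hy (T i) (hT i)) v
    change T i (y v) = y (T i v) at this
    rw [this]
  rw [this] at h1
  have h3 := tendsto_nhds_unique h1 h2
  rw [inner_star] at h3
  exact h3

lemma inner_re_mono {a b : BH H} (h : a ≤ b) (x : H) : (⟪x, a x⟫_ℂ).re ≤ (⟪x, b x⟫_ℂ).re := by
  have := re_nonneg_of (sub_nonneg.mpr h) x
  simp [inner_sub_right] at this
  linarith

lemma lub_approx {S : Set (BH H)} (hne : S.Nonempty) (hdir : DirectedOn (· ≤ ·) S) (h0 : ∀ a ∈ S, 0 ≤ a)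
    {T : BH H} (hT : IsLUB S T) (ξ : H) {ε : ℝ} (hε : 0 < ε) :
    ∃ a ∈ S, (⟪ξ, T ξ⟫_ℂ).re < (⟪ξ, a ξ⟫_ℂ).re + ε := by
  haveI : Nonempty S := hne.to_subtype
  haveI : IsDirected S (· ≤ ·) := ⟨fun a b => by
    obtain ⟨c, hc, h1, h2⟩ := hdir a a.2 b b.2
    exact ⟨⟨c, hc⟩, h1, h2⟩⟩
  let U : Ultrafilter S := Ultrafilter.of Filter.atTop
  have hU : (U : Filter S) ≤ Filter.atTop := Ultrafilter.of_le _
  obtain ⟨R, -, hR⟩ := uf_lim U (fun a => (a : BH H)) ‖T‖ (by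
    intro a
    apply norm_le_of_le (norm_nonneg _) (h0 a a.2)
    have hTp : 0 ≤ T := (h0 a a.2).trans (hT.1 a.2)
    exact (hT.1 a.2).trans (le_norm (sa_of_nonneg hTp)))
  have hub : ∀ a ∈ S, a ≤ R := by
    intro a ha
    rw [← sub_nonneg]
    apply nonneg_of_inner
    intro x
    have h1 : Filter.Tendsto (fun b : S => ⟪x, ((b : BH H) - a) x⟫_ℂ) U (nhds ⟪x, (R - a) x⟫_ℂ) := by
      simp only [ContinuousLinearMap.sub_apply, inner_sub_right]
      exact (hR x x).sub tendsto_const_nhds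
    apply ge_of_tendsto h1
    apply hU
    filter_upwards [Filter.eventually_ge_atTop (⟨a, ha⟩ : S)] with b hb
    have hb' : a ≤ (b : BH H) := hb
    exact inner_nonneg_of (sub_nonneg.mpr hb') x
  have hle := hT.2 hub
  have h2 := inner_re_mono hle ξ
  have h3 : Filter.Tendsto (fun b : S => (⟪ξ, (b : BH H) ξ⟫_ℂ).re) U (nhds (⟪ξ, R ξ⟫_ℂ).re) :=
    (Complex.continuous_re.tendsto _).comp (hR ξ ξ)
  have h4 := h3.eventually (lt_mem_nhds (show (⟪ξ, R ξ⟫_ℂ).re - ε < (⟪ξ, R ξ⟫_ℂ).re by linarith))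
  obtain ⟨b, hb⟩ := h4.exists
  exact ⟨b, b.2, by linarith⟩

structure NF (M : VonNeumannAlgebra H) (φ : BH H → ℝ) : Prop where
  add : ∀ x ∈ M, ∀ y ∈ M, φ (x + y) = φ x + φ y
  smul : ∀ (c : ℝ), ∀ x ∈ M, φ ((c:ℂ) • x) = c * φ x
  pos : ∀ x ∈ M, 0 ≤ x → 0 ≤ φ x
  norm : ∀ S : Set (BH H), (∀ p ∈ S, IsProjection p ∧ p ∈ M) → S.Nonempty → DirectedOn (· ≤ ·) S →
    ∀ q ∈ M, IsLUB S q → ∀ ε > 0, ∃ p ∈ S, φ q < φ p + ε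

lemma NF.sub {M : VonNeumannAlgebra H} {φ : BH H → ℝ} (h : NF M φ) {x y : BH H} (hx : x ∈ M) (hy : y ∈ M) :
    φ (x - y) = φ x - φ y := by
  have := h.add (x - y) (sub_mem hx hy) y hy
  rw [sub_add_cancel] at this; linarith

lemma NF.mono {M : VonNeumannAlgebra H} {φ : BH H → ℝ} (h : NF M φ) {x y : BH H} (hx : x ∈ M) (hy : y ∈ M)
    (hxy : x ≤ y) : φ x ≤ φ y := by
  have := h.pos _ (sub_mem hy hx) (sub_nonneg.mpr hxy)
  rw [h.sub hy hx] at this; linarith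

lemma NF.zero {M : VonNeumannAlgebra H} {φ : BH H → ℝ} (h : NF M φ) : φ 0 = 0 := by
  have := h.smul 0 0 (zero_mem M)
  simpa using this

lemma nf_ce {M P : VonNeumannAlgebra H} {Φ : BH H → BH H} (h : IsCondExp (M : Set (BH H)) P Φ)
    (hn : IsNormalOn (M : Set (BH H)) Φ) (ξ : H) : NF M (fun x => (⟪ξ, Φ x ξ⟫_ℂ).re) where
  add x hx y hy := by simp [h.map_add x hx y hy, inner_add_right]
  smul c x hx := by
    rw [h.map_smul _ x hx]; simp
  pos x hx h0 := re_nonneg_of (h.pos x hx h0) ξ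
  norm S hS hne hdir q hq hlub ε hε := by
    have hl := hn S (fun p hp => (hS p hp).2) hne hdir q hq hlub
    have hdir' : DirectedOn (· ≤ ·) (Φ '' S) := by
      rintro _ ⟨a, ha, rfl⟩ _ ⟨b, hb, rfl⟩
      obtain ⟨c, hc, h1, h2⟩ := hdir a ha b hb
      exact ⟨Φ c, ⟨c, hc, rfl⟩, ce_mono h (hS a ha).2 (hS c hc).2 h1, ce_mono h (hS b hb).2 (hS c hc).2 h2⟩
    obtain ⟨_, ⟨p, hp, rfl⟩, hlt⟩ := lub_approx (hne.image Φ) hdir' (by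
      rintro _ ⟨a, ha, rfl⟩
      exact h.pos a (hS a ha).2 (proj_nonneg (hS a ha).1)) hl ξ hε
    exact ⟨p, hp, hlt⟩

lemma nf_vec (M : VonNeumannAlgebra H) (ξ : H) : NF M (fun x => (⟪ξ, x ξ⟫_ℂ).re) where
  add x hx y hy := by simp [inner_add_right]
  smul c x hx := by simp [inner_smul_right]
  pos x hx h0 := re_nonneg_of h0 ξ
  norm S hS hne hdir q hq hlub ε hε :=
    lub_approx hne hdir (fun a ha => proj_nonneg (hS a ha).1) hlub ξ hε

lemma chain_dir {c : Set (BH H)} (h : IsChain (· ≤ ·) c) : DirectedOn (· ≤ ·) c := h.directedOn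

lemma corner_compare {M : VonNeumannAlgebra H} {φ ω : BH H → ℝ} (hφ : NF M φ) (hω : NF M ω) {e : BH H}
    (he : e ∈ M) (hep : IsProjection e) (hωe : 0 < ω e) :
    ∃ r ∈ M, IsProjection r ∧ e * r = r ∧ r ≠ 0 ∧ ∃ C : ℝ, 0 ≤ C ∧ ∀ x ∈ M, 0 ≤ x → r * x = x → φ x ≤ C * ω x := by
  have hφe := hφ.pos e he (proj_nonneg hep)
  set C := φ e / ω e + 1 with hC
  have hC0 : 0 < C := by positivity
  have hCe : φ e < C * ω e := by
    rw [hC, add_mul, div_mul_cancel₀ _ hωe.ne']; linarith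
  obtain ⟨q, hq⟩ := zorn_le₀ {q : BH H | (q ∈ M ∧ IsProjection q) ∧ q ≤ e ∧ C * ω q ≤ φ q} (by
    intro c hc hch
    rcases c.eq_empty_or_nonempty with rfl | hne
    · refine ⟨0, ⟨⟨zero_mem M, ⟨by simp, by simp [IsIdempotentElem]⟩⟩, proj_nonneg hep, ?_⟩, by simp⟩
      rw [hφ.zero, hω.zero]; simp
    · have hS : ∀ p ∈ c, IsProjection p ∧ p ∈ M := fun p hp => ⟨(hc hp).1.2, (hc hp).1.1⟩
      obtain ⟨q, hqM, hqp, hle, hlub⟩ := proj_sup hS hne (chain_dir hch)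
      refine ⟨q, ⟨⟨hqM, hqp⟩, hlub.2 (fun p hp => (hc hp).2.1), ?_⟩, hle⟩
      apply le_of_forall_pos_le_add
      intro ε hε
      obtain ⟨p, hp, hlt⟩ := hω.norm c hS hne (chain_dir hch) q hqM hlub (ε / C) (by positivity)
      have h1 := (hc hp).2.2
      have h2 := hφ.mono (hS p hp).2 hqM (hle p hp)
      have h3 : C * ω q ≤ C * (ω p + ε / C) := by gcongr
      have h4 : C * (ω p + ε / C) = C * ω p + ε := by field_simp
      linarith)
  obtain ⟨⟨hqM, hqp⟩, hqe, hqC⟩ := hq.prop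
  have heq := (proj_le_iff hqp hep).mp hqe
  have hqe' := proj_mul_comm_of hqp hep heq
  have hr : IsProjection (e - q) := proj_sub hqp hep heq
  refine ⟨e - q, sub_mem he hqM, hr, ?_, ?_, C, hC0.le, ?_⟩
  · rw [mul_sub, hep.2.eq, heq]
  · intro h
    have : e = q := sub_eq_zero.mp h
    rw [← this] at hqC; linarith
  have hrM : e - q ∈ M := sub_mem he hqM
  have hproj : ∀ s ∈ M, IsProjection s → (e - q) * s = s → 0 ≤ C * ω s - φ s := by
    intro s hs hsp hrs
    by_contra hlt
    push Not at hlt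
    have hqs : q * s = 0 := by
      rw [← hrs, ← mul_assoc, mul_sub, hqe', hqp.2.eq, sub_self, zero_mul]
    have hes : e * s = s := by
      have : (e - q) * s = e * s - q * s := sub_mul _ _ _
      rw [hrs, hqs, sub_zero] at this; exact this.symm
    have hadd := proj_add hsp hqp hqs
    have hmem : q + s ∈ {q : BH H | (q ∈ M ∧ IsProjection q) ∧ q ≤ e ∧ C * ω q ≤ φ q} := by
      refine ⟨⟨add_mem hqM hs, hadd⟩, ?_, ?_⟩
      · rw [proj_le_iff hadd hep, mul_add, heq, hes]
      · rw [hφ.add q hqM s hs, hω.add q hqM s hs]; linarith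
    have hle := hq.2 hmem (by simpa using proj_nonneg hsp)
    have hs0 : s = 0 := le_antisymm (by simpa using hle) (proj_nonneg hsp)
    rw [hs0, hφ.zero, hω.zero] at hlt; simp at hlt
  have h01 : ∀ x ∈ M, (e - q) * x = x → 0 ≤ x → x ≤ 1 → 0 ≤ C * ω x - φ x := by
    apply dyadic hr (fun x => C * ω x - φ x) (φ 1)
    · intro s a hs ha _ _ _ _
      have e1 := hφ.smul (1/2) _ (add_mem hs ha)
      have e2 := hω.smul (1/2) _ (add_mem hs ha)
      push_cast at e1 e2
      rw [hφ.add s hs a ha] at e1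
      rw [hω.add s hs a ha] at e2
      rw [e1, e2]; linarith
    · intro a ha _ _ h0 h1
      have e1 := hω.pos a ha h0
      have e2 := hφ.mono ha (one_mem M) h1
      have : 0 ≤ C * ω a := by positivity
      linarith
    · exact hproj
  intro x hx h0 hrx
  by_cases hx0 : x = 0
  · rw [hx0, hφ.zero, hω.zero]; simp
  have hn : 0 < ‖x‖ := norm_pos_iff.mpr hx0
  have h1 := h01 (((‖x‖⁻¹:ℝ):ℂ) • x) (M.smul_mem hx _) (by rw [mul_smul_comm, hrx]) (nonneg_smul h0 (by positivity)) (by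
    have h2 := nonneg_smul (sub_nonneg.mpr (le_norm (sa_of_nonneg h0))) (t := ‖x‖⁻¹) (by positivity)
    rw [smul_sub, smul_smul] at h2
    rw [← sub_nonneg]
    convert h2 using 2
    have : (((‖x‖⁻¹:ℝ):ℂ) * (‖x‖:ℂ)) = 1 := by
      rw [← Complex.ofReal_mul, inv_mul_cancel₀ hn.ne']; simp
    rw [this, one_smul])
  rw [hφ.smul _ x hx, hω.smul _ x hx] at h1
  have h3 : 0 ≤ ‖x‖ * (C * (‖x‖⁻¹ * ω x) - ‖x‖⁻¹ * φ x) := by positivity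
  have h4 : ‖x‖ * (C * (‖x‖⁻¹ * ω x) - ‖x‖⁻¹ * φ x) = C * ω x - φ x := by field_simp
  linarith

def vsum (l : List H) (x : BH H) : ℝ := (l.map (fun ξ => (⟪ξ, x ξ⟫_ℂ).re)).sum

lemma vsum_nonneg (l : List H) {x : BH H} (hx : 0 ≤ x) : 0 ≤ vsum l x := by
  apply List.sum_nonneg
  intro r hr
  obtain ⟨ξ, -, rfl⟩ := List.mem_map.mp hr
  exact re_nonneg_of hx ξ

lemma vsum_append (l l' : List H) (x : BH H) : vsum (l ++ l') x = vsum l x + vsum l' x := by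
  simp [vsum]

def Good (M : VonNeumannAlgebra H) (φ : BH H → ℝ) (p : BH H) : Prop :=
  p ∈ M ∧ IsProjection p ∧ ∃ (C : ℝ) (l : List H), 0 ≤ C ∧ ∀ x ∈ M, 0 ≤ x → φ (p * x * p) ≤ C * vsum l x

lemma Good.add {M : VonNeumannAlgebra H} {φ : BH H → ℝ} (hφ : NF M φ) {p r : BH H} (hp : Good M φ p) (hr : Good M φ r)
    (h : p * r = 0) : Good M φ (p + r) := by
  obtain ⟨hpM, hpp, C, l, hC, hl⟩ := hp
  obtain ⟨hrM, hrp, D, l', hD, hl'⟩ := hr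
  refine ⟨add_mem hpM hrM, proj_add hrp hpp h, 2 * (C + D), l ++ l', by positivity, fun x hx h0 => ?_⟩
  have h1 : 0 ≤ (p - r) * x * (p - r) := by
    have := conj_nonneg h0 (p - r)
    rwa [star_sa (hpp.1.sub hrp.1)] at this
  have m : ∀ a b : BH H, a ∈ M → b ∈ M → a * x * b ∈ M := fun a b ha hb => mul_mem (mul_mem ha hx) hb
  have e : (p + r) * x * (p + r) + (p - r) * x * (p - r) = (p * x * p + r * x * r) + (p * x * p + r * x * r) := by
    noncomm_ring
  have e2 := congrArg φ e
  have ms : p * x * p + r * x * r ∈ M := add_mem (m _ _ hpM hpM) (m _ _ hrM hrM)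
  rw [hφ.add _ (m _ _ (add_mem hpM hrM) (add_mem hpM hrM)) _ (m _ _ (sub_mem hpM hrM) (sub_mem hpM hrM)),
    hφ.add _ ms _ ms, hφ.add _ (m _ _ hpM hpM) _ (m _ _ hrM hrM)] at e2
  have h2 := hφ.pos _ (m _ _ (sub_mem hpM hrM) (sub_mem hpM hrM)) h1
  have h3 := hl x hx h0
  have h4 := hl' x hx h0
  rw [vsum_append]
  have h5 := vsum_nonneg l h0
  have h6 := vsum_nonneg l' h0
  nlinarith [mul_nonneg hC h6, mul_nonneg hD h5]

lemma exists_good {M : VonNeumannAlgebra H} {φ : BH H → ℝ} (hφ : NF M φ) {e : BH H} (he : e ∈ M)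
    (hep : IsProjection e) (h0 : e ≠ 0) : ∃ r, Good M φ r ∧ e * r = r ∧ r ≠ 0 := by
  obtain ⟨ξ, hξ⟩ : ∃ ξ, e ξ ≠ 0 := by
    by_contra hh
    push Not at hh
    exact h0 (ContinuousLinearMap.ext hh)
  have hpos : 0 < (⟪ξ, e ξ⟫_ℂ).re := by
    have : ⟪ξ, e ξ⟫_ℂ = ⟪e ξ, e ξ⟫_ℂ := by
      rw [← inner_star, star_sa hep.1]
      have := DFunLike.congr_fun hep.2.eq ξ
      change e (e ξ) = e ξ at this
      rw [← inner_star e (e ξ) ξ, star_sa hep.1, this]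
    rw [this]
    have := inner_self_eq_norm_sq (𝕜 := ℂ) (e ξ)
    change (⟪e ξ, e ξ⟫_ℂ).re = _ at this
    rw [this]
    have := norm_pos_iff.mpr hξ
    positivity
  obtain ⟨r, hrM, hrp, her, hr0, C, hC, h⟩ := corner_compare hφ (nf_vec M ξ) he hep hpos
  refine ⟨r, ⟨hrM, hrp, C, [r ξ], hC, fun x hx hx0 => ?_⟩, her, hr0⟩
  have h1 : 0 ≤ r * x * r := by
    have := conj_nonneg hx0 r
    rwa [star_sa hrp.1] at this
  have h2 := h (r * x * r) (mul_mem (mul_mem hrM hx) hrM) h1 (by rw [← mul_assoc, ← mul_assoc, hrp.2.eq])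
  refine h2.trans (le_of_eq ?_)
  simp only [vsum, List.map_cons, List.map_nil, List.sum_singleton]
  congr 2
  change ⟪ξ, r (x (r ξ))⟫_ℂ = _
  rw [← inner_star, star_sa hrp.1]

lemma good_one {M : VonNeumannAlgebra H} {φ : BH H → ℝ} (hφ : NF M φ) {ε : ℝ} (hε : 0 < ε) :
    ∃ p, Good M φ p ∧ φ (1 - p) < ε := by
  obtain ⟨e, he⟩ := zorn_le₀ {e : BH H | (e ∈ M ∧ IsProjection e) ∧ ∀ ε > 0, ∃ p, Good M φ p ∧ e * p = p ∧ φ e < φ p + ε} (by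
    intro c hc hch
    rcases c.eq_empty_or_nonempty with rfl | hne
    · refine ⟨0, ⟨⟨zero_mem M, ⟨by simp, by simp [IsIdempotentElem]⟩⟩, fun ε hε => ⟨0, ⟨zero_mem M, ⟨by simp, by simp [IsIdempotentElem]⟩, 0, [], le_rfl, ?_⟩, by simp, by simpa using hε⟩⟩, by simp⟩
      intro x _ _
      simp [hφ.zero]
    · have hS : ∀ p ∈ c, IsProjection p ∧ p ∈ M := fun p hp => ⟨(hc hp).1.2, (hc hp).1.1⟩
      obtain ⟨q, hqM, hqp, hle, hlub⟩ := proj_sup hS hne (chain_dir hch)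
      refine ⟨q, ⟨⟨hqM, hqp⟩, fun ε hε => ?_⟩, hle⟩
      obtain ⟨p, hp, hlt⟩ := hφ.norm c hS hne (chain_dir hch) q hqM hlub (ε / 2) (by positivity)
      obtain ⟨g, hg, hgp, hglt⟩ := (hc hp).2 (ε / 2) (by positivity)
      refine ⟨g, hg, ?_, by linarith⟩
      have := (proj_le_iff (hS p hp).1 hqp).mp (hle p hp)
      rw [← hgp, ← mul_assoc, this])
  obtain ⟨⟨heM, hep⟩, heG⟩ := he.prop
  have he1 : e = 1 := by
    by_contra hne
    obtain ⟨r, hr, her, hr0⟩ := exists_good hφ (sub_mem (one_mem M) heM) (proj_one_sub hep) (sub_ne_zero.mpr (Ne.symm hne))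
    have her0 : e * r = 0 := by
      rw [sub_mul, one_mul] at her
      simpa using her
    have hadd := proj_add hr.2.1 hep her0
    have hmem : e + r ∈ {e : BH H | (e ∈ M ∧ IsProjection e) ∧ ∀ ε > 0, ∃ p, Good M φ p ∧ e * p = p ∧ φ e < φ p + ε} := by
      refine ⟨⟨add_mem heM hr.1, hadd⟩, fun ε hε => ?_⟩
      obtain ⟨p, hp, hpe, hlt⟩ := heG ε hε
      have hpe' := proj_mul_comm_of hp.2.1 hep hpe
      have hpr : p * r = 0 := by rw [← hpe', mul_assoc, her0, mul_zero]
      have hrp : r * p = 0 := by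
        have := congrArg star hpr
        simpa [star_sa hp.2.1.1, star_sa hr.2.1.1] using this
      refine ⟨p + r, hp.add hφ hr hpr, ?_, ?_⟩
      · rw [add_mul, mul_add, mul_add, hpe, her0, hrp, hr.2.1.2.eq]; simp
      · rw [hφ.add e heM r hr.1, hφ.add p hp.1 r hr.1]; linarith
    have hle := he.2 hmem (by simpa using proj_nonneg hr.2.1)
    exact hr0 (le_antisymm (by simpa using hle) (proj_nonneg hr.2.1))
  obtain ⟨p, hp, -, hlt⟩ := heG ε hε
  rw [he1] at hlt
  exact ⟨p, hp, by rw [hφ.sub (one_mem M) hp.1]; linarith⟩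

lemma pos_conj {A : Type*} [Ring A] [StarRing A] [Algebra ℂ A] [StarModule ℂ A] (f : A →ₗ[ℂ] ℂ)
    (hf : ∀ a, 0 ≤ f (star a * a)) (x y : A) : (starRingEnd ℂ) (f (star y * x)) = f (star x * y) := by
  have im0 : ∀ a, (f (star a * a)).im = 0 := fun a => (Complex.le_def.mp (hf a)).2.symm
  have h1 := im0 (x + y)
  have h2 := im0 (x + Complex.I • y)
  simp only [star_add, star_smul, add_mul, mul_add, map_add, smul_mul_assoc, mul_smul_comm, map_smul,
    smul_eq_mul, Complex.add_im, im0, Complex.mul_im, Complex.star_def, Complex.conj_I, Complex.neg_re, Complex.neg_im, Complex.I_re, Complex.I_im,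
    Complex.mul_re] at h1 h2
  apply Complex.ext
  · rw [Complex.conj_re]; linarith
  · rw [Complex.conj_im]; linarith

lemma CS {A : Type*} [Ring A] [StarRing A] [Algebra ℂ A] [StarModule ℂ A] (f : A →ₗ[ℂ] ℂ)
    (hf : ∀ a, 0 ≤ f (star a * a)) (x y : A) :
    ‖f (star y * x)‖ ^ 2 ≤ (f (star y * y)).re * (f (star x * x)).re := by
  letI : PreInnerProductSpace.Core ℂ A :=
    { inner := fun a b => f (star a * b)
      conj_inner_symm := fun a b => pos_conj f hf a b
      re_inner_nonneg := fun a => (Complex.le_def.mp (hf a)).1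
      add_left := fun a b c => by simp [add_mul]
      smul_left := fun a b r => by simp }
  have h := InnerProductSpace.Core.inner_mul_inner_self_le (𝕜 := ℂ) y x
  change ‖f (star y * x)‖ * ‖f (star x * y)‖ ≤ (f (star y * y)).re * (f (star x * x)).re at h
  rw [← pos_conj f hf x y, RCLike.norm_conj, ← sq] at h
  exact h

def ceFun {M P : VonNeumannAlgebra H} {Φ : BH H → BH H} (h : IsCondExp (M : Set (BH H)) P Φ) (ξ : H) :
    M.toStarSubalgebra →ₗ[ℂ] ℂ where
  toFun a := ⟪ξ, Φ a ξ⟫_ℂ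
  map_add' a b := by
    have := h.map_add a a.2 b b.2
    simp [this, inner_add_right]
  map_smul' c a := by
    have := h.map_smul c a a.2
    simp [this, inner_smul_right]

lemma ceFun_pos {M P : VonNeumannAlgebra H} {Φ : BH H → BH H} (h : IsCondExp (M : Set (BH H)) P Φ) (ξ : H)
    (a : M.toStarSubalgebra) : 0 ≤ ceFun h ξ (star a * a) :=
  inner_nonneg_of (h.pos _ (mul_mem (star_mem a.2) a.2) (star_mul_self_nonneg (a : BH H))) ξ

/-- Representation of a functional bounded by finitely many vectors. -/
lemma riesz_vec {V : Type*} [AddCommGroup V] [Module ℂ V] {n : ℕ} (T : Fin n → V →ₗ[ℂ] H) (g : V →ₗ[ℂ] ℂ) (C : ℝ)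
    (hC : 0 ≤ C)
    (hg : ∀ v, ‖g v‖ ^ 2 ≤ C * ∑ j, ‖T j v‖ ^ 2) : ∃ η : Fin n → H, ∀ v, g v = ∑ j, ⟪η j, T j v⟫_ℂ := by
  let W := PiLp 2 (fun _ : Fin n => H)
  let S : V →ₗ[ℂ] W := (WithLp.linearEquiv 2 ℂ (Fin n → H)).symm.toLinearMap ∘ₗ LinearMap.pi T
  let K : Submodule ℂ W := (LinearMap.range S).topologicalClosure
  let e : V →ₗ[ℂ] K := S.codRestrict K (fun v => Submodule.le_topologicalClosure _ ⟨v, rfl⟩)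
  have hd : DenseRange e := by
    intro ⟨k, hk⟩
    rw [Metric.mem_closure_iff]
    intro ε hε
    have hk' : k ∈ closure ((LinearMap.range S : Submodule ℂ W) : Set W) := by
      rwa [← Submodule.topologicalClosure_coe]
    obtain ⟨_, ⟨v, rfl⟩, hv⟩ := Metric.mem_closure_iff.mp hk' ε hε
    exact ⟨e v, ⟨v, rfl⟩, hv⟩
  have hb : ∀ v, ‖g v‖ ≤ Real.sqrt C * ‖e v‖ := by
    intro v
    have h1 : ‖e v‖ ^ 2 = ∑ j, ‖T j v‖ ^ 2 := by
      change ‖S v‖ ^ 2 = _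
      rw [PiLp.norm_sq_eq_of_L2]
      rfl
    have h2 := hg v
    rw [← h1] at h2
    apply abs_le_of_sq_le_sq' _ (by positivity) |>.2
    rw [mul_pow, Real.sq_sqrt hC]; exact h2
  let G := g.extendOfNorm e
  have hG : ∀ v, G (e v) = g v := LinearMap.extendOfNorm_eq hd ⟨_, hb⟩
  let G' : StrongDual ℂ W := G.comp K.orthogonalProjection
  let η := (InnerProductSpace.toDual ℂ W).symm G'
  refine ⟨fun j => η j, fun v => ?_⟩
  have h1 : ⟪η, S v⟫_ℂ = G' (S v) := InnerProductSpace.toDual_symm_apply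
  rw [PiLp.inner_apply] at h1
  have h2 : G' (S v) = g v := by
    rw [← hG]
    show G (K.orthogonalProjection (S v)) = _
    congr 1
    exact Submodule.orthogonalProjection_mem_subspace_eq_self (e v)
  rw [← h2, ← h1]
  rfl

lemma T1 {M P : VonNeumannAlgebra H} {Φ : BH H → BH H} (h : IsCondExp (M : Set (BH H)) P Φ)
    (hn : IsNormalOn (M : Set (BH H)) Φ) (ξ : H) {ε : ℝ} (hε : 0 < ε) :
    ∃ (n : ℕ) (ζ η : Fin n → H), ∀ z ∈ M, ‖⟪ξ, Φ z ξ⟫_ℂ - ∑ j, ⟪η j, z (ζ j)⟫_ℂ‖ ≤ ε * ‖z‖ := by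
  obtain ⟨p, ⟨hpM, hpp, C, l, hC, hl⟩, hlt⟩ := good_one (nf_ce h hn ξ) (ε := (ε / (‖ξ‖ + 1)) ^ 2) (by positivity)
  have key2 : ∀ z ∈ M, (⟪ξ, Φ z ξ⟫_ℂ).re ≤ ‖z‖ * ‖ξ‖ ^ 2 := by
    intro z hz
    calc (⟪ξ, Φ z ξ⟫_ℂ).re ≤ ‖⟪ξ, Φ z ξ⟫_ℂ‖ := Complex.re_le_norm _
      _ ≤ ‖ξ‖ * ‖Φ z ξ‖ := norm_inner_le_norm _ _
      _ ≤ ‖ξ‖ * (‖z‖ * ‖ξ‖) := by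
        gcongr
        exact (ContinuousLinearMap.le_opNorm _ _).trans (by gcongr; exact ce_norm h hz)
      _ = _ := by ring
  let f := ceFun h ξ
  have hf := ceFun_pos h ξ
  let p' : M.toStarSubalgebra := ⟨p, hpM⟩
  let T : Fin l.length → M.toStarSubalgebra →ₗ[ℂ] H := fun j =>
    { toFun := fun a => (a : BH H) (l.get j), map_add' := fun a b => rfl, map_smul' := fun c a => rfl }
  let g : M.toStarSubalgebra →ₗ[ℂ] ℂ := f ∘ₗ LinearMap.mulRight ℂ p'
  obtain ⟨η, hη⟩ := riesz_vec T g (‖ξ‖ ^ 2 * C) (by positivity) (by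
    intro a
    have h1 := CS f hf (a * p') 1
    rw [star_one, one_mul] at h1
    have e1 : (f (1 * 1)).re ≤ ‖ξ‖ ^ 2 := by
      have := key2 1 (one_mem M)
      have h2 : (f (1 * 1)) = ⟪ξ, Φ 1 ξ⟫_ℂ := by rw [one_mul]; rfl
      rw [h2, ce_one h]
      simp only [ContinuousLinearMap.one_apply]
      have := inner_self_eq_norm_sq (𝕜 := ℂ) ξ
      change (⟪ξ, ξ⟫_ℂ).re = _ at this
      rw [this]
    have e2 : (f (star (a * p') * (a * p'))).re ≤ C * ∑ j, ‖T j a‖ ^ 2 := by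
      have h3 := hl (star (a : BH H) * a) (mul_mem (star_mem a.2) a.2) (star_mul_self_nonneg _)
      have h4 : f (star (a * p') * (a * p')) = ⟪ξ, Φ (p * (star (a : BH H) * a) * p) ξ⟫_ℂ := by
        change ⟪ξ, Φ (star ((a : BH H) * p) * (a * p)) ξ⟫_ℂ = _
        rw [star_mul, star_sa hpp.1]
        simp only [mul_assoc]
      rw [h4]
      refine h3.trans (le_of_eq ?_)
      congr 1
      rw [vsum, ← List.ofFn_get (l.map _), List.sum_ofFn, ]
      have : ∀ ζ : H, (⟪ζ, (star (a : BH H) * a) ζ⟫_ℂ).re = ‖(a : BH H) ζ‖ ^ 2 := by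
        intro ζ
        change (⟪ζ, star (a : BH H) ((a : BH H) ζ)⟫_ℂ).re = _
        rw [inner_star']
        exact inner_self_eq_norm_sq (𝕜 := ℂ) _
      apply Fintype.sum_equiv (finCongr (by simp))
      intro j
      have hj := this (l[(j:ℕ)]'(by have := j.2; simpa using this))
      change (⟪_, star (a : BH H) ((a : BH H) _)⟫_ℂ).re = _ at hj
      simp [hj, T]
    have e3 : 0 ≤ (f (star (a * p') * (a * p'))).re := (Complex.le_def.mp (hf (a * p'))).1
    calc ‖g a‖ ^ 2 ≤ (f (1 * 1)).re * (f (star (a * p') * (a * p'))).re := h1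
      _ ≤ ‖ξ‖ ^ 2 * (C * ∑ j, ‖T j a‖ ^ 2) := mul_le_mul e1 e2 e3 (by positivity)
      _ = _ := by ring)
  refine ⟨l.length, fun j => l.get j, η, fun z hz => ?_⟩
  have h1 := hη ⟨z, hz⟩
  have h2 : ∑ j, ⟪η j, z (l.get j)⟫_ℂ = ⟪ξ, Φ (z * p) ξ⟫_ℂ := h1.symm
  rw [h2]
  have h3 : ⟪ξ, Φ z ξ⟫_ℂ - ⟪ξ, Φ (z * p) ξ⟫_ℂ = f (star ⟨star z, star_mem hz⟩ * ⟨1 - p, sub_mem (one_mem M) hpM⟩) := by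
    change _ = ⟪ξ, Φ (star (star z) * (1 - p)) ξ⟫_ℂ
    rw [star_star, mul_sub, mul_one, ce_sub h hz (mul_mem hz hpM)]
    simp
  rw [h3]
  have h4 := CS f hf ⟨1 - p, sub_mem (one_mem M) hpM⟩ ⟨star z, star_mem hz⟩
  have h5 : (f (star ⟨star z, star_mem hz⟩ * ⟨star z, star_mem hz⟩)).re ≤ (‖z‖ * ‖ξ‖) ^ 2 := by
    change (⟪ξ, Φ (star (star z) * star z) ξ⟫_ℂ).re ≤ _
    have := key2 (star (star z) * star z) (mul_mem (star_mem (star_mem hz)) (star_mem hz))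
    rw [CStarRing.norm_star_mul_self, norm_star] at this
    linarith [this]
  have h6 : (f (star ⟨1 - p, sub_mem (one_mem M) hpM⟩ * ⟨1 - p, sub_mem (one_mem M) hpM⟩)).re ≤ (ε / (‖ξ‖ + 1)) ^ 2 := by
    change (⟪ξ, Φ (star (1 - p) * (1 - p)) ξ⟫_ℂ).re ≤ _
    rw [star_sa (proj_one_sub hpp).1, (proj_one_sub hpp).2.eq]
    exact hlt.le
  have h7 : ‖f (star ⟨star z, star_mem hz⟩ * ⟨1 - p, sub_mem (one_mem M) hpM⟩)‖ ^ 2 ≤ ((‖z‖ * ‖ξ‖) * (ε / (‖ξ‖ + 1))) ^ 2 := by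
    rw [mul_pow]
    refine h4.trans (mul_le_mul h5 h6 ?_ (by positivity))
    exact (Complex.le_def.mp (hf _)).1
  have h8 := (abs_le_of_sq_le_sq' h7 (by positivity)).2
  refine h8.trans ?_
  rw [mul_div_assoc', div_le_iff₀ (by positivity)]
  nlinarith [norm_nonneg z, norm_nonneg ξ, mul_nonneg hε.le (norm_nonneg z)]

/-- normal conditional expectations are WOT continuous on bounded nets -/
lemma ce_tendsto {M P : VonNeumannAlgebra H} {Φ : BH H → BH H} (h : IsCondExp (M : Set (BH H)) P Φ)
    (hn : IsNormalOn (M : Set (BH H)) Φ) {ι : Type*} {U : Filter ι} {z : ι → BH H} {w : BH H} (C : ℝ)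
    (hz : ∀ i, z i ∈ M) (hw : w ∈ M) (hC : ∀ i, ‖z i‖ ≤ C)
    (hlim : ∀ x y, Filter.Tendsto (fun i => ⟪x, z i y⟫_ℂ) U (nhds ⟪x, w y⟫_ℂ)) :
    ∀ x y, Filter.Tendsto (fun i => ⟪x, Φ (z i) y⟫_ℂ) U (nhds ⟪x, Φ w y⟫_ℂ) := by
  have diag : ∀ x, Filter.Tendsto (fun i => ⟪x, Φ (z i) x⟫_ℂ) U (nhds ⟪x, Φ w x⟫_ℂ) := by
    intro x
    rw [Metric.tendsto_nhds]
    intro ε hε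
    set D := max (max C ‖w‖) 0 + 1 with hD
    have hD0 : 0 < D := by positivity
    have hCD : C ≤ D := by
      have := le_max_left C ‖w‖; have := le_max_left (max C ‖w‖) 0; linarith
    have hwD : ‖w‖ ≤ D := by
      have := le_max_right C ‖w‖; have := le_max_left (max C ‖w‖) 0; linarith
    obtain ⟨n, ζ, η, hT⟩ := T1 h hn x (ε := ε / (4 * D)) (by positivity)
    have hs : Filter.Tendsto (fun i => ∑ j, ⟪η j, z i (ζ j)⟫_ℂ) U (nhds (∑ j, ⟪η j, w (ζ j)⟫_ℂ)) :=
      tendsto_finset_sum _ (fun j _ => hlim _ _)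
    filter_upwards [(Metric.tendsto_nhds.mp hs) (ε / 4) (by positivity)] with i hi
    rw [dist_eq_norm] at hi ⊢
    have h1 := hT (z i) (hz i)
    have h2 := hT w hw
    have b : ∀ t : ℝ, t ≤ D → ε / (4 * D) * t ≤ ε / 4 := by
      intro t ht
      calc ε / (4 * D) * t ≤ ε / (4 * D) * D := by gcongr
        _ = ε / 4 := by field_simp
    have h1' := h1.trans (b _ ((hC i).trans hCD))
    have h2' := h2.trans (b _ hwD)
    have e : ⟪x, Φ (z i) x⟫_ℂ - ⟪x, Φ w x⟫_ℂ = (⟪x, Φ (z i) x⟫_ℂ - ∑ j, ⟪η j, z i (ζ j)⟫_ℂ)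
        + (∑ j, ⟪η j, z i (ζ j)⟫_ℂ - ∑ j, ⟪η j, w (ζ j)⟫_ℂ) - (⟪x, Φ w x⟫_ℂ - ∑ j, ⟪η j, w (ζ j)⟫_ℂ) := by ring
    rw [e]
    calc _ ≤ _ := norm_sub_le _ _
      _ ≤ _ := add_le_add_left (norm_add_le _ _) _
      _ < ε := by linarith
  have diag' : ∀ x, Filter.Tendsto (fun i => ⟪Φ (z i) x, x⟫_ℂ) U (nhds ⟪Φ w x, x⟫_ℂ) := by
    intro x
    have := (Complex.continuous_conj.tendsto _).comp (diag x)
    simp only [Function.comp_def, inner_conj_symm] at this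
    exact this
  intro x y
  have main : Filter.Tendsto (fun i => ⟪Φ (z i) y, x⟫_ℂ) U (nhds ⟪Φ w y, x⟫_ℂ) := by
    have e : ∀ T : BH H, ⟪T y, x⟫_ℂ = _ := fun T => inner_map_polarization T.toLinearMap x y
    simp only [e]
    exact ((((diag' _).sub (diag' _)).add ((diag' _).const_mul _)).sub ((diag' _).const_mul _)).div_const _
  have := (Complex.continuous_conj.tendsto _).comp main
  simp only [Function.comp_def, inner_conj_symm] at this
  exact this

abbrev PW (ι : Type*) [Fintype ι] (H : Type*) [NormedAddCommGroup H] := PiLp 2 (fun _ : ι => H)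

lemma dc_zero (A : StarSubalgebra ℂ (BH H)) {y : BH H} (hy : ∀ z, (∀ a ∈ A, a * z = z * a) → y * z = z * y)
    {ι : Type*} [Fintype ι] (ξ η : ι → H) (h : ∀ a ∈ A, ∑ j, ⟪η j, a (ξ j)⟫_ℂ = 0) :
    ∑ j, ⟪η j, y (ξ j)⟫_ℂ = 0 := by
  classical
  let D : BH H → BH (PW ι H) := fun a => ((PiLp.continuousLinearEquiv 2 ℂ (fun _ : ι => H)).symm : (ι → H) →L[ℂ] PW ι H).comp
    ((ContinuousLinearMap.pi (fun j => a.comp (PiLp.proj 2 (fun _ : ι => H) j))))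
  have hD : ∀ a (w : PW ι H) j, (D a w) j = a (w j) := fun a w j => rfl
  let ξ' : PW ι H := WithLp.toLp 2 ξ
  let η' : PW ι H := WithLp.toLp 2 η
  let K : Submodule ℂ (PW ι H) := 
    { carrier := {w | ∃ a ∈ A, w = D a ξ'}
      add_mem' := by
        rintro _ _ ⟨a, ha, rfl⟩ ⟨b, hb, rfl⟩
        exact ⟨a + b, add_mem ha hb, by ext j; simp [hD]⟩
      zero_mem' := ⟨0, zero_mem A, by ext j; simp [hD]⟩
      smul_mem' := by
        rintro c _ ⟨a, ha, rfl⟩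
        exact ⟨c • a, SMulMemClass.smul_mem c ha, by ext j; simp [hD]⟩ }
  have hstar : ∀ a, star (D a) = D (star a) := by
    intro a
    apply eq_of_inner
    intro u v
    rw [inner_star', PiLp.inner_apply, PiLp.inner_apply]
    exact Finset.sum_congr rfl (fun j _ => by rw [hD, hD, inner_star'])
  have hinv : ∀ a ∈ A, ∀ k ∈ K, D a k ∈ K := by
    rintro a ha _ ⟨b, hb, rfl⟩
    exact ⟨a * b, mul_mem ha hb, by ext j; simp [hD]⟩
  have hcomm : ∀ a ∈ A, D a * pr K = pr K * D a := by
    intro a ha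
    apply pr_comm
    · exact hinv a ha
    · rw [hstar]; exact hinv _ (star_mem ha)
  let inj : ι → H →L[ℂ] PW ι H := fun j => (((PiLp.continuousLinearEquiv 2 ℂ (fun _ : ι => H)).symm : (ι → H) →L[ℂ] PW ι H)).comp
    (ContinuousLinearMap.single ℂ (fun _ : ι => H) j)
  have hinj : ∀ j v k, (inj j v) k = (Pi.single j v : ι → H) k := fun j v k => rfl
  have hDinj : ∀ a j v, D a (inj j v) = inj j (a v) := by
    intro a j v
    ext k
    rw [hD, hinj, hinj]
    by_cases hk : k = j
    · subst hk; simp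
    · simp [hk]
  let e : ι → ι → BH H := fun i j => (PiLp.proj 2 (fun _ : ι => H) i).comp ((pr K).comp (inj j))
  have he : ∀ i j v, e i j v = (pr K (inj j v)) i := fun i j v => rfl
  have hey : ∀ i j, y * e i j = e i j * y := by
    intro i j
    apply hy
    intro a ha
    ext v
    change a (e i j v) = e i j (a v)
    rw [he, he, ← hDinj, ← hD]
    exact congrArg (fun w : PW ι H => w i) (DFunLike.congr_fun (hcomm a ha) (inj j v))
  have hsum : ∀ w : PW ι H, w = ∑ j, inj j (w j) := by
    intro w
    ext k
    simp [hinj, Finset.sum_apply, Pi.single_apply]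
  have hPy : ∀ w : PW ι H, D y (pr K w) = pr K (D y w) := by
    have key : ∀ j v, D y (pr K (inj j v)) = pr K (D y (inj j v)) := by
      intro j v
      ext i
      rw [hD, hDinj, ← he, ← he]
      exact DFunLike.congr_fun (hey i j) v
    intro w
    rw [hsum w]
    simp only [map_sum, key]
  have hξ : ξ' ∈ K := ⟨1, one_mem A, by ext j; simp [hD]⟩
  have hfix : pr K (D y ξ') = D y ξ' := by rw [← hPy, pr_fix hξ]
  have horth : ∀ k ∈ K, ⟪η', k⟫_ℂ = 0 := by
    rintro _ ⟨a, ha, rfl⟩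
    rw [PiLp.inner_apply]
    exact h a ha
  have hkill : (innerSL ℂ η' : PW ι H →L[ℂ] ℂ) (pr K (D y ξ')) = 0 := by
    apply kill_closure (K := K) (z := innerSL ℂ η') horth
    exact pr_mem _ _
  rw [hfix] at hkill
  have : ⟪η', D y ξ'⟫_ℂ = 0 := hkill
  rw [PiLp.inner_apply] at this
  exact this

lemma dc_sa (A : StarSubalgebra ℂ (BH H)) {y : BH H} (hy : ∀ z, (∀ a ∈ A, a * z = z * a) → y * z = z * y)
    (hsa : IsSelfAdjoint y) {ι : Type*} [Fintype ι] (ξ : ι → H) {ε : ℝ} (hε : 0 < ε) :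
    ∃ a ∈ A, IsSelfAdjoint a ∧ ∀ j, ‖a (ξ j) - y (ξ j)‖ < ε := by
  let v : BH H → PW ι H := fun a => WithLp.toLp 2 (fun j => a (ξ j))
  let T : Set (PW ι H) := {w | ∃ a ∈ A, IsSelfAdjoint a ∧ w = v a}
  have hT : Convex ℝ T := by
    rintro _ ⟨a, ha, ha', rfl⟩ _ ⟨b, hb, hb', rfl⟩ s t _ _ _
    refine ⟨(s:ℂ) • a + (t:ℂ) • b, add_mem (SMulMemClass.smul_mem _ ha) (SMulMemClass.smul_mem _ hb), ?_, ?_⟩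
    · rw [IsSelfAdjoint, star_add, star_smul, star_smul, star_sa ha', star_sa hb']; simp
    · ext j; simp [v]
  by_cases hmem : v y ∈ closure T
  · rw [Metric.mem_closure_iff] at hmem
    obtain ⟨_, ⟨a, ha, ha', rfl⟩, hd⟩ := hmem ε hε
    refine ⟨a, ha, ha', fun j => lt_of_le_of_lt ?_ hd⟩
    rw [dist_comm, dist_eq_norm]
    exact PiLp.norm_apply_le (v a - v y) j
  · exfalso
    obtain ⟨f, u, h1, h2⟩ := RCLike.geometric_hahn_banach_point_closed (𝕜 := ℂ) hT.closure isClosed_closure hmem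
    let η : PW ι H := (InnerProductSpace.toDual ℂ (PW ι H)).symm f
    have hf : ∀ w, f w = ⟪η, w⟫_ℂ := fun w => by rw [InnerProductSpace.toDual_symm_apply]
    have hfv : ∀ a, f (v a) = ∑ j, ⟪η j, a (ξ j)⟫_ℂ := by
      intro a; rw [hf, PiLp.inner_apply]
    have hre : ∀ a, IsSelfAdjoint a → ∑ j, ⟪η j, a (ξ j)⟫_ℂ + ∑ j, ⟪ξ j, a (η j)⟫_ℂ = ((2 * (f (v a)).re : ℝ) : ℂ) := by
      intro a ha
      have : ∑ j, ⟪ξ j, a (η j)⟫_ℂ = (starRingEnd ℂ) (∑ j, ⟪η j, a (ξ j)⟫_ℂ) := by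
        rw [map_sum]
        refine Finset.sum_congr rfl (fun j _ => ?_)
        rw [inner_conj_symm, ← inner_star, star_sa ha]
      rw [this, ← hfv, Complex.add_conj]
    have h0 : ∀ a ∈ A, IsSelfAdjoint a → (f (v a)).re = 0 := by
      intro a ha hasa
      have hl : ∀ t : ℝ, u < t * (f (v a)).re := by
        intro t
        have := h2 (v ((t:ℂ) • a)) (subset_closure ⟨_, SMulMemClass.smul_mem _ ha, by
          rw [IsSelfAdjoint, star_smul, star_sa hasa]; simp, rfl⟩)
        have hv : v ((t:ℂ) • a) = (t:ℂ) • v a := by ext j; simp [v]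
        rw [hv, map_smul] at this
        simpa using this
      by_contra hne
      have := hl (u / (f (v a)).re)
      rw [div_mul_cancel₀ _ hne] at this
      exact lt_irrefl _ this
    have hu : u < 0 := by
      have := h2 (v 0) (subset_closure ⟨0, zero_mem A, IsSelfAdjoint.zero _, rfl⟩)
      have hv : v 0 = 0 := by ext j; simp [v]
      rw [hv] at this; simpa using this
    have hz : ∀ a ∈ A, ∑ j, ⟪η j, a (ξ j)⟫_ℂ + ∑ j, ⟪ξ j, a (η j)⟫_ℂ = 0 := by
      have hzs : ∀ a ∈ A, IsSelfAdjoint a → ∑ j, ⟪η j, a (ξ j)⟫_ℂ + ∑ j, ⟪ξ j, a (η j)⟫_ℂ = 0 := by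
        intro a ha hasa
        rw [hre a hasa, h0 a ha hasa]; simp
      intro a ha
      have e1 := hzs (a + star a) (add_mem ha (star_mem ha)) (IsSelfAdjoint.add_star_self a)
      have e2 := hzs (Complex.I • (star a - a)) (SMulMemClass.smul_mem _ (sub_mem (star_mem ha) ha)) (by
        rw [IsSelfAdjoint, star_smul, star_sub, star_star]
        simp [← smul_neg])
      simp only [ContinuousLinearMap.add_apply, ContinuousLinearMap.sub_apply, ContinuousLinearMap.smul_apply,
        inner_add_right, inner_sub_right, inner_smul_right, Finset.sum_add_distrib, Finset.sum_sub_distrib,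
        ← Finset.mul_sum] at e1 e2
      have e3 := mul_eq_zero.mp (show Complex.I * (∑ j, ⟪η j, (star a) (ξ j)⟫_ℂ - ∑ j, ⟪η j, a (ξ j)⟫_ℂ + (∑ j, ⟪ξ j, (star a) (η j)⟫_ℂ - ∑ j, ⟪ξ j, a (η j)⟫_ℂ)) = 0 by linear_combination e2)
      have e4 := e3.resolve_left Complex.I_ne_zero
      linear_combination (e1 - e4) / 2
    have hfin := dc_zero A hy (Sum.elim ξ η) (Sum.elim η ξ) (by
      intro a ha
      rw [Fintype.sum_sum_type]
      exact hz a ha)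
    rw [Fintype.sum_sum_type] at hfin
    have e5 : ((2 * (f (v y)).re : ℝ) : ℂ) = 0 := by rw [← hre y hsa]; exact hfin
    have e6 : 2 * (f (v y)).re = 0 := by exact_mod_cast e5
    have h1' : (f (v y)).re < u := h1
    linarith

lemma cfc_mem_clos (A : StarSubalgebra ℂ (BH H)) {a : BH H} (haA : a ∈ A) (f : ℝ → ℝ) :
    cfc f a ∈ closure (A : Set (BH H)) := by
  have h1 : cfc f a ∈ StarAlgebra.elemental ℝ a := cfc_mem_elemental _ a
  let S : StarSubalgebra ℝ (BH H) :=
    { carrier := A.topologicalClosure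
      mul_mem' := fun h h' => mul_mem (S := StarSubalgebra ℂ (BH H)) h h'
      add_mem' := fun h h' => add_mem (S := StarSubalgebra ℂ (BH H)) h h'
      algebraMap_mem' := fun r => by
        have : algebraMap ℝ (BH H) r = algebraMap ℂ (BH H) (r:ℂ) := by ext v; simp [Algebra.algebraMap_eq_smul_one]
        rw [this]
        exact A.topologicalClosure.algebraMap_mem _
      star_mem' := fun h => star_mem (S := StarSubalgebra ℂ (BH H)) h }
  have hcl : IsClosed (S : Set (BH H)) := A.isClosed_topologicalClosure
  have haS : a ∈ S := A.le_topologicalClosure haA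
  have h3 : StarAlgebra.elemental ℝ a ≤ S := StarAlgebra.elemental.le_of_mem hcl haS
  have : cfc f a ∈ (A.topologicalClosure : Set (BH H)) := h3 h1
  rwa [StarSubalgebra.topologicalClosure_coe] at this

set_option maxHeartbeats 600000 in
lemma kap_one (A : StarSubalgebra ℂ (BH H)) {x : BH H} (hx : ∀ z, (∀ a ∈ A, a * z = z * a) → x * z = z * x)
    (hsa : IsSelfAdjoint x) (hn : ‖x‖ ≤ 1) {ι : Type*} [Fintype ι] (ξ : ι → H) {ε : ℝ} (hε : 0 < ε) :
    ∃ c ∈ A, ‖c‖ ≤ 2 ∧ ∀ j, ‖c (ξ j) - x (ξ j)‖ < ε := by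
  let g : ℝ → ℝ := fun t => t / (1 + Real.sqrt (1 - t ^ 2))
  have hgpos : ∀ t : ℝ, 1 + Real.sqrt (1 - t ^ 2) ≠ 0 := fun t => by positivity
  have hgc : Continuous g := by
    apply Continuous.div continuous_id (by fun_prop) hgpos
  have hspec : ∀ t ∈ spectrum ℝ x, t ^ 2 ≤ 1 := by
    intro t ht
    have h := spectrum.norm_le_norm_mul_of_mem ht
    have h1 : ‖(1 : BH H)‖ ≤ 1 := ContinuousLinearMap.norm_id_le
    have h2 : ‖x‖ * ‖(1 : BH H)‖ ≤ 1 := by nlinarith [norm_nonneg x, norm_nonneg (1 : BH H)]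
    rw [Real.norm_eq_abs] at h
    rw [sq_le_one_iff_abs_le_one]
    linarith
  set y : BH H := cfc g x with hyd
  have hysa : IsSelfAdjoint y := cfc_predicate (p := IsSelfAdjoint) g x
  have hyA : ∀ z, (∀ a ∈ A, a * z = z * a) → y * z = z * y := by
    intro z hz
    have h1 := hx z hz
    exact (IsSelfAdjoint.commute_cfc hsa (show Commute x z from h1) g).eq
  have hyx : (1 + y * y) * x = (2:ℝ) • y := by
    have e1 : (1 + y * y) * x = cfc (fun t : ℝ => (1 + g t * g t) * t) x := by
      rw [cfc_mul (fun t : ℝ => 1 + g t * g t) (fun t => t) x (by fun_prop) (by fun_prop),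
        cfc_add x (fun t : ℝ => (1:ℝ)) (fun t => g t * g t) (by fun_prop) (by fun_prop),
        cfc_mul g g x (by fun_prop) (by fun_prop), cfc_const_one ℝ x, cfc_id' ℝ x]
    rw [e1, hyd, ← cfc_smul (2:ℝ) g x (by fun_prop)]
    apply cfc_congr
    intro t ht
    have hs := Real.sq_sqrt (show 0 ≤ 1 - t ^ 2 by linarith [hspec t ht])
    have h0 := hgpos t
    simp only [g, smul_eq_mul]
    generalize Real.sqrt (1 - t ^ 2) = s at hs h0
    have ht2 : t ^ 2 = 1 - s ^ 2 := by linarith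
    field_simp
    rw [ht2]; ring
  obtain ⟨a, haA, hasa, ha⟩ := dc_sa A hyA hysa (Sum.elim ξ (Sum.elim (fun j => y (x (ξ j))) (fun j => x (ξ j))))
    (ε := ε / 8) (by positivity)
  have ha1 : ∀ j, ‖a (ξ j) - y (ξ j)‖ < ε / 8 := fun j => ha (Sum.inl j)
  have ha2 : ∀ j, ‖a (y (x (ξ j))) - y (y (x (ξ j)))‖ < ε / 8 := fun j => ha (Sum.inr (Sum.inl j))
  have ha3 : ∀ j, ‖a (x (ξ j)) - y (x (ξ j))‖ < ε / 8 := fun j => ha (Sum.inr (Sum.inr j))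
  have hdp : ∀ t : ℝ, 1 + t ^ 2 ≠ 0 := fun t => by positivity
  have hrc : Continuous (fun t : ℝ => 1 / (1 + t ^ 2)) := Continuous.div (by fun_prop) (by fun_prop) hdp
  have hbc : Continuous (fun t : ℝ => 2 * t / (1 + t ^ 2)) := Continuous.div (by fun_prop) (by fun_prop) hdp
  set R : BH H := cfc (fun t : ℝ => 1 / (1 + t ^ 2)) a with hR
  set b : BH H := cfc (fun t : ℝ => 2 * t / (1 + t ^ 2)) a with hb
  have hR1 : ‖R‖ ≤ 1 := by
    apply norm_cfc_le zero_le_one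
    intro t _
    rw [Real.norm_eq_abs, abs_of_nonneg (by positivity), div_le_one (by positivity)]
    nlinarith [sq_nonneg t]
  have hb1 : ‖b‖ ≤ 1 := by
    apply norm_cfc_le zero_le_one
    intro t _
    rw [Real.norm_eq_abs, abs_div, abs_of_nonneg (show 0 ≤ 1 + t ^ 2 by positivity), div_le_one (by positivity),
      abs_le]
    constructor <;> nlinarith [sq_nonneg (t - 1), sq_nonneg (t + 1)]
  have eR : R * (1 + a * a) = 1 := by
    have : (1 + a * a) = cfc (fun t : ℝ => 1 + t * t) a := by
      rw [cfc_add a (fun t : ℝ => (1:ℝ)) (fun t => t * t) (by fun_prop) (by fun_prop),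
        cfc_mul (fun t : ℝ => t) (fun t => t) a (by fun_prop) (by fun_prop), cfc_const_one ℝ a, cfc_id' ℝ a]
    rw [this, hR, ← cfc_mul _ _ a hrc.continuousOn (by fun_prop), ← cfc_const_one ℝ a]
    apply cfc_congr
    intro t _
    have := hdp t
    simp only
    field_simp
  have eb : (2:ℝ) • (R * a) = b := by
    have : R * a = cfc (fun t : ℝ => 1 / (1 + t ^ 2) * t) a := by
      rw [cfc_mul _ _ a hrc.continuousOn (by fun_prop), cfc_id' ℝ a]
    rw [this, ← cfc_smul (2:ℝ) _ a (by exact (hrc.mul continuous_id).continuousOn), hb]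
    apply cfc_congr
    intro t _
    simp only [smul_eq_mul]; ring
  have key : ∀ v, b v - x v = (2:ℝ) • R (a v - y v) - R (a (y (x v)) - y (y (x v))) - (1/2:ℝ) • b (a (x v) - y (x v)) := by
    intro v
    have h1 : b - x = (2:ℝ) • (R * (a - y)) - R * ((a - y) * (y * x)) - (1/2:ℝ) • (b * ((a - y) * x)) := by
      have h2 : x = R * (x + a * a * x) := by
        calc x = (R * (1 + a * a)) * x := by rw [eR, one_mul]
          _ = _ := by noncomm_ring
      have h3 : (2:ℝ) • (R * y) = R * x + R * (y * y * x) := by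
        rw [← mul_smul_comm, ← hyx]; noncomm_ring
      have h4 : (1/2:ℝ) • (b * ((a - y) * x)) = R * a * ((a - y) * x) := by
        rw [← eb, smul_mul_assoc, smul_smul]; norm_num
      rw [h4, mul_sub R a y, smul_sub, h3, eb]
      nth_rewrite 1 [h2]
      noncomm_ring
    have := DFunLike.congr_fun h1 v
    simpa using this
  have hbb : ∀ j, ‖b (ξ j) - x (ξ j)‖ < ε / 2 := by
    intro j
    rw [key]
    have n1 : ‖(2:ℝ) • R (a (ξ j) - y (ξ j))‖ ≤ 2 * (ε / 8) := by
      rw [norm_smul, Real.norm_of_nonneg (by norm_num)]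
      have := (R.le_of_opNorm_le hR1 (a (ξ j) - y (ξ j)))
      linarith [ha1 j]
    have n2 : ‖R (a (y (x (ξ j))) - y (y (x (ξ j))))‖ ≤ ε / 8 := by
      have := (R.le_of_opNorm_le hR1 (a (y (x (ξ j))) - y (y (x (ξ j)))))
      linarith [ha2 j]
    have n3 : ‖(1/2:ℝ) • b (a (x (ξ j)) - y (x (ξ j)))‖ < ε / 8 := by
      rw [norm_smul, Real.norm_of_nonneg (by norm_num)]
      have := (b.le_of_opNorm_le hb1 (a (x (ξ j)) - y (x (ξ j))))
      have h0 := norm_nonneg (b (a (x (ξ j)) - y (x (ξ j))))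
      linarith [ha3 j]
    have := norm_sub_le ((2:ℝ) • R (a (ξ j) - y (ξ j)) - R (a (y (x (ξ j))) - y (y (x (ξ j))))) ((1/2:ℝ) • b (a (x (ξ j)) - y (x (ξ j))))
    have := norm_sub_le ((2:ℝ) • R (a (ξ j) - y (ξ j))) (R (a (y (x (ξ j))) - y (y (x (ξ j)))))
    linarith
  have hbm : b ∈ closure (A : Set (BH H)) := cfc_mem_clos A haA _
  have hsum : 0 ≤ ∑ j, ‖ξ j‖ := Finset.sum_nonneg (fun _ _ => norm_nonneg _)
  obtain ⟨c, hc, hd⟩ := Metric.mem_closure_iff.mp hbm (min 1 (ε / (2 * (1 + ∑ j, ‖ξ j‖)))) (by positivity)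
  rw [dist_eq_norm] at hd
  refine ⟨c, hc, ?_, fun j => ?_⟩
  · have : ‖b - c‖ ≤ 1 := hd.le.trans (min_le_left _ _)
    have h2 := norm_sub_norm_le c b
    rw [norm_sub_rev] at h2
    linarith
  · have h1 : ‖(b - c) (ξ j)‖ ≤ ε / 2 := by
      calc ‖(b - c) (ξ j)‖ ≤ ‖b - c‖ * ‖ξ j‖ := ContinuousLinearMap.le_opNorm _ _
        _ ≤ (ε / (2 * (1 + ∑ j, ‖ξ j‖))) * (1 + ∑ j, ‖ξ j‖) := by
          gcongr
          · exact hd.le.trans (min_le_right _ _)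
          · have := Finset.single_le_sum (f := fun j => ‖ξ j‖) (fun i _ => norm_nonneg _) (Finset.mem_univ j)
            linarith
        _ = ε / 2 := by field_simp
    have h2 : c (ξ j) - x (ξ j) = (b (ξ j) - x (ξ j)) - (b - c) (ξ j) := by simp
    rw [h2]
    have := norm_sub_le (b (ξ j) - x (ξ j)) ((b - c) (ξ j))
    linarith [hbb j]

def NetLim (A : Set (BH H)) (x : BH H) : Prop :=
  ∃ (C : ℝ) (z : Finset H × ℕ → BH H), (∀ i, z i ∈ A) ∧ (∀ i, ‖z i‖ ≤ C) ∧
    ∀ u v, Filter.Tendsto (fun i => ⟪u, z i v⟫_ℂ) Filter.atTop (nhds ⟪u, x v⟫_ℂ)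

lemma NetLim.add {A : StarSubalgebra ℂ (BH H)} {x y : BH H} (hx : NetLim (A : Set (BH H)) x) (hy : NetLim (A : Set (BH H)) y) :
    NetLim (A : Set (BH H)) (x + y) := by
  obtain ⟨C, z, h1, h2, h3⟩ := hx
  obtain ⟨D, w, k1, k2, k3⟩ := hy
  refine ⟨C + D, fun i => z i + w i, fun i => add_mem (h1 i) (k1 i), fun i => (norm_add_le _ _).trans (add_le_add (h2 i) (k2 i)), fun u v => ?_⟩
  simp only [ContinuousLinearMap.add_apply, inner_add_right]
  exact (h3 u v).add (k3 u v)

lemma NetLim.smul {A : StarSubalgebra ℂ (BH H)} {x : BH H} (hx : NetLim (A : Set (BH H)) x) (c : ℂ) :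
    NetLim (A : Set (BH H)) (c • x) := by
  obtain ⟨C, z, h1, h2, h3⟩ := hx
  refine ⟨‖c‖ * C, fun i => c • z i, fun i => SMulMemClass.smul_mem _ (h1 i), fun i => ?_, fun u v => ?_⟩
  · rw [norm_smul]; gcongr; exact h2 i
  · simp only [ContinuousLinearMap.smul_apply, inner_smul_right]
    exact (h3 u v).const_mul c

lemma kap (A : StarSubalgebra ℂ (BH H)) {x : BH H} (hx : ∀ z, (∀ a ∈ A, a * z = z * a) → x * z = z * x) :
    NetLim (A : Set (BH H)) x := by
  have hone : ∀ x : BH H, (∀ z, (∀ a ∈ A, a * z = z * a) → x * z = z * x) → IsSelfAdjoint x → ‖x‖ ≤ 1 →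
      NetLim (A : Set (BH H)) x := by
    intro x hx hsa hn
    have : ∀ i : Finset H × ℕ, ∃ c ∈ A, ‖c‖ ≤ 2 ∧ ∀ j : i.1, ‖c j - x j‖ < 1 / ((i.2 : ℝ) + 1) := by
      intro i
      exact kap_one A hx hsa hn (fun j : i.1 => (j : H)) (by positivity)
    choose z h1 h2 h3 using this
    refine ⟨2, z, h1, h2, fun u v => ?_⟩
    rw [tendsto_iff_norm_sub_tendsto_zero]
    have hb : Filter.Tendsto (fun i : Finset H × ℕ => ‖u‖ * (1 / ((i.2 : ℝ) + 1))) Filter.atTop (nhds 0) := by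
      have : Filter.Tendsto (fun n : ℕ => ‖u‖ * (1 / ((n : ℝ) + 1))) Filter.atTop (nhds (‖u‖ * 0)) :=
        tendsto_one_div_add_atTop_nhds_zero_nat.const_mul _
      rw [mul_zero] at this
      exact this.comp (by rw [← Filter.prod_atTop_atTop_eq]; exact Filter.tendsto_snd)
    apply squeeze_zero' (Filter.Eventually.of_forall (fun _ => norm_nonneg _)) _ hb
    filter_upwards [Filter.eventually_ge_atTop (({v}, 0) : Finset H × ℕ)] with i hi
    have hv : v ∈ i.1 := hi.1 (Finset.mem_singleton_self v)
    rw [← inner_sub_right]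
    refine (norm_inner_le_norm _ _).trans ?_
    gcongr
    exact (h3 i ⟨v, hv⟩).le
  have hsa : ∀ x : BH H, (∀ z, (∀ a ∈ A, a * z = z * a) → x * z = z * x) → IsSelfAdjoint x →
      NetLim (A : Set (BH H)) x := by
    intro x hx hsa
    have hp : (0:ℝ) < ‖x‖ + 1 := by positivity
    have hp' : ((‖x‖ + 1 : ℝ) : ℂ) ≠ 0 := by exact_mod_cast hp.ne'
    have h1 := (hone ((((‖x‖ + 1 : ℝ) : ℂ)⁻¹) • x) (fun z hz => by
      rw [smul_mul_assoc, mul_smul_comm, hx z hz]) (by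
      rw [IsSelfAdjoint, star_smul, star_sa hsa]; simp) (by
      rw [norm_smul, norm_inv, Complex.norm_real, Real.norm_of_nonneg hp.le, inv_mul_le_iff₀ hp]; linarith)).smul
      ((‖x‖ + 1 : ℝ) : ℂ)
    rwa [smul_smul, mul_inv_cancel₀ hp', one_smul] at h1
  have hst : ∀ z, (∀ a ∈ A, a * z = z * a) → star x * z = z * star x := by
    intro z hz
    have h3 := hx (star z) (fun a ha => by
      have := congrArg star (hz (star a) (star_mem ha))
      simpa using this.symm)
    have := congrArg star h3
    simpa using this.symm
  have hr := hsa ((1/2:ℂ) • (x + star x)) (fun z hz => by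
    rw [smul_mul_assoc, mul_smul_comm, add_mul, mul_add, hx z hz, hst z hz]) (by
    rw [IsSelfAdjoint, star_smul, star_add, star_star, add_comm]; simp)
  have hi := hsa ((Complex.I/2:ℂ) • (star x - x)) (fun z hz => by
    rw [smul_mul_assoc, mul_smul_comm, sub_mul, mul_sub, hx z hz, hst z hz]) (by
    rw [IsSelfAdjoint, star_smul, star_sub, star_star, ← neg_sub, smul_neg, ← neg_smul]
    congr 1
    simp [neg_div])
  have := hr.add (hi.smul Complex.I)
  have e : (1/2:ℂ) • (x + star x) + Complex.I • ((Complex.I/2:ℂ) • (star x - x)) = x := by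
    rw [smul_smul, show Complex.I * (Complex.I / 2) = -(1/2) by rw [← mul_div_assoc, Complex.I_mul_I]; ring]
    module
  rwa [e] at this

def Ms (M₁ M₂ : VonNeumannAlgebra H) (i : Bool) : VonNeumannAlgebra H := match i with
  | true => M₁
  | false => M₂

inductive Red (M₁ M₂ : VonNeumannAlgebra H) (E : BH H → BH H) : Bool → Bool → BH H → Prop
  | single (i : Bool) (x : BH H) (hx : x ∈ Ms M₁ M₂ i) (h0 : E x = 0) : Red M₁ M₂ E i i x
  | cons (i j : Bool) (x w : BH H) (hx : x ∈ Ms M₁ M₂ i) (h0 : E x = 0) (hw : Red M₁ M₂ E (!i) j w) :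
      Red M₁ M₂ E i j (x * w)

section words
variable {M M₁ M₂ B : VonNeumannAlgebra H} {E : BH H → BH H}

lemma IsAFP.msM (h : IsAFP M M₁ M₂ B E) {i : Bool} {x : BH H} (hx : x ∈ Ms M₁ M₂ i) : x ∈ M := by
  cases i
  · exact h.le₂M hx
  · exact h.le₁M hx

lemma IsAFP.bMs (h : IsAFP M M₁ M₂ B E) (i : Bool) {x : BH H} (hx : x ∈ B) : x ∈ Ms M₁ M₂ i := by
  cases i
  · exact h.le₂ hx
  · exact h.le₁ hx

lemma IsAFP.bM (h : IsAFP M M₁ M₂ B E) {x : BH H} (hx : x ∈ B) : x ∈ M := h.msM (h.bMs true hx)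

lemma IsAFP.eB (h : IsAFP M M₁ M₂ B E) {x : BH H} (hx : x ∈ M) : E x ∈ B := h.condExp.maps_to x hx

lemma Red.list {i j : Bool} {w : BH H} (hw : Red M₁ M₂ E i j w) :
    ∃ (n : ℕ) (x : Fin (n+1) → BH H) (ι : Fin (n+1) → Bool), ι 0 = i ∧
    (∀ k, x k ∈ (if ι k then (M₁ : Set (BH H)) else (M₂ : Set (BH H))) ∧ E (x k) = 0) ∧
    (∀ (k : ℕ) (h : k + 1 < n + 1), ι ⟨k, Nat.lt_of_succ_lt h⟩ ≠ ι ⟨k + 1, h⟩) ∧ (List.ofFn x).prod = w := by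
  induction hw with
  | single i x hx h0 =>
    refine ⟨0, fun _ => x, fun _ => i, rfl, fun k => ⟨?_, h0⟩, fun k hk => by omega, by simp⟩
    cases i <;> simpa [Ms] using hx
  | cons i j x w hx h0 hw ih =>
    obtain ⟨n, y, ι, h1, h2, h3, h4⟩ := ih
    refine ⟨n + 1, Fin.cons x y, Fin.cons i ι, rfl, ?_, ?_, ?_⟩
    · intro k
      refine Fin.cases ?_ (fun k => ?_) k
      · refine ⟨?_, h0⟩
        cases i <;> simpa [Ms] using hx
      · simpa using h2 k
    · intro k hk
      cases k with
      | zero =>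
        have e : (⟨0 + 1, hk⟩ : Fin (n + 1 + 1)) = Fin.succ 0 := rfl
        have e0 : (⟨0, Nat.lt_of_succ_lt hk⟩ : Fin (n + 1 + 1)) = 0 := rfl
        rw [e, e0, Fin.cons_succ, Fin.cons_zero, h1]
        cases i <;> simp
      | succ k => exact h3 k (by omega)
    · rw [List.ofFn_succ]
      simp only [Fin.cons_zero, Fin.cons_succ, List.prod_cons, h4]

lemma Red.E0 (h : IsAFP M M₁ M₂ B E) {i j : Bool} {w : BH H} (hw : Red M₁ M₂ E i j w) : E w = 0 := by
  obtain ⟨n, x, ι, -, h2, h3, h4⟩ := hw.list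
  rw [← h4]
  exact h.free (n+1) x ι (Nat.succ_pos _) h2 h3

lemma Red.memM (h : IsAFP M M₁ M₂ B E) {i j : Bool} {w : BH H} (hw : Red M₁ M₂ E i j w) : w ∈ M := by
  induction hw with
  | single i x hx h0 => exact h.msM hx
  | cons i j x w hx h0 hw ih => exact mul_mem (h.msM hx) ih

lemma Red.lB (h : IsAFP M M₁ M₂ B E) {i j : Bool} {w b : BH H} (hw : Red M₁ M₂ E i j w) (hb : b ∈ B) :
    Red M₁ M₂ E i j (b * w) := by
  cases hw with
  | single i x hx h0 =>
    refine Red.single _ _ (mul_mem (h.bMs _ hb) hx) ?_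
    rw [ce_left h.condExp hb (h.msM hx), h0, mul_zero]
  | cons i j x w hx h0 hw =>
    rw [← mul_assoc]
    refine Red.cons _ _ _ _ (mul_mem (h.bMs _ hb) hx) ?_ hw
    rw [ce_left h.condExp hb (h.msM hx), h0, mul_zero]

lemma Red.append {i j l : Bool} {w v : BH H} (hw : Red M₁ M₂ E i j w) (hv : Red M₁ M₂ E (!j) l v) :
    Red M₁ M₂ E i l (w * v) := by
  induction hw with
  | single i x hx h0 => exact Red.cons _ _ _ _ hx h0 hv
  | cons i j x w hx h0 hw ih =>
    rw [mul_assoc]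
    exact Red.cons _ _ _ _ hx h0 (ih hv)

lemma Red.star (h : IsAFP M M₁ M₂ B E) {i j : Bool} {w : BH H} (hw : Red M₁ M₂ E i j w) :
    Red M₁ M₂ E j i (star w) := by
  induction hw with
  | single i x hx h0 =>
    exact Red.single _ _ (star_mem hx) (by rw [ce_star h.condExp (h.msM hx), h0, star_zero])
  | cons i j x w hx h0 hw ih =>
    rw [star_mul]
    refine ih.append ?_
    rw [Bool.not_not]
    exact Red.single _ _ (star_mem hx) (by rw [ce_star h.condExp (h.msM hx), h0, star_zero])

lemma Red.rB (h : IsAFP M M₁ M₂ B E) {i j : Bool} {w b : BH H} (hw : Red M₁ M₂ E i j w) (hb : b ∈ B) :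
    Red M₁ M₂ E i j (w * b) := by
  have := ((hw.star h).lB h (star_mem hb)).star h
  simpa using this

/-- generators of the p-part -/
def Gp (M₁ M₂ B : VonNeumannAlgebra H) (E : BH H → BH H) : Set (BH H) :=
  {w | w ∈ B ∨ ∃ j, Red M₁ M₂ E false j w}

def Gq (M₁ M₂ : VonNeumannAlgebra H) (E : BH H → BH H) : Set (BH H) := {w | ∃ j, Red M₁ M₂ E true j w}

def Lp (M₁ M₂ B : VonNeumannAlgebra H) (E : BH H → BH H) : Submodule ℂ (BH H) := Submodule.span ℂ (Gp M₁ M₂ B E)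
def Lq (M₁ M₂ : VonNeumannAlgebra H) (E : BH H → BH H) : Submodule ℂ (BH H) := Submodule.span ℂ (Gq M₁ M₂ E)

lemma IsAFP.ce_cent (h : IsAFP M M₁ M₂ B E) {x : BH H} (hx : x ∈ M) : E (x - E x) = 0 := by
  rw [ce_sub h.condExp hx (h.bM (h.eB hx)), h.condExp.fixes _ (h.eB hx), sub_self]

lemma IsAFP.cent_mem (h : IsAFP M M₁ M₂ B E) {i : Bool} {x : BH H} (hx : x ∈ Ms M₁ M₂ i) :
    x - E x ∈ Ms M₁ M₂ i := sub_mem hx (h.bMs i (h.eB (h.msM hx)))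

lemma IsAFP.gpM (h : IsAFP M M₁ M₂ B E) {x : BH H} (hx : x ∈ Gp M₁ M₂ B E) : x ∈ M := by
  rcases hx with hx | ⟨j, hx⟩
  · exact h.bM hx
  · exact hx.memM h

lemma span_le_vn {S : Set (BH H)} (hS : ∀ x ∈ S, x ∈ M) {x : BH H} (hx : x ∈ Submodule.span ℂ S) : x ∈ M := by
  induction hx using Submodule.span_induction with
  | mem x hx => exact hS x hx
  | zero => exact zero_mem M
  | add x y _ _ hx hy => exact add_mem hx hy
  | smul c x _ hx => exact M.smul_mem hx c

lemma IsAFP.lpM (h : IsAFP M M₁ M₂ B E) {x : BH H} (hx : x ∈ Lp M₁ M₂ B E) : x ∈ M :=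
  span_le_vn (fun _ => h.gpM) hx

lemma IsAFP.lqM (h : IsAFP M M₁ M₂ B E) {x : BH H} (hx : x ∈ Lq M₁ M₂ E) : x ∈ M :=
  span_le_vn (S := Gq M₁ M₂ E) (fun _ hx => hx.elim (fun _ hx => hx.memM h)) hx

lemma IsAFP.sesq0 (h : IsAFP M M₁ M₂ B E) {S T : Set (BH H)} {x : BH H} (hx : x ∈ M) (hS : ∀ u ∈ S, u ∈ M) (hT : ∀ u ∈ T, u ∈ M)
    (h0 : ∀ u ∈ S, ∀ v ∈ T, E (star u * x * v) = 0) {u v : BH H} (hu : u ∈ Submodule.span ℂ S) (hv : v ∈ Submodule.span ℂ T) :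
    E (star u * x * v) = 0 := by
  have h1 : ∀ u ∈ S, ∀ v ∈ Submodule.span ℂ T, E (star u * x * v) = 0 := by
    intro u hu v hv
    have huM := mul_mem (star_mem (hS u hu)) hx
    induction hv using Submodule.span_induction with
    | mem v hv => exact h0 u hu v hv
    | zero => rw [mul_zero, ce_zero h.condExp]
    | add a b ha hb iha ihb =>
      rw [mul_add, h.condExp.map_add _ (mul_mem huM (span_le_vn hT ha)) _ (mul_mem huM (span_le_vn hT hb)), iha, ihb, add_zero]
    | smul c a ha iha =>
      rw [mul_smul_comm, h.condExp.map_smul _ _ (mul_mem huM (span_le_vn hT ha)), iha, smul_zero]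
  have hvM := span_le_vn hT hv
  induction hu using Submodule.span_induction with
  | mem u hu => exact h1 u hu v hv
  | zero => rw [star_zero, zero_mul, zero_mul, ce_zero h.condExp]
  | add a b ha hb iha ihb =>
    rw [star_add, add_mul, add_mul, h.condExp.map_add _ (mul_mem (mul_mem (star_mem (span_le_vn hS ha)) hx) hvM) _
      (mul_mem (mul_mem (star_mem (span_le_vn hS hb)) hx) hvM), iha, ihb, add_zero]
  | smul c a ha iha =>
    rw [star_smul, smul_mul_assoc, smul_mul_assoc,
      h.condExp.map_smul _ _ (mul_mem (mul_mem (star_mem (span_le_vn hS ha)) hx) hvM), iha, smul_zero]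

lemma IsAFP.F1 (h : IsAFP M M₁ M₂ B E) {x u v : BH H} (hx : x ∈ M₁) (hu : u ∈ Lp M₁ M₂ B E) (hv : v ∈ Lp M₁ M₂ B E) :
    E (star u * x * v) = E (star u * E x * v) := by
  have hxM := h.le₁M hx
  have key : E (star u * (x - E x) * v) = 0 := by
    apply h.sesq0 (sub_mem hxM (h.bM (h.eB hxM))) (fun _ => h.gpM) (fun _ => h.gpM) ?_ hu hv
    intro u hu v hv
    have hr : Red M₁ M₂ E true true (x - E x) := Red.single _ _ (h.cent_mem (i := true) hx) (h.ce_cent hxM)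
    have : ∃ i j, Red M₁ M₂ E i j (star u * (x - E x) * v) := by
      have h1 : ∃ i, Red M₁ M₂ E i true (star u * (x - E x)) := by
        rcases hu with hu | ⟨j, hu⟩
        · exact ⟨_, hr.lB h (star_mem hu)⟩
        · exact ⟨_, (hu.star h).append hr⟩
      obtain ⟨i, h1⟩ := h1
      rcases hv with hv | ⟨j, hv⟩
      · exact ⟨_, _, h1.rB h hv⟩
      · exact ⟨_, _, h1.append hv⟩
    obtain ⟨i, j, hw⟩ := this
    exact hw.E0 h
  rw [mul_sub, sub_mul, ce_sub h.condExp (mul_mem (mul_mem (star_mem (h.lpM hu)) hxM) (h.lpM hv))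
    (mul_mem (mul_mem (star_mem (h.lpM hu)) (h.bM (h.eB hxM))) (h.lpM hv))] at key
  exact sub_eq_zero.mp key

lemma IsAFP.F2 (h : IsAFP M M₁ M₂ B E) {u v : BH H} (hu : u ∈ Lp M₁ M₂ B E) (hv : v ∈ Lq M₁ M₂ E) :
    E (star u * v) = 0 := by
  have := h.sesq0 (x := 1) (one_mem M) (fun _ => h.gpM) (fun _ ⟨_, hx⟩ => hx.memM h) (S := Gp M₁ M₂ B E) (T := Gq M₁ M₂ E) (by
    rintro u hu v ⟨l, hv⟩
    rw [mul_one]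
    rcases hu with hu | ⟨j, hu⟩
    · exact (hv.lB h (star_mem hu)).E0 h
    · exact ((hu.star h).append hv).E0 h) hu hv
  rwa [mul_one] at this

lemma IsAFP.F4 {w v : BH H} (hw : Red M₁ M₂ E false false w) (hv : v ∈ Lq M₁ M₂ E) :
    w * v ∈ Lp M₁ M₂ B E := by
  induction hv using Submodule.span_induction with
  | mem v hv =>
    obtain ⟨j, hv⟩ := hv
    exact Submodule.subset_span (Or.inr ⟨j, hw.append hv⟩)
  | zero => rw [mul_zero]; exact zero_mem _
  | add a b ha hb iha ihb => rw [mul_add]; exact add_mem iha ihb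
  | smul c a ha iha => rw [mul_smul_comm]; exact Submodule.smul_mem _ _ iha

lemma IsAFP.F5 (h : IsAFP M M₁ M₂ B E) {b v : BH H} (hb : b ∈ B) (hv : v ∈ Lp M₁ M₂ B E) :
    b * v ∈ Lp M₁ M₂ B E := by
  induction hv using Submodule.span_induction with
  | mem v hv =>
    rcases hv with hv | ⟨j, hv⟩
    · exact Submodule.subset_span (Or.inl (mul_mem hb hv))
    · exact Submodule.subset_span (Or.inr ⟨j, hv.lB h hb⟩)
  | zero => rw [mul_zero]; exact zero_mem _
  | add a b ha hb iha ihb => rw [mul_add]; exact add_mem iha ihb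
  | smul c a ha iha => rw [mul_smul_comm]; exact Submodule.smul_mem _ _ iha

lemma IsAFP.F7 (h : IsAFP M M₁ M₂ B E) {a b w : BH H} (ha : a ∈ M₁) (hb : b ∈ M₁) (hw : Red M₁ M₂ E false false w) :
    E (a * w * b) = 0 := by
  have hsp : ∀ a ∈ M₁, a ∈ Submodule.span ℂ {x | x ∈ B ∨ Red M₁ M₂ E true true x} := by
    intro a ha
    have : a = E a + (a - E a) := by abel
    rw [this]
    exact add_mem (Submodule.subset_span (Or.inl (h.eB (h.le₁M ha))))
      (Submodule.subset_span (Or.inr (Red.single _ _ (h.cent_mem (i := true) ha) (h.ce_cent (h.le₁M ha)))))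
  have hM : ∀ x ∈ {x | x ∈ B ∨ Red M₁ M₂ E true true x}, x ∈ M := by
    rintro x (hx | hx)
    · exact h.bM hx
    · exact hx.memM h
  have := h.sesq0 (x := w) (hw.memM h) hM hM (by
    intro u hu v hv
    have h1 : ∃ i, Red M₁ M₂ E i false (star u * w) := by
      rcases hu with hu | hu
      · exact ⟨_, hw.lB h (star_mem hu)⟩
      · exact ⟨_, (hu.star h).append hw⟩
    obtain ⟨i, h1⟩ := h1
    rcases hv with hv | hv
    · exact (h1.rB h hv).E0 h
    · exact (h1.append hv).E0 h) (hsp _ (star_mem ha)) (hsp _ hb)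
  rwa [star_star] at this

/-- elements `a w b` -/
def G3 (M₁ M₂ : VonNeumannAlgebra H) (E : BH H → BH H) : Set (BH H) :=
  {x | x ∈ M₁ ∨ ∃ a ∈ M₁, ∃ b ∈ M₁, ∃ w, Red M₁ M₂ E false false w ∧ x = a * w * b}

lemma Red.g3 (h : IsAFP M M₁ M₂ B E) {i j : Bool} {w : BH H} (hw : Red M₁ M₂ E i j w) : w ∈ G3 M₁ M₂ E := by
  have h2 : ∀ j w, Red M₁ M₂ E false j w → ∃ b ∈ M₁, ∃ v, Red M₁ M₂ E false false v ∧ w = v * b := by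
    intro j w hw
    cases j with
    | false => exact ⟨1, one_mem _, w, hw, by simp⟩
    | true =>
      have hs := hw.star h
      generalize hx : Star.star w = x at hs
      cases hs with
      | cons _ _ x v hx' h0 hv =>
        refine ⟨Star.star x, star_mem (show x ∈ M₁ from hx'), Star.star v, hv.star h, ?_⟩
        rw [← star_mul, ← hx, star_star]
  cases i with
  | false =>
    obtain ⟨b, hb, v, hv, rfl⟩ := h2 _ _ hw
    exact Or.inr ⟨1, one_mem _, b, hb, v, hv, by simp⟩
  | true =>
    cases hw with
    | single _ x hx h0 => exact Or.inl hx
    | cons _ _ x w hx h0 hw =>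
      obtain ⟨b, hb, v, hv, rfl⟩ := h2 _ _ hw
      exact Or.inr ⟨x, hx, b, hb, v, hv, by rw [mul_assoc]⟩

def Malg (M₁ M₂ : VonNeumannAlgebra H) : StarSubalgebra ℂ (BH H) :=
  StarAlgebra.adjoin ℂ ((M₁ : Set (BH H)) ∪ (M₂ : Set (BH H)))

def Sall (M₁ M₂ B : VonNeumannAlgebra H) (E : BH H → BH H) : Submodule ℂ (BH H) :=
  Submodule.span ℂ {w | w ∈ B ∨ ∃ i j, Red M₁ M₂ E i j w}

lemma IsAFP.ms_sall (h : IsAFP M M₁ M₂ B E) {i : Bool} {x : BH H} (hx : x ∈ Ms M₁ M₂ i) : x ∈ Sall M₁ M₂ B E := by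
  have : x = E x + (x - E x) := by abel
  rw [this]
  exact add_mem (Submodule.subset_span (Or.inl (h.eB (h.msM hx))))
    (Submodule.subset_span (Or.inr ⟨i, i, Red.single _ _ (h.cent_mem hx) (h.ce_cent (h.msM hx))⟩))

lemma IsAFP.ms_mul_sall (h : IsAFP M M₁ M₂ B E) {i : Bool} {x s : BH H} (hx : x ∈ Ms M₁ M₂ i) (hs : s ∈ Sall M₁ M₂ B E) :
    x * s ∈ Sall M₁ M₂ B E := by
  have h1 : ∀ (i j : Bool) (x w : BH H), x ∈ Ms M₁ M₂ i → Red M₁ M₂ E (!i) j w → x * w ∈ Sall M₁ M₂ B E := by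
    intro i j x w hx hw
    have : x * w = E x * w + (x - E x) * w := by noncomm_ring
    rw [this]
    exact add_mem (Submodule.subset_span (Or.inr ⟨_, _, hw.lB h (h.eB (h.msM hx))⟩))
      (Submodule.subset_span (Or.inr ⟨_, _, Red.cons _ _ _ _ (h.cent_mem hx) (h.ce_cent (h.msM hx)) hw⟩))
  induction hs using Submodule.span_induction with
  | mem w hw =>
    rcases hw with hw | ⟨k, j, hw⟩
    · exact h.ms_sall (mul_mem hx (h.bMs i hw))
    · by_cases hk : k = i
      · subst hk
        cases hw with
        | single _ y hy h0 => exact h.ms_sall (mul_mem hx hy)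
        | cons _ _ y w hy h0 hw =>
          rw [← mul_assoc]
          exact h1 _ _ _ _ (mul_mem hx hy) hw
      · have : k = !i := by cases k <;> cases i <;> simp_all
        subst this
        exact h1 _ _ _ _ hx hw
  | zero => rw [mul_zero]; exact zero_mem _
  | add a b ha hb iha ihb => rw [mul_add]; exact add_mem iha ihb
  | smul c a ha iha => rw [mul_smul_comm]; exact Submodule.smul_mem _ _ iha

lemma IsAFP.malg_sall (h : IsAFP M M₁ M₂ B E) {x : BH H} (hx : x ∈ Malg M₁ M₂) : x ∈ Sall M₁ M₂ B E := by
  have key : (∀ s ∈ Sall M₁ M₂ B E, x * s ∈ Sall M₁ M₂ B E) ∧ (∀ s ∈ Sall M₁ M₂ B E, Star.star x * s ∈ Sall M₁ M₂ B E) := by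
    induction hx using StarAlgebra.adjoin_induction with
    | mem x hx =>
      rcases hx with hx | hx
      · exact ⟨fun s hs => h.ms_mul_sall (i := true) hx hs, fun s hs => h.ms_mul_sall (i := true) (star_mem (show x ∈ M₁ from hx)) hs⟩
      · exact ⟨fun s hs => h.ms_mul_sall (i := false) hx hs, fun s hs => h.ms_mul_sall (i := false) (star_mem (show x ∈ M₂ from hx)) hs⟩
    | algebraMap r =>
      rw [Algebra.algebraMap_eq_smul_one, star_smul, star_one]
      exact ⟨fun s hs => by rw [smul_mul_assoc, one_mul]; exact Submodule.smul_mem _ _ hs,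
        fun s hs => by rw [smul_mul_assoc, one_mul]; exact Submodule.smul_mem _ _ hs⟩
    | add x y _ _ hx hy =>
      refine ⟨fun s hs => ?_, fun s hs => ?_⟩
      · rw [add_mul]; exact add_mem (hx.1 s hs) (hy.1 s hs)
      · rw [star_add, add_mul]; exact add_mem (hx.2 s hs) (hy.2 s hs)
    | mul x y _ _ hx hy =>
      refine ⟨fun s hs => ?_, fun s hs => ?_⟩
      · rw [mul_assoc]; exact hx.1 _ (hy.1 s hs)
      · rw [star_mul, mul_assoc]; exact hy.2 _ (hx.2 s hs)
    | star x _ hx => exact ⟨hx.2, by rw [star_star]; exact hx.1⟩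
  have := key.1 1 (Submodule.subset_span (Or.inl (one_mem B)))
  rwa [mul_one] at this

lemma IsAFP.malg_pq (h : IsAFP M M₁ M₂ B E) {x : BH H} (hx : x ∈ Malg M₁ M₂) :
    ∃ u ∈ Lp M₁ M₂ B E, ∃ v ∈ Lq M₁ M₂ E, x = u + v := by
  have hx := h.malg_sall hx
  have : Sall M₁ M₂ B E ≤ Lp M₁ M₂ B E ⊔ Lq M₁ M₂ E := by
    apply Submodule.span_le.mpr
    rintro w (hw | ⟨i, j, hw⟩)
    · exact Submodule.mem_sup_left (Submodule.subset_span (Or.inl hw))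
    · cases i
      · exact Submodule.mem_sup_left (Submodule.subset_span (Or.inr ⟨_, hw⟩))
      · exact Submodule.mem_sup_right (Submodule.subset_span ⟨_, hw⟩)
  obtain ⟨u, hu, v, hv, e⟩ := Submodule.mem_sup.mp (this hx)
  exact ⟨u, hu, v, hv, e.symm⟩

lemma IsAFP.malg_g3 (h : IsAFP M M₁ M₂ B E) {x : BH H} (hx : x ∈ Malg M₁ M₂) :
    x ∈ Submodule.span ℂ (G3 M₁ M₂ E) := by
  have hx := h.malg_sall hx
  have : Sall M₁ M₂ B E ≤ Submodule.span ℂ (G3 M₁ M₂ E) := by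
    apply Submodule.span_mono
    rintro w (hw | ⟨i, j, hw⟩)
    · exact Or.inl (h.le₁ hw)
    · exact hw.g3 h
  exact this hx

lemma IsAFP.malgM (h : IsAFP M M₁ M₂ B E) {x : BH H} (hx : x ∈ Malg M₁ M₂) : x ∈ M := by
  have hx := h.malg_sall hx
  refine span_le_vn ?_ hx
  rintro w (hw | ⟨i, j, hw⟩)
  · exact h.bM hw
  · exact hw.memM h

lemma IsAFP.net (h : IsAFP M M₁ M₂ B E) {x : BH H} (hx : x ∈ M) : NetLim (Malg M₁ M₂ : Set (BH H)) x := by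
  apply kap
  intro z hz
  have hx' : x ∈ (M : Set (BH H)) := hx
  rw [← h.generated] at hx'
  refine (hx' z ?_).symm
  intro a ha
  exact hz a (StarAlgebra.subset_adjoin ℂ _ ha)

end words

section E1
variable {M M₁ M₂ B : VonNeumannAlgebra H} {E : BH H → BH H}

lemma le_zero_of_eps {h : BH H} (hsa : IsSelfAdjoint h) (hε : ∀ ε : ℝ, 0 < ε → h ≤ (ε:ℂ) • 1) : h ≤ 0 := by
  rw [← neg_nonneg]
  apply nonneg_of_re hsa.neg
  intro x
  simp only [ContinuousLinearMap.neg_apply, inner_neg_right, Complex.neg_re]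
  rw [neg_nonneg]
  apply le_of_forall_pos_le_add
  intro ε hε0
  have := inner_re_mono (hε (ε / (‖x‖^2 + 1)) (by positivity)) x
  refine this.trans ?_
  simp only [ContinuousLinearMap.smul_apply, ContinuousLinearMap.one_apply, inner_smul_right, Complex.re_ofReal_mul]
  rw [inner_self_eq_norm_sq_to_K]
  have e : (((‖x‖:ℝ):ℂ)^2).re = ‖x‖^2 := by
    rw [← Complex.ofReal_pow, Complex.ofReal_re]
  simp only [Complex.coe_algebraMap, e, zero_add]
  rw [div_mul_eq_mul_div, div_le_iff₀ (by positivity)]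
  nlinarith [sq_nonneg ‖x‖]

lemma IsAFP.test (h : IsAFP M M₁ M₂ B E) {N : VonNeumannAlgebra H} (hN : ∀ x ∈ N, x ∈ M) {a : BH H} (ha : a ∈ N) (hsa : IsSelfAdjoint a)
    (ht : ∀ b ∈ N, E (star b * a * b) ≤ 0) : a ≤ 0 := by
  apply le_zero_of_eps hsa
  intro ε hε
  obtain ⟨s, hs, hc, h1, -, h2, -⟩ := SP hsa ε
  apply h2
  have hsN := SP_mem ha hc
  have hca : s * a = a * s := (hc a (Commute.refl a)).symm.eq
  have h3 := ht s hsN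
  have e : star s * a * s = s * a := by rw [star_sa hs.1, mul_assoc, ← hca, ← mul_assoc, hs.2.eq]
  rw [e] at h3
  have h4 := (ce_mono h.condExp (M.smul_mem (hN s hsN) _) (hN _ (mul_mem hsN ha)) h1).trans h3
  rw [h.condExp.map_smul _ _ (hN s hsN)] at h4
  have h5 := h.condExp.pos s (hN s hsN) (proj_nonneg hs)
  have h6 : E s ≤ 0 := by
    have := smul_nonneg (show (0:ℂ) ≤ ((ε⁻¹ : ℝ) : ℂ) by exact_mod_cast (inv_pos.mpr hε).le) (neg_nonneg.mpr h4)
    rw [smul_neg, smul_smul, ← Complex.ofReal_mul, inv_mul_cancel₀ hε.ne', Complex.ofReal_one, one_smul] at this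
    exact neg_nonneg.mp this
  exact h.faithful s (hN s hsN) (proj_nonneg hs) (le_antisymm h6 h5)

def RR (M₁ : VonNeumannAlgebra H) (E : BH H → BH H) (x y : BH H) : Prop :=
  y ∈ M₁ ∧ ∀ a ∈ M₁, ∀ b ∈ M₁, E (a * x * b) = E (a * y * b)

lemma RR.self {y : BH H} (hy : y ∈ M₁) : RR M₁ E y y := ⟨hy, fun _ _ _ _ => rfl⟩

lemma RR.add (h : IsAFP M M₁ M₂ B E) {x y x' y' : BH H} (hx : x ∈ M) (hx' : x' ∈ M) (h1 : RR M₁ E x y) (h2 : RR M₁ E x' y') :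
    RR M₁ E (x + x') (y + y') := by
  refine ⟨add_mem h1.1 h2.1, fun a ha b hb => ?_⟩
  have haM := h.le₁M ha
  have hbM := h.le₁M hb
  rw [mul_add, add_mul, mul_add, add_mul, h.condExp.map_add _ (mul_mem (mul_mem haM hx) hbM) _ (mul_mem (mul_mem haM hx') hbM),
    h.condExp.map_add _ (mul_mem (mul_mem haM (h.le₁M h1.1)) hbM) _ (mul_mem (mul_mem haM (h.le₁M h2.1)) hbM),
    h1.2 a ha b hb, h2.2 a ha b hb]

lemma RR.smul (h : IsAFP M M₁ M₂ B E) {x y : BH H} (hx : x ∈ M) (h1 : RR M₁ E x y) (c : ℂ) :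
    RR M₁ E (c • x) (c • y) := by
  refine ⟨M₁.smul_mem h1.1 c, fun a ha b hb => ?_⟩
  have haM := h.le₁M ha
  have hbM := h.le₁M hb
  rw [mul_smul_comm, smul_mul_assoc, mul_smul_comm, smul_mul_assoc, h.condExp.map_smul _ _ (mul_mem (mul_mem haM hx) hbM),
    h.condExp.map_smul _ _ (mul_mem (mul_mem haM (h.le₁M h1.1)) hbM), h1.2 a ha b hb]

lemma RR.bimod {x y c d : BH H} (h1 : RR M₁ E x y) (hc : c ∈ M₁) (hd : d ∈ M₁) :
    RR M₁ E (c * x * d) (c * y * d) := by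
  refine ⟨mul_mem (mul_mem hc h1.1) hd, fun a ha b hb => ?_⟩
  have := h1.2 (a * c) (mul_mem ha hc) (d * b) (mul_mem hd hb)
  simp only [mul_assoc] at this ⊢
  exact this

lemma RR.star (h : IsAFP M M₁ M₂ B E) {x y : BH H} (hx : x ∈ M) (h1 : RR M₁ E x y) : RR M₁ E (star x) (star y) := by
  refine ⟨star_mem h1.1, fun a ha b hb => ?_⟩
  have haM := h.le₁M ha
  have hbM := h.le₁M hb
  have := congrArg Star.star (h1.2 (Star.star b) (star_mem hb) (Star.star a) (star_mem ha))
  rw [← ce_star h.condExp (mul_mem (mul_mem (star_mem hbM) hx) (star_mem haM)),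
    ← ce_star h.condExp (mul_mem (mul_mem (star_mem hbM) (h.le₁M h1.1)) (star_mem haM))] at this
  simpa [mul_assoc] using this

lemma RR.zero (h : IsAFP M M₁ M₂ B E) {y : BH H} (h1 : RR M₁ E 0 y) : y = 0 := by
  have h2 := h1.2 (Star.star y) (star_mem h1.1) 1 (one_mem _)
  rw [mul_zero, zero_mul, ce_zero h.condExp, mul_one] at h2
  have := h.faithful _ (mul_mem (star_mem (h.le₁M h1.1)) (h.le₁M h1.1)) (star_mul_self_nonneg y) h2.symm
  exact (CStarRing.star_mul_self_eq_zero_iff y).mp this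

lemma RR.unique (h : IsAFP M M₁ M₂ B E) {x y y' : BH H} (hx : x ∈ M) (h1 : RR M₁ E x y) (h2 : RR M₁ E x y') : y = y' := by
  have := h1.add h hx (M.smul_mem hx _) (h2.smul h hx (-1))
  have e : x + (-1:ℂ) • x = 0 := by simp
  rw [e] at this
  have := this.zero h
  simpa [sub_eq_zero, ← sub_eq_add_neg] using this

lemma RR.nonneg (h : IsAFP M M₁ M₂ B E) {x y : BH H} (hx : x ∈ M) (h0 : 0 ≤ x) (h1 : RR M₁ E x y) : 0 ≤ y := by
  have hsa : IsSelfAdjoint y := by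
    have := h1.star h hx
    rw [star_sa (sa_of_nonneg h0)] at this
    exact this.unique h hx h1
  rw [← neg_nonpos]
  apply h.test (fun x hx => h.le₁M hx) (neg_mem h1.1) hsa.neg
  intro b hb
  have hbM := h.le₁M hb
  rw [mul_neg, neg_mul, ce_neg h.condExp (mul_mem (mul_mem (star_mem hbM) (h.le₁M h1.1)) hbM), neg_nonpos,
    ← h1.2 _ (star_mem hb) _ hb]
  exact h.condExp.pos _ (mul_mem (mul_mem (star_mem hbM) hx) hbM) (conj_nonneg' h0 b)

lemma RR.eq_zero (h : IsAFP M M₁ M₂ B E) {x : BH H} (hx : x ∈ M) (h0 : 0 ≤ x) (h1 : RR M₁ E x 0) : x = 0 := by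
  apply h.faithful x hx h0
  have := h1.2 1 (one_mem _) 1 (one_mem _)
  simpa [ce_zero h.condExp] using this

lemma RR.norm (h : IsAFP M M₁ M₂ B E) {x y : BH H} (hx : x ∈ M) (h1 : RR M₁ E x y) : ‖y‖ ≤ ‖x‖ := by
  have hyM := h.le₁M h1.1
  have hsx := star_mul_self_nonneg x
  have hle : Star.star y * y - ((‖x‖^2 : ℝ) : ℂ) • 1 ≤ 0 := by
    apply h.test (fun x hx => h.le₁M hx) (sub_mem (mul_mem (star_mem h1.1) h1.1) (M₁.smul_mem (one_mem _) _))
    · rw [IsSelfAdjoint, star_sub, star_smul]; simp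
    intro a ha
    have haM := h.le₁M ha
    have t1 := h.condExp.pos _ (mul_mem (star_mem (mul_mem (sub_mem hx hyM) haM)) (mul_mem (sub_mem hx hyM) haM))
      (star_mul_self_nonneg ((x - y) * a))
    have e : Star.star ((x - y) * a) * ((x - y) * a) = Star.star a * (Star.star x * x) * a - Star.star a * Star.star x * (y * a)
        - (Star.star a * Star.star y * x * a - Star.star a * (Star.star y * y) * a) := by
      rw [star_mul, star_sub]; noncomm_ring
    have m1 : Star.star a * (Star.star x * x) * a ∈ M := mul_mem (mul_mem (star_mem haM) (mul_mem (star_mem hx) hx)) haM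
    have m2 : Star.star a * Star.star x * (y * a) ∈ M := mul_mem (mul_mem (star_mem haM) (star_mem hx)) (mul_mem hyM haM)
    have m3 : Star.star a * Star.star y * x * a ∈ M := mul_mem (mul_mem (mul_mem (star_mem haM) (star_mem hyM)) hx) haM
    have m4 : Star.star a * (Star.star y * y) * a ∈ M := mul_mem (mul_mem (star_mem haM) (mul_mem (star_mem hyM) hyM)) haM
    rw [e, ce_sub h.condExp (sub_mem m1 m2) (sub_mem m3 m4), ce_sub h.condExp m1 m2, ce_sub h.condExp m3 m4,
      h1.2 _ (mul_mem (star_mem ha) (star_mem h1.1)) _ ha, (h1.star h hx).2 _ (star_mem ha) _ (mul_mem h1.1 ha)] at t1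
    have e3 : Star.star a * Star.star y * y * a = Star.star a * (Star.star y * y) * a := by noncomm_ring
    have e4 : Star.star a * Star.star y * (y * a) = Star.star a * (Star.star y * y) * a := by noncomm_ring
    rw [e3, e4, sub_self, sub_zero, sub_nonneg] at t1
    have m5 : Star.star a * (((‖x‖^2 : ℝ) : ℂ) • 1) * a ∈ M := mul_mem (mul_mem (star_mem haM) (M.smul_mem (one_mem _) _)) haM
    have t2 : E (Star.star a * (Star.star x * x) * a) ≤ E (Star.star a * (((‖x‖^2 : ℝ) : ℂ) • 1) * a) := by
      apply ce_mono h.condExp m1 m5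
      rw [← sub_nonneg, ← sub_mul, ← mul_sub]
      apply conj_nonneg'
      rw [sub_nonneg]
      have := le_norm (IsSelfAdjoint.star_mul_self x)
      rwa [CStarRing.norm_star_mul_self, ← sq] at this
    rw [mul_sub, sub_mul, ce_sub h.condExp m4 m5, sub_nonpos]
    exact t1.trans t2
  have := norm_le_of_le (by positivity) (star_mul_self_nonneg y) (sub_nonpos.mp hle)
  rw [CStarRing.norm_star_mul_self, ← sq] at this
  exact (sq_le_sq₀ (norm_nonneg _) (norm_nonneg _)).mp this

lemma RR.exists (h : IsAFP M M₁ M₂ B E) {x : BH H} (hx : x ∈ M) : ∃ y, RR M₁ E x y := by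
  classical
  have halg : ∀ x ∈ Malg M₁ M₂, ∃ y, RR M₁ E x y := by
    intro x hx0
    have hg : ∀ x ∈ G3 M₁ M₂ E, x ∈ M := by
      rintro x (hx | ⟨a, ha, b, hb, w, hw, rfl⟩)
      · exact h.le₁M hx
      · exact mul_mem (mul_mem (h.le₁M ha) (hw.memM h)) (h.le₁M hb)
    have hx := h.malg_g3 hx0
    clear hx0
    induction hx using Submodule.span_induction with
    | mem x hx =>
      rcases hx with hx | ⟨a, ha, b, hb, w, hw, rfl⟩
      · exact ⟨x, RR.self hx⟩
      · refine ⟨0, zero_mem _, fun c hc d hd => ?_⟩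
        have e : c * (a * w * b) * d = (c * a) * w * (b * d) := by noncomm_ring
        rw [e, h.F7 (mul_mem hc ha) (mul_mem hb hd) hw, mul_zero, zero_mul, ce_zero h.condExp]
    | zero => exact ⟨0, RR.self (zero_mem _)⟩
    | add a b ha hb iha ihb =>
      obtain ⟨y, hy⟩ := iha
      obtain ⟨z, hz⟩ := ihb
      exact ⟨_, hy.add h (span_le_vn hg ha) (span_le_vn hg hb) hz⟩
    | smul c a ha iha =>
      obtain ⟨y, hy⟩ := iha
      exact ⟨_, hy.smul h (span_le_vn hg ha) c⟩
  obtain ⟨C, z, h1, h2, h3⟩ := h.net hx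
  choose y hy using fun i => halg (z i) (h1 i)
  have hzM : ∀ i, z i ∈ M := fun i => h.malgM (h1 i)
  have hyC : ∀ i, ‖y i‖ ≤ C := fun i => ((hy i).norm h (hzM i)).trans (h2 i)
  let U : Ultrafilter (Finset H × ℕ) := Ultrafilter.of Filter.atTop
  have hU : (U : Filter (Finset H × ℕ)) ≤ Filter.atTop := Ultrafilter.of_le _
  obtain ⟨Y, -, hY⟩ := uf_lim U y C hyC
  have hYM : Y ∈ M₁ := lim_mem_vn (fun i => (hy i).1) hY
  refine ⟨Y, hYM, fun a ha b hb => ?_⟩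
  have haM := h.le₁M ha
  have hbM := h.le₁M hb
  have gen : ∀ (t : Finset H × ℕ → BH H) (T : BH H), (∀ i, t i ∈ M) → T ∈ M → (∀ i, ‖t i‖ ≤ C) →
      (∀ u v, Filter.Tendsto (fun i => ⟪u, t i v⟫_ℂ) U (nhds ⟪u, T v⟫_ℂ)) →
      ∀ u v, Filter.Tendsto (fun i => ⟪u, E (a * t i * b) v⟫_ℂ) U (nhds ⟪u, E (a * T * b) v⟫_ℂ) := by
    intro t T ht hT hC hl
    apply ce_tendsto h.condExp h.normal (‖a‖ * C * ‖b‖) (fun i => mul_mem (mul_mem haM (ht i)) hbM) (mul_mem (mul_mem haM hT) hbM)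
    · intro i
      refine (norm_mul_le _ _).trans ?_
      gcongr
      refine (norm_mul_le _ _).trans ?_
      gcongr
      exact hC i
    · intro u v
      have := hl (Star.star a u) (b v)
      simp only [inner_star] at this
      exact this
  apply eq_of_inner
  intro u v
  have l1 := gen z x hzM hx h2 (fun u v => (h3 u v).mono_left hU) u v
  have l2 := gen y Y (fun i => h.le₁M (hy i).1) (h.le₁M hYM) hyC hY u v
  have e : (fun i => ⟪u, E (a * z i * b) v⟫_ℂ) = fun i => ⟪u, E (a * y i * b) v⟫_ℂ := by
    funext i
    rw [(hy i).2 a ha b hb]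
  rw [e] at l1
  exact tendsto_nhds_unique l1 l2

end E1

section GNS
universe u₁ u₂
variable {ι : Type u₁} {A : Type u₂} [Ring A] [StarRing A] [Algebra ℂ A] [StarModule ℂ A]

/-- Data for a direct sum of GNS representations. -/
structure GD (ι : Type u₁) (A : Type u₂) [Ring A] [StarRing A] [Algebra ℂ A] [StarModule ℂ A] where
  f : ι → A →ₗ[ℂ] ℂ
  pos : ∀ i a, 0 ≤ f i (star a * a)
  bd : A → ℝ
  bd_nonneg : ∀ x, 0 ≤ bd x
  bound : ∀ x i y, (f i (star (x * y) * (x * y))).re ≤ bd x ^ 2 * (f i (star y * y)).re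

set_option linter.unusedVariables false in
@[nolint unusedArguments]
def GX (D : GD ι A) := ι →₀ A

instance (D : GD ι A) : AddCommGroup (GX D) := inferInstanceAs (AddCommGroup (ι →₀ A))
instance (D : GD ι A) : Module ℂ (GX D) := inferInstanceAs (Module ℂ (ι →₀ A))

def toX (D : GD ι A) : (ι →₀ A) ≃ₗ[ℂ] GX D := LinearEquiv.refl ℂ _
def ofX (D : GD ι A) : GX D ≃ₗ[ℂ] (ι →₀ A) := (toX D).symm

lemma ofX_toX (D : GD ι A) (u) : ofX D (toX D u) = u := rfl
lemma toX_ofX (D : GD ι A) (u) : toX D (ofX D u) = u := rfl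

def gin (D : GD ι A) (u v : ι →₀ A) : ℂ := u.sum fun i a => D.f i (star a * v i)

lemma gin_eq (D : GD ι A) (u v : ι →₀ A) {s : Finset ι} (hs : u.support ⊆ s) :
    gin D u v = ∑ i ∈ s, D.f i (star (u i) * v i) :=
  Finsupp.sum_of_support_subset _ hs _ (by simp)

lemma gin_single (D : GD ι A) (i : ι) (a : A) (v : ι →₀ A) : gin D (Finsupp.single i a) v = D.f i (star a * v i) := by
  rw [gin, Finsupp.sum_single_index]; simp

abbrev gcore (D : GD ι A) : PreInnerProductSpace.Core ℂ (GX D) where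
  inner u v := gin D (ofX D u) (ofX D v)
  conj_inner_symm u v := by
    classical
    rw [gin_eq D (ofX D v) (ofX D u) (s := (ofX D u).support ∪ (ofX D v).support) Finset.subset_union_right,
      gin_eq D (ofX D u) (ofX D v) (s := (ofX D u).support ∪ (ofX D v).support) Finset.subset_union_left, map_sum]
    exact Finset.sum_congr rfl fun i _ => pos_conj (D.f i) (D.pos i) _ _
  re_inner_nonneg u := by
    have : 0 ≤ gin D (ofX D u) (ofX D u) := Finset.sum_nonneg fun i _ => D.pos i _
    exact (Complex.le_def.mp this).1
  add_left u v w := by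
    rw [map_add]; unfold gin
    refine Finsupp.sum_add_index' (by simp) (by simp [add_mul])
  smul_left u v c := by
    rw [map_smul]; unfold gin
    rw [Finsupp.sum_smul_index' (by simp), Finsupp.mul_sum]
    simp

instance (D : GD ι A) : SeminormedAddCommGroup (GX D) :=
  InnerProductSpace.Core.toSeminormedAddCommGroup (c := gcore D)
instance (D : GD ι A) : InnerProductSpace ℂ (GX D) :=
  InnerProductSpace.ofCore (gcore D)

lemma gx_inner (D : GD ι A) (u v : GX D) : ⟪u, v⟫_ℂ = gin D (ofX D u) (ofX D v) := rfl

def gmul (D : GD ι A) (x : A) : GX D →ₗ[ℂ] GX D :=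
  (toX D).toLinearMap ∘ₗ Finsupp.mapRange.linearMap (LinearMap.mulLeft ℂ x) ∘ₗ (ofX D).toLinearMap

lemma gmul_apply (D : GD ι A) (x : A) (u : GX D) (i : ι) : ofX D (gmul D x u) i = x * ofX D u i := rfl

lemma gmul_bound (D : GD ι A) (x : A) (u : GX D) : ‖gmul D x u‖ ≤ D.bd x * ‖u‖ := by
  rw [← sq_le_sq₀ (by positivity) (mul_nonneg (D.bd_nonneg x) (norm_nonneg _)), mul_pow]
  have e1 : ∀ v : GX D, ‖v‖ ^ 2 = (gin D (ofX D v) (ofX D v)).re := fun v => by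
    rw [← gx_inner, inner_self_eq_norm_sq_to_K (𝕜 := ℂ)]; simp [← Complex.ofReal_pow]
  rw [e1, e1, gin_eq D (ofX D (gmul D x u)) _ (s := (ofX D u).support), gin, Finsupp.sum, Complex.re_sum, Complex.re_sum, Finset.mul_sum]
  · exact Finset.sum_le_sum fun i _ => by
      rw [gmul_apply]; exact D.bound x i _
  · intro i hi
    simp only [Finsupp.mem_support_iff, gmul_apply] at hi ⊢
    exact fun h => hi (by rw [h, mul_zero])

def gmulc (D : GD ι A) (x : A) : GX D →L[ℂ] GX D := (gmul D x).mkContinuous (D.bd x) (gmul_bound D x)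

lemma gmulc_apply (D : GD ι A) (x : A) (u : GX D) : gmulc D x u = gmul D x u := rfl

abbrev GK (D : GD ι A) := UniformSpace.Completion (GX D)

def gpi (D : GD ι A) (x : A) : BH (GK D) := (gmulc D x).completion

def geta (D : GD ι A) (i : ι) : A →ₗ[ℂ] GK D where
  toFun a := ((toX D (Finsupp.single i a) : GX D) : GK D)
  map_add' a b := by rw [Finsupp.single_add, map_add, UniformSpace.Completion.coe_add]
  map_smul' c a := by
    rw [← Finsupp.smul_single, map_smul, UniformSpace.Completion.coe_smul]; rfl

lemma gpi_coe (D : GD ι A) (x : A) (u : GX D) : gpi D x (u : GK D) = (gmul D x u : GX D) := by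
  simp [gpi, gmulc_apply]

lemma gmul_single (D : GD ι A) (x a : A) (i : ι) :
    gmul D x (toX D (Finsupp.single i a)) = toX D (Finsupp.single i (x * a)) := by
  change toX D (Finsupp.mapRange.linearMap (LinearMap.mulLeft ℂ x) (Finsupp.single i a)) = _
  simp [Finsupp.mapRange.linearMap_apply, Finsupp.mapRange_single]

lemma gpi_geta (D : GD ι A) (x a : A) (i : ι) : gpi D x (geta D i a) = geta D i (x * a) := by
  change gpi D x ((toX D (Finsupp.single i a) : GX D) : GK D) = _
  rw [gpi_coe, gmul_single]; rfl

lemma geta_inner (D : GD ι A) (i : ι) (a b : A) : ⟪geta D i a, geta D i b⟫_ℂ = D.f i (star a * b) := by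
  change ⟪((toX D (Finsupp.single i a) : GX D) : GK D), ((toX D (Finsupp.single i b) : GX D) : GK D)⟫_ℂ = _
  rw [UniformSpace.Completion.inner_coe, gx_inner, ofX_toX, ofX_toX, gin_single]
  simp

lemma geta_inner_ne (D : GD ι A) {i j : ι} (hij : i ≠ j) (a b : A) : ⟪geta D i a, geta D j b⟫_ℂ = 0 := by
  change ⟪((toX D (Finsupp.single i a) : GX D) : GK D), ((toX D (Finsupp.single j b) : GX D) : GK D)⟫_ℂ = _
  rw [UniformSpace.Completion.inner_coe, gx_inner, ofX_toX, ofX_toX, gin_single]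
  simp [Finsupp.single_eq_of_ne hij]

lemma geta_dense (D : GD ι A) {S : BH (GK D)} {T : BH (GK D)} (h : ∀ i a, S (geta D i a) = T (geta D i a)) : S = T := by
  ext k
  induction k using UniformSpace.Completion.induction_on with
  | hp => exact isClosed_eq S.continuous T.continuous
  | ih u =>
    have : ∀ v : ι →₀ A, S ((toX D v : GX D) : GK D) = T ((toX D v : GX D) : GK D) := by
      intro v
      induction v using Finsupp.induction_linear with
      | zero => rw [map_zero, UniformSpace.Completion.coe_zero, map_zero, map_zero]
      | add v w hv hw => rw [map_add, UniformSpace.Completion.coe_add, map_add, map_add, hv, hw]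
      | single i a => exact h i a
    exact this (ofX D u)

lemma geta_ext (D : GD ι A) {k : GK D} (h : ∀ i a, ⟪geta D i a, k⟫_ℂ = 0) : k = 0 := by
  have h1 : ∀ l : GK D, ⟪l, k⟫_ℂ = 0 := by
    intro l
    induction l using UniformSpace.Completion.induction_on with
    | hp => exact isClosed_eq (by fun_prop) (by fun_prop)
    | ih u =>
      have : ∀ v : ι →₀ A, ⟪((toX D v : GX D) : GK D), k⟫_ℂ = 0 := by
        intro v
        induction v using Finsupp.induction_linear with
        | zero => rw [map_zero, UniformSpace.Completion.coe_zero, inner_zero_left]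
        | add v w hv hw => rw [map_add, UniformSpace.Completion.coe_add, inner_add_left, hv, hw, add_zero]
        | single i a => exact h i a
      exact this (ofX D u)
  exact inner_self_eq_zero.mp (h1 k)

def gpiHom (D : GD ι A) : A →⋆ₐ[ℂ] BH (GK D) where
  toFun := gpi D
  map_one' := geta_dense D fun i a => by rw [gpi_geta, one_mul]; rfl
  map_mul' x y := geta_dense D fun i a => by
    rw [gpi_geta, ContinuousLinearMap.mul_apply, gpi_geta, gpi_geta, mul_assoc]
  map_zero' := geta_dense D fun i a => by rw [gpi_geta, zero_mul]; simp
  map_add' x y := geta_dense D fun i a => by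
    rw [gpi_geta, ContinuousLinearMap.add_apply, gpi_geta, gpi_geta, add_mul, map_add]
  commutes' c := geta_dense D fun i a => by
    rw [gpi_geta, Algebra.algebraMap_eq_smul_one, Algebra.algebraMap_eq_smul_one, smul_mul_assoc, one_mul, map_smul]; rfl
  map_star' x := geta_dense D fun i a => by
    rw [gpi_geta, ← sub_eq_zero]
    apply geta_ext D
    intro j b
    rw [inner_sub_right, inner_star', gpi_geta]
    by_cases hij : j = i
    · subst hij
      rw [geta_inner, geta_inner, star_mul, mul_assoc, sub_self]
    · rw [geta_inner_ne D hij, geta_inner_ne D hij, sub_zero]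

lemma gpiHom_geta (D : GD ι A) (x a : A) (i : ι) : gpiHom D x (geta D i a) = geta D i (x * a) := gpi_geta D x a i

lemma gpiHom_smul (D : GD ι A) (c : ℂ) (x : A) : gpiHom D (c • x) = c • gpiHom D x := map_smul (gpiHom D) c x

lemma gpiHom_add (D : GD ι A) (x y : A) : gpiHom D (x + y) = gpiHom D x + gpiHom D y := map_add (gpiHom D) x y
lemma gpiHom_mul (D : GD ι A) (x y : A) : gpiHom D (x * y) = gpiHom D x * gpiHom D y := map_mul (gpiHom D) x y
lemma gpiHom_one (D : GD ι A) : gpiHom D 1 = 1 := map_one (gpiHom D)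
lemma gpiHom_star (D : GD ι A) (x : A) : gpiHom D (star x) = star (gpiHom D x) := map_star (gpiHom D) x
lemma geta_add (D : GD ι A) (i : ι) (x y : A) : geta D i (x + y) = geta D i x + geta D i y := map_add (geta D i) x y
lemma geta_smul (D : GD ι A) (i : ι) (c : ℂ) (x : A) : geta D i (c • x) = c • geta D i x := map_smul (geta D i) c x

end GNS

structure GRep (M : VonNeumannAlgebra H) (E : BH H → BH H) {K : Type*} [NormedAddCommGroup K] [InnerProductSpace ℂ K]
    [CompleteSpace K] (π : BH H → BH K) (η : H → BH H → K) : Prop where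
  one : π 1 = 1
  add : ∀ x ∈ M, ∀ y ∈ M, π (x + y) = π x + π y
  smul : ∀ c : ℂ, ∀ x ∈ M, π (c • x) = c • π x
  mul : ∀ x ∈ M, ∀ y ∈ M, π (x * y) = π x * π y
  str : ∀ x ∈ M, π (star x) = star (π x)
  eadd : ∀ ζ, ∀ x ∈ M, ∀ y ∈ M, η ζ (x + y) = η ζ x + η ζ y
  esmul : ∀ ζ, ∀ c : ℂ, ∀ x ∈ M, η ζ (c • x) = c • η ζ x
  act : ∀ ζ, ∀ x ∈ M, ∀ y ∈ M, π x (η ζ y) = η ζ (x * y)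
  inn : ∀ ζ, ∀ x ∈ M, ∀ y ∈ M, ⟪η ζ x, η ζ y⟫_ℂ = ⟪ζ, E (Star.star x * y) ζ⟫_ℂ
  inn_ne : ∀ ζ ζ', ζ ≠ ζ' → ∀ x ∈ M, ∀ y ∈ M, ⟪η ζ x, η ζ' y⟫_ℂ = 0
  ext : ∀ k, (∀ ζ, ∀ x ∈ M, ⟪η ζ x, k⟫_ℂ = 0) → k = 0
  clos : ∀ S : Set K, IsClosed S → (0:K) ∈ S → (∀ x ∈ S, ∀ y ∈ S, x + y ∈ S) → (∀ ζ, ∀ x ∈ M, η ζ x ∈ S) → ∀ k, k ∈ S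

structure Rep (M M₁ M₂ B : VonNeumannAlgebra H) (E : BH H → BH H) {K : Type*} [NormedAddCommGroup K] [InnerProductSpace ℂ K]
    [CompleteSpace K] (π : BH H → BH K) (p : BH K) : Prop where
  one : π 1 = 1
  add : ∀ x ∈ M, ∀ y ∈ M, π (x + y) = π x + π y
  smul : ∀ c : ℂ, ∀ x ∈ M, π (c • x) = c • π x
  mul : ∀ x ∈ M, ∀ y ∈ M, π (x * y) = π x * π y
  str : ∀ x ∈ M, π (star x) = star (π x)
  norm : ∀ x ∈ M, ‖x‖ ≤ ‖π x‖
  proj : IsProjection p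
  comp : ∀ x ∈ M₁, p * π x * p = π (E x) * p
  comm : ∀ b ∈ B, π b * p = p * π b
  kill : ∀ w, Red M₁ M₂ E false false w → (1 - p) * π w * (1 - p) = 0

section gns2
universe u
variable {H : Type u} [NormedAddCommGroup H] [InnerProductSpace ℂ H] [CompleteSpace H]
variable {M M₁ M₂ B : VonNeumannAlgebra H} {E : BH H → BH H}

lemma norm_conj_le (x y : BH H) : Star.star (x * y) * (x * y) ≤ ((‖x‖ ^ 2 : ℝ) : ℂ) • (Star.star y * y) := by
  have h1 : star x * x ≤ ((‖x‖ ^ 2 : ℝ) : ℂ) • (1 : BH H) := by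
    have := le_norm (a := star x * x) (IsSelfAdjoint.star_mul_self x)
    rwa [CStarRing.norm_star_mul_self, ← sq] at this
  have h2 := conj_nonneg' (sub_nonneg.mpr h1) y
  rw [← sub_nonneg]
  convert h2 using 1
  simp only [star_mul, mul_sub, sub_mul, mul_smul_comm, smul_mul_assoc, mul_one, mul_assoc]

def IsAFP.gd (h : IsAFP M M₁ M₂ B E) : GD H M.toStarSubalgebra where
  f := ceFun h.condExp
  pos := ceFun_pos h.condExp
  bd x := ‖(x : BH H)‖
  bd_nonneg x := norm_nonneg _
  bound x ζ y := by
    have hx : (x : BH H) ∈ M := x.2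
    have hy : (y : BH H) ∈ M := y.2
    have hxy := mul_mem hx hy
    have h1 := ce_mono h.condExp (mul_mem (star_mem hxy) hxy) (M.smul_mem (mul_mem (star_mem hy) hy) _) (norm_conj_le (x : BH H) (y : BH H))
    have h2 := inner_re_mono h1 ζ
    rw [h.condExp.map_smul _ _ (mul_mem (star_mem hy) hy), ContinuousLinearMap.smul_apply, inner_smul_right, Complex.re_ofReal_mul] at h2
    exact h2

open Classical in
def dpi (D : GD H M.toStarSubalgebra) (x : BH H) : BH (GK D) := if hx : x ∈ M then gpiHom D ⟨x, hx⟩ else 0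
open Classical in
def deta (D : GD H M.toStarSubalgebra) (ζ : H) (x : BH H) : GK D := if hx : x ∈ M then geta D ζ ⟨x, hx⟩ else 0

lemma dpi_pos (D : GD H M.toStarSubalgebra) {x : BH H} (hx : x ∈ M) : dpi D x = gpiHom D ⟨x, hx⟩ := by
  unfold dpi; exact dif_pos hx
lemma deta_pos (D : GD H M.toStarSubalgebra) (ζ : H) {x : BH H} (hx : x ∈ M) : deta D ζ x = geta D ζ ⟨x, hx⟩ := by
  unfold deta; exact dif_pos hx

set_option maxHeartbeats 2000000 in
lemma GD.grep (D : GD H M.toStarSubalgebra) (hD : ∀ ζ, ∀ x : M.toStarSubalgebra, D.f ζ x = ⟪ζ, E x ζ⟫_ℂ) :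
    GRep M E (K := GK D) (dpi D) (deta D) := by
  constructor
  · rw [dpi_pos D (one_mem M)]; exact gpiHom_one D
  · intro x hx y hy
    rw [dpi_pos D hx, dpi_pos D hy, dpi_pos D (add_mem hx hy)]; exact gpiHom_add D ⟨x, hx⟩ ⟨y, hy⟩
  · intro c x hx
    rw [dpi_pos D hx, dpi_pos D (M.smul_mem hx c)]; exact gpiHom_smul D c ⟨x, hx⟩
  · intro x hx y hy
    rw [dpi_pos D hx, dpi_pos D hy, dpi_pos D (mul_mem hx hy)]; exact gpiHom_mul D ⟨x, hx⟩ ⟨y, hy⟩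
  · intro x hx
    rw [dpi_pos D hx, dpi_pos D (star_mem hx)]; exact gpiHom_star D ⟨x, hx⟩
  · intro ζ x hx y hy
    rw [deta_pos D ζ hx, deta_pos D ζ hy, deta_pos D ζ (add_mem hx hy)]; exact geta_add D ζ ⟨x, hx⟩ ⟨y, hy⟩
  · intro ζ c x hx
    rw [deta_pos D ζ hx, deta_pos D ζ (M.smul_mem hx c)]; exact geta_smul D ζ c ⟨x, hx⟩
  · intro ζ x hx y hy
    rw [dpi_pos D hx, deta_pos D ζ hy, deta_pos D ζ (mul_mem hx hy)]; exact gpiHom_geta D ⟨x, hx⟩ ⟨y, hy⟩ ζ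
  · intro ζ x hx y hy
    rw [deta_pos D ζ hx, deta_pos D ζ hy, geta_inner, hD]; rfl
  · intro ζ ζ' hne x hx y hy
    rw [deta_pos D ζ hx, deta_pos D ζ' hy, geta_inner_ne D hne]
  · intro k hk
    refine geta_ext D fun ζ a => ?_
    have := hk ζ a.1 a.2
    rwa [deta_pos D ζ a.2] at this
  · intro S hS h0 hadd hS2 k
    induction k using UniformSpace.Completion.induction_on with
    | hp => exact hS
    | ih u =>
      have : ∀ v : H →₀ M.toStarSubalgebra, ((toX D v : GX D) : GK D) ∈ S := by
        intro v
        induction v using Finsupp.induction_linear with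
        | zero => rw [map_zero, UniformSpace.Completion.coe_zero]; exact h0
        | add v w hv hw => rw [map_add, UniformSpace.Completion.coe_add]; exact hadd _ hv _ hw
        | single ζ a =>
          have := hS2 ζ a.1 a.2
          rwa [deta_pos D ζ a.2] at this
      exact this (ofX D u)

lemma IsAFP.grep (h : IsAFP M M₁ M₂ B E) : GRep M E (K := GK h.gd) (dpi h.gd) (deta h.gd) :=
  GD.grep h.gd fun _ _ => rfl

end gns2

section gns3
variable {M M₁ M₂ B : VonNeumannAlgebra H} {E : BH H → BH H}
variable {K : Type*} [NormedAddCommGroup K] [InnerProductSpace ℂ K] [CompleteSpace K] {π : BH H → BH K} {η : H → BH H → K}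

lemma GRep.norm (g : GRep M E π η) (h : IsAFP M M₁ M₂ B E) {x : BH H} (hx : x ∈ M) : ‖x‖ ≤ ‖π x‖ := by
  have hxx : star x * x ∈ M := mul_mem (star_mem hx) hx
  have key : star x * x - ((‖π x‖ ^ 2 : ℝ) : ℂ) • (1 : BH H) ≤ 0 := by
    have hsa : IsSelfAdjoint (star x * x - ((‖π x‖ ^ 2 : ℝ) : ℂ) • (1 : BH H)) :=
      (IsSelfAdjoint.star_mul_self x).sub (IsSelfAdjoint.smul (Complex.conj_ofReal _) (IsSelfAdjoint.one _))
    have hm : star x * x - ((‖π x‖ ^ 2 : ℝ) : ℂ) • (1 : BH H) ∈ M := sub_mem hxx (M.smul_mem (one_mem M) _)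
    refine h.test (N := M) (fun _ h => h) hm hsa ?_
    intro b hb
    have hxb := mul_mem hx hb
    have e1 : star b * (star x * x - ((‖π x‖ ^ 2 : ℝ) : ℂ) • (1 : BH H)) * b = star (x * b) * (x * b) - ((‖π x‖ ^ 2 : ℝ) : ℂ) • (star b * b) := by
      simp only [star_mul, mul_sub, sub_mul, mul_smul_comm, smul_mul_assoc, mul_one, mul_assoc]
    have hm2 := mul_mem (mul_mem (star_mem hb) hm) hb
    have hsa2 : IsSelfAdjoint (star b * (star x * x - ((‖π x‖ ^ 2 : ℝ) : ℂ) • (1 : BH H)) * b) := hsa.conjugate' b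
    rw [← neg_nonneg, ← ce_neg h.condExp hm2]
    refine nonneg_of_re (ce_sa h.condExp (neg_mem hm2) hsa2.neg) ?_
    intro ζ
    rw [ce_neg h.condExp hm2, e1, ce_sub h.condExp (mul_mem (star_mem hxb) hxb) (M.smul_mem (mul_mem (star_mem hb) hb) _),
      h.condExp.map_smul _ _ (mul_mem (star_mem hb) hb)]
    simp only [ContinuousLinearMap.neg_apply, ContinuousLinearMap.sub_apply, ContinuousLinearMap.smul_apply, inner_neg_right, inner_sub_right, inner_smul_right]
    rw [← g.inn ζ _ hxb _ hxb, ← g.inn ζ _ hb _ hb, ← g.act ζ _ hx _ hb, inner_self_eq_norm_sq_to_K, inner_self_eq_norm_sq_to_K]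
    have h3 := (π x).le_opNorm (η ζ b)
    have h4 : ‖π x (η ζ b)‖ ^ 2 ≤ ‖π x‖ ^ 2 * ‖η ζ b‖ ^ 2 := by rw [← mul_pow]; gcongr
    simp only [Complex.coe_algebraMap, Complex.neg_re, Complex.sub_re, ← Complex.ofReal_pow, ← Complex.ofReal_mul, Complex.ofReal_re]
    linarith
  have h2 := norm_le_of_le (by positivity) (star_mul_self_nonneg x) (sub_nonpos.mp key)
  rw [CStarRing.norm_star_mul_self, ← sq] at h2
  exact (sq_le_sq₀ (norm_nonneg _) (norm_nonneg _)).mp h2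

lemma GRep.norm_eta (g : GRep M E π η) (h : IsAFP M M₁ M₂ B E) (ζ : H) {x : BH H} (hx : x ∈ M) : ‖η ζ x‖ ≤ ‖x‖ * ‖ζ‖ := by
  rw [← sq_le_sq₀ (norm_nonneg _) (by positivity)]
  have hxx := mul_mem (star_mem hx) hx
  have h1 : ‖η ζ x‖ ^ 2 = (⟪ζ, E (star x * x) ζ⟫_ℂ).re := by
    rw [← g.inn ζ _ hx _ hx, inner_self_eq_norm_sq_to_K]; simp [← Complex.ofReal_pow]
  rw [h1]
  have h2 := ce_norm h.condExp hxx
  calc _ ≤ ‖⟪ζ, E (star x * x) ζ⟫_ℂ‖ := Complex.re_le_norm _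
    _ ≤ ‖ζ‖ * ‖E (star x * x) ζ‖ := norm_inner_le_norm _ _
    _ ≤ ‖ζ‖ * (‖star x * x‖ * ‖ζ‖) := by
        gcongr
        exact ((E (star x * x)).le_opNorm ζ).trans (by gcongr)
    _ = _ := by rw [CStarRing.norm_star_mul_self]; ring

lemma GRep.ext_alg (g : GRep M E π η) (h : IsAFP M M₁ M₂ B E) {k : K} (hk : ∀ ζ, ∀ x ∈ Malg M₁ M₂, ⟪η ζ x, k⟫_ℂ = 0) : k = 0 := by
  apply g.ext
  intro ζ x hx
  obtain ⟨C, z, hz, hC, hlim⟩ := h.net hx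
  have hC0 : 0 ≤ C := (norm_nonneg _).trans (hC (∅, 0))
  have hzM : ∀ i, z i ∈ M := fun i => h.malgM (hz i)
  have hcl : IsClosed {l : K | Filter.Tendsto (fun i => ⟪η ζ (z i), l⟫_ℂ) Filter.atTop (nhds ⟪η ζ x, l⟫_ℂ)} := by
    apply Equicontinuous.isClosed_setOfPred_tendsto (F := fun i l => ⟪η ζ (z i), l⟫_ℂ) _ (by fun_prop)
    apply UniformEquicontinuous.equicontinuous
    apply LipschitzWith.uniformEquicontinuous _ (C * ‖ζ‖).toNNReal
    intro i
    apply LipschitzWith.of_dist_le_mul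
    intro l l'
    rw [dist_eq_norm, dist_eq_norm, ← inner_sub_right, Real.coe_toNNReal _ (by positivity)]
    refine (norm_inner_le_norm _ _).trans ?_
    gcongr
    exact (g.norm_eta h ζ (hzM i)).trans (by gcongr; exact hC i)
  have hall := g.clos _ hcl (by simpa using tendsto_const_nhds) (by
    intro a ha b hb
    simp only [Set.mem_setOf_eq, inner_add_right] at ha hb ⊢
    exact ha.add hb) (by
    intro ζ' y hy
    by_cases hne : ζ = ζ'
    · subst hne
      simp only [Set.mem_setOf_eq]
      have h2 : ∀ u ∈ M, ⟪η ζ u, η ζ y⟫_ℂ = ⟪ζ, E (star u * y) ζ⟫_ℂ := fun u hu => g.inn ζ u hu y hy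
      rw [h2 x hx]
      simp only [fun i => h2 (z i) (hzM i)]
      refine ce_tendsto h.condExp h.normal (z := fun i => star (z i) * y) (C * ‖y‖) (fun i => mul_mem (star_mem (hzM i)) hy) (mul_mem (star_mem hx) hy) ?_ ?_ ζ ζ
      · intro i
        refine (norm_mul_le _ _).trans ?_
        rw [norm_star]
        gcongr
        exact hC i
      · intro a b
        simp only [ContinuousLinearMap.mul_apply, inner_star']
        have := (hlim (y b) a)
        have h5 := (Complex.continuous_conj.tendsto _).comp this
        simpa only [Function.comp_def, inner_conj_symm] using h5
    · simp only [Set.mem_setOf_eq]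
      rw [g.inn_ne ζ ζ' hne x hx y hy]
      simp only [fun i => g.inn_ne ζ ζ' hne (z i) (hzM i) y hy]
      exact tendsto_const_nhds) k
  simp only [Set.mem_setOf_eq, fun i => hk ζ (z i) (hz i)] at hall
  classical
  exact tendsto_nhds_unique hall tendsto_const_nhds |>.symm ▸ rfl

def KP (M₁ M₂ B : VonNeumannAlgebra H) (E : BH H → BH H) (η : H → BH H → K) : Submodule ℂ K :=
  Submodule.span ℂ {k | ∃ ζ, ∃ u ∈ Lp M₁ M₂ B E, k = η ζ u}

lemma pr_zero {S : Set K} {x : K} (h : ∀ k ∈ S, ⟪k, x⟫_ℂ = 0) : pr (Submodule.span ℂ S) x = 0 := by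
  rw [Submodule.starProjection_apply_eq_zero_iff, Submodule.orthogonal_closure, Submodule.mem_orthogonal]
  intro u hu
  induction hu using Submodule.span_induction with
  | mem k hk => exact h k hk
  | zero => simp
  | add a b _ _ ha hb => rw [inner_add_left, ha, hb, add_zero]
  | smul c a _ ha => rw [inner_smul_left, ha, mul_zero]

lemma GRep.rep (g : GRep M E π η) (h : IsAFP M M₁ M₂ B E) : Rep M M₁ M₂ B E π (pr (KP M₁ M₂ B E η)) := by
  have hfix : ∀ ζ, ∀ u ∈ Lp M₁ M₂ B E, pr (KP M₁ M₂ B E η) (η ζ u) = η ζ u := fun ζ u hu =>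
    pr_fix (Submodule.subset_span ⟨ζ, u, hu, rfl⟩)
  have hz : ∀ ζ, ∀ v ∈ M, (∀ u ∈ Lp M₁ M₂ B E, E (star u * v) = 0) → pr (KP M₁ M₂ B E η) (η ζ v) = 0 := by
    intro ζ v hv huv
    apply pr_zero
    rintro _ ⟨ζ', u, hu, rfl⟩
    by_cases hne : ζ' = ζ
    · subst hne
      rw [g.inn _ _ (h.lpM hu) _ hv, huv u hu]; simp
    · exact g.inn_ne _ _ hne _ (h.lpM hu) _ hv
  have hker : ∀ z : BH K, (∀ ζ, ∀ u ∈ Lp M₁ M₂ B E, z (η ζ u) = 0) → z * pr (KP M₁ M₂ B E η) = 0 := by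
    intro z hz
    apply kill_pr
    intro k hk
    induction hk using Submodule.span_induction with
    | mem k hk => obtain ⟨ζ, u, hu, rfl⟩ := hk; exact hz ζ u hu
    | zero => simp
    | add a b _ _ ha hb => rw [map_add, ha, hb, add_zero]
    | smul c a _ ha => rw [map_smul, ha, smul_zero]
  refine ⟨g.one, g.add, g.smul, g.mul, g.str, fun x hx => g.norm h hx, pr_isProj _, ?_, ?_, ?_⟩
  · intro x hx
    have hxM := h.le₁M hx
    rw [← sub_eq_zero, ← sub_mul]
    apply hker
    intro ζ u hu
    have huM := h.lpM hu
    have hEu : E x * u ∈ Lp M₁ M₂ B E := h.F5 (h.eB hxM) hu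
    have hExM := h.bM (h.eB hxM)
    rw [ContinuousLinearMap.sub_apply, ContinuousLinearMap.mul_apply, g.act _ _ hxM _ huM, g.act _ _ hExM _ huM]
    rw [← hfix ζ _ hEu, ← map_sub]
    have e2 : η ζ (x * u - E x * u) = η ζ (x * u) - η ζ (E x * u) := by
      rw [sub_eq_add_neg, ← neg_one_smul ℂ (E x * u), g.eadd _ _ (mul_mem hxM huM) _ (M.smul_mem (mul_mem hExM huM) _), g.esmul _ _ _ (mul_mem hExM huM)]
      simp [sub_eq_add_neg]
    rw [← e2]
    apply hz _ _ (sub_mem (mul_mem hxM huM) (mul_mem hExM huM))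
    intro v hv
    have hvM := h.lpM hv
    have := h.F1 hx hv hu
    rw [mul_sub, ce_sub h.condExp (mul_mem (star_mem hvM) (mul_mem hxM huM)) (mul_mem (star_mem hvM) (mul_mem hExM huM)),
      ← mul_assoc, ← mul_assoc, this, sub_self]
  · have hm : ∀ b ∈ B, ∀ k ∈ KP M₁ M₂ B E η, π b k ∈ KP M₁ M₂ B E η := by
      intro b hb k hk
      induction hk using Submodule.span_induction with
      | mem k hk =>
        obtain ⟨ζ, u, hu, rfl⟩ := hk
        rw [g.act _ _ (h.bM hb) _ (h.lpM hu)]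
        exact Submodule.subset_span ⟨ζ, b * u, h.F5 hb hu, rfl⟩
      | zero => rw [map_zero]; exact zero_mem _
      | add a b _ _ ha hb => rw [map_add]; exact add_mem ha hb
      | smul c a _ ha => rw [map_smul]; exact Submodule.smul_mem _ _ ha
    intro b hb
    exact pr_comm (hm b hb) (by rw [← g.str b (h.bM hb)]; exact hm _ (star_mem hb))
  · intro w hw
    have hwM := hw.memM h
    have key : ∀ ζ, ∀ x ∈ Malg M₁ M₂, ((1 - pr (KP M₁ M₂ B E η)) * π w * (1 - pr (KP M₁ M₂ B E η))) (η ζ x) = 0 := by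
      intro ζ x hx
      obtain ⟨u, hu, v, hv, rfl⟩ := h.malg_pq hx
      have huM := h.lpM hu
      have hvM := h.lqM hv
      have h1 : (1 - pr (KP M₁ M₂ B E η)) (η ζ (u + v)) = η ζ v := by
        rw [g.eadd _ _ huM _ hvM, map_add, ContinuousLinearMap.sub_apply, ContinuousLinearMap.sub_apply, hfix ζ u hu,
          hz ζ v hvM (fun u hu => h.F2 hu hv)]
        simp
      rw [ContinuousLinearMap.mul_apply, h1, ContinuousLinearMap.mul_apply, g.act _ _ hwM _ hvM, ContinuousLinearMap.sub_apply,
        hfix ζ _ (IsAFP.F4 hw hv)]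
      simp
    set T := (1 - pr (KP M₁ M₂ B E η)) * π w * (1 - pr (KP M₁ M₂ B E η)) with hT
    have hs : star T = 0 := by
      ext k
      apply g.ext_alg h
      intro ζ x hx
      rw [inner_star', key ζ x hx, inner_zero_left]
    rw [← star_star T, hs, star_zero]

end gns3

lemma fun_real {K : Type*} [NormedAddCommGroup K] [InnerProductSpace ℂ K] [CompleteSpace K] (s : BH K →L[ℂ] ℂ) {c : ℝ}
    (h1 : s 1 = c) (hn : ‖s‖ ≤ c) {T : BH K} (hT : IsSelfAdjoint T) : (s T).im = 0 := by
  have hc : 0 ≤ c := (norm_nonneg _).trans hn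
  have key : ∀ t : ℝ, ((s T).im + t * c) ^ 2 ≤ c ^ 2 * (‖T‖ ^ 2 + t ^ 2) := by
    intro t
    let A : BH K := T + ((t : ℂ) * Complex.I) • 1
    have e1 : star A * A = T * T + ((t ^ 2 : ℝ) : ℂ) • 1 := by
      simp only [A, star_add, star_smul, star_sa hT, star_one, add_mul, mul_add, smul_mul_assoc, mul_smul_comm, one_mul, mul_one, smul_smul, star_mul', Complex.star_def,
        Complex.conj_I, Complex.conj_ofReal]
      have : (t:ℂ) * Complex.I * ((t:ℂ) * -Complex.I) = ((t ^ 2 : ℝ) : ℂ) := by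
        push_cast; linear_combination (-(t:ℂ)^2) * Complex.I_mul_I
      rw [smul_add, smul_smul, this]
      module
    have e2 : ‖A‖ ^ 2 ≤ ‖T‖ ^ 2 + t ^ 2 := by
      rw [sq ‖A‖, ← CStarRing.norm_star_mul_self, e1]
      refine (norm_add_le _ _).trans ?_
      gcongr
      · rw [sq]; exact norm_mul_le _ _
      · rw [norm_smul, Complex.norm_real, Real.norm_of_nonneg (sq_nonneg t)]
        exact mul_le_of_le_one_right (sq_nonneg _) ContinuousLinearMap.norm_id_le
    have e3 : s A = s T + t * Complex.I * c := by
      simp only [A, map_add, map_smul, h1, smul_eq_mul]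
    have e4 : |(s A).im| ≤ c * ‖A‖ := (Complex.abs_im_le_norm _).trans ((s.le_opNorm A).trans (by gcongr))
    have e5 : (s A).im = (s T).im + t * c := by rw [e3]; simp
    rw [← e5, ← sq_abs]
    calc _ ≤ (c * ‖A‖) ^ 2 := by gcongr
      _ = c ^ 2 * ‖A‖ ^ 2 := by ring
      _ ≤ _ := by gcongr
  by_contra hne
  rcases hc.eq_or_lt with rfl | hc
  · have := key 0
    simp at this
    exact hne this
  · have h3 := key ((c ^ 2 * ‖T‖ ^ 2 + 1) / (2 * c * (s T).im))
    have h4 : 2 * ((c ^ 2 * ‖T‖ ^ 2 + 1) / (2 * c * (s T).im)) * c * (s T).im = c ^ 2 * ‖T‖ ^ 2 + 1 := by field_simp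
    nlinarith [sq_nonneg (s T).im]

lemma fun_pos {K : Type*} [NormedAddCommGroup K] [InnerProductSpace ℂ K] [CompleteSpace K] (s : BH K →L[ℂ] ℂ) {c : ℝ}
    (h1 : s 1 = c) (hn : ‖s‖ ≤ c) {T : BH K} (hT : 0 ≤ T) : 0 ≤ s T := by
  have him := fun_real s h1 hn (sa_of_nonneg hT)
  rw [Complex.le_def]
  refine ⟨?_, by simpa using him.symm⟩
  have hc : 0 ≤ c := (norm_nonneg _).trans hn
  rcases (norm_nonneg T).eq_or_lt with h0 | h0
  · rw [norm_eq_zero.mp h0.symm]; simp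
  have hle := le_norm (sa_of_nonneg hT)
  have h2 : ‖((‖T‖ : ℝ) : ℂ) • (1 : BH K) - T‖ ≤ ‖T‖ :=
    norm_le_of_le (norm_nonneg _) (sub_nonneg.mpr hle) (sub_le_self _ hT)
  have h3 : |(s (((‖T‖ : ℝ) : ℂ) • (1 : BH K) - T)).re| ≤ c * ‖T‖ :=
    (Complex.abs_re_le_norm _).trans ((s.le_opNorm _).trans (by gcongr))
  rw [map_sub, map_smul, h1, Complex.sub_re, smul_eq_mul, Complex.re_ofReal_mul, Complex.ofReal_re] at h3
  have := (abs_le.mp h3).2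
  simp only [Complex.zero_re]
  linarith

section phi
universe u v
variable {H : Type u} [NormedAddCommGroup H] [InnerProductSpace ℂ H] [CompleteSpace H]
variable {M M₁ M₂ B : VonNeumannAlgebra H} {E : BH H → BH H}
variable {K : Type v} [NormedAddCommGroup K] [InnerProductSpace ℂ K] [CompleteSpace K] {π : BH H → BH K} {p : BH K}

lemma Rep.state (r : Rep M M₁ M₂ B E π p) {Q : VonNeumannAlgebra H} {F : BH H → BH H} (hF : IsCondExp (M : Set (BH H)) Q F) (ζ : H) :
    ∃ s : BH K →ₗ[ℂ] ℂ, (∀ T, 0 ≤ T → 0 ≤ s T) ∧ ∀ x ∈ M, s (π x) = ⟪ζ, F x ζ⟫_ℂ := by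
  let πl : M.toStarSubalgebra →ₗ[ℂ] BH K :=
    { toFun := fun x => π x, map_add' := fun x y => r.add x x.2 y y.2, map_smul' := fun c x => r.smul c x x.2 }
  have hinj : Function.Injective πl := by
    rw [← LinearMap.ker_eq_bot, LinearMap.ker_eq_bot']
    intro x hx
    have h1 := r.norm x x.2
    have h2 : π (x : BH H) = 0 := hx
    rw [h2, norm_zero] at h1
    exact Subtype.ext (norm_le_zero_iff.mp h1)
  let eq := LinearEquiv.ofInjective πl hinj
  let f : πl.range →ₗ[ℂ] ℂ := (ceFun hF ζ) ∘ₗ eq.symm.toLinearMap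
  have hb : ∀ y, ‖f y‖ ≤ ‖ζ‖ ^ 2 * ‖y‖ := by
    intro y
    obtain ⟨x, rfl⟩ := eq.surjective y
    have h1 : f (eq x) = ⟪ζ, F x ζ⟫_ℂ := by
      simp only [f, LinearMap.comp_apply, LinearEquiv.coe_coe, LinearEquiv.symm_apply_apply]; rfl
    have h2 : ‖eq x‖ = ‖π x‖ := rfl
    rw [h1, h2]
    calc _ ≤ ‖ζ‖ * ‖F x ζ‖ := norm_inner_le_norm _ _
      _ ≤ ‖ζ‖ * (‖(x : BH H)‖ * ‖ζ‖) := by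
          gcongr
          exact ((F x).le_opNorm ζ).trans (by gcongr; exact ce_norm hF x.2)
      _ ≤ ‖ζ‖ * (‖π x‖ * ‖ζ‖) := by gcongr; exact r.norm x x.2
      _ = _ := by ring
  obtain ⟨s, hs, hsn⟩ := exists_extension_norm_eq (𝕜 := ℂ) πl.range (f.mkContinuous _ hb)
  have hval : ∀ x ∈ M, s (π x) = ⟪ζ, F x ζ⟫_ℂ := by
    intro x hx
    have h1 := hs (eq ⟨x, hx⟩)
    have h2 : ((eq ⟨x, hx⟩ : πl.range) : BH K) = π x := rfl
    rw [h2] at h1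
    rw [h1, LinearMap.mkContinuous_apply]
    simp only [f, LinearMap.comp_apply, LinearEquiv.coe_coe, LinearEquiv.symm_apply_apply]; rfl
  have h1 : s 1 = ((‖ζ‖ ^ 2 : ℝ) : ℂ) := by
    rw [← r.one, hval 1 (one_mem M), ce_one hF, ContinuousLinearMap.one_apply, inner_self_eq_norm_sq_to_K]; simp
  have hn : ‖s‖ ≤ ‖ζ‖ ^ 2 := by
    rw [hsn]; exact LinearMap.mkContinuous_norm_le _ (by positivity) _
  exact ⟨s.toLinearMap, fun T hT => fun_pos s h1 hn hT, hval⟩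

/-- Decomposition into cyclic subspaces. -/
lemma cyclic (Q : VonNeumannAlgebra H) : ∃ Z : Set H, (∀ ζ ∈ Z, ∀ ζ' ∈ Z, ζ ≠ ζ' → ∀ a ∈ Q, ⟪ζ, a ζ'⟫_ℂ = 0) ∧
    ∀ ξ : H, (∀ ζ ∈ Z, ∀ a ∈ Q, ⟪a ζ, ξ⟫_ℂ = 0) → ξ = 0 := by
  obtain ⟨Z, hZ, hmax⟩ := zorn_subset {Z : Set H | ∀ ζ ∈ Z, ∀ ζ' ∈ Z, ζ ≠ ζ' → ∀ a ∈ Q, ⟪ζ, a ζ'⟫_ℂ = 0} (by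
    intro c hc hch
    refine ⟨⋃₀ c, ?_, fun s hs => Set.subset_sUnion_of_mem hs⟩
    rintro ζ ⟨s, hs, hζ⟩ ζ' ⟨t, ht, hζ'⟩ hne a ha
    rcases hch.total hs ht with hst | hst
    · exact hc ht ζ (hst hζ) ζ' hζ' hne a ha
    · exact hc hs ζ hζ ζ' (hst hζ') hne a ha)
  refine ⟨Z, hZ, ?_⟩
  intro ξ hξ
  have h1 : insert ξ Z ∈ {Z : Set H | ∀ ζ ∈ Z, ∀ ζ' ∈ Z, ζ ≠ ζ' → ∀ a ∈ Q, ⟪ζ, a ζ'⟫_ℂ = 0} := by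
    rintro ζ (rfl | hζ) ζ' (rfl | hζ') hne a ha
    · exact absurd rfl hne
    · rw [← inner_conj_symm, hξ ζ' hζ' a ha, map_zero]
    · rw [← inner_star, hξ ζ hζ _ (star_mem ha)]
    · exact hZ ζ hζ ζ' hζ' hne a ha
  have h2 : ξ ∈ Z := hmax h1 (Set.subset_insert _ _) (Set.mem_insert _ _)
  have h3 := hξ ξ h2 1 (one_mem Q)
  exact inner_self_eq_zero.mp h3

lemma cyc_ext {Q : VonNeumannAlgebra H} {Z : Set H} (hZd : ∀ ξ : H, (∀ ζ ∈ Z, ∀ a ∈ Q, ⟪a ζ, ξ⟫_ℂ = 0) → ξ = 0)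
    {G : Type*} [NormedAddCommGroup G] [NormedSpace ℂ G] {S T : H →L[ℂ] G} (h : ∀ ζ ∈ Z, ∀ a ∈ Q, S (a ζ) = T (a ζ)) : S = T := by
  let L : Submodule ℂ H := Submodule.span ℂ {ξ | ∃ ζ ∈ Z, ∃ a ∈ Q, ξ = a ζ}
  have h1 : L.topologicalClosure = ⊤ := by
    rw [Submodule.topologicalClosure_eq_top_iff, Submodule.eq_bot_iff]
    intro ξ hξ
    apply hZd
    intro ζ hζ a ha
    exact (Submodule.mem_orthogonal _ _).mp hξ _ (Submodule.subset_span ⟨ζ, hζ, a, ha, rfl⟩)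
  ext x
  have h2 : (S - T) x = 0 := by
    apply kill_closure (K := L) (z := S - T)
    · intro k hk
      induction hk using Submodule.span_induction with
      | mem k hk => obtain ⟨ζ, hζ, a, ha, rfl⟩ := hk; rw [ContinuousLinearMap.sub_apply, h ζ hζ a ha, sub_self]
      | zero => simp
      | add a b _ _ ha hb => rw [map_add, ha, hb, add_zero]
      | smul c a _ ha => rw [map_smul, ha, smul_zero]
    · rw [h1]; trivial
  exact sub_eq_zero.mp h2

set_option maxHeartbeats 2000000 in
lemma Rep.lam (r : Rep M M₁ M₂ B E π p) {Q : VonNeumannAlgebra H} (hQM : ∀ x ∈ Q, x ∈ M) {F : BH H → BH H} (hF : IsCondExp (M : Set (BH H)) Q F) :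
    ∃ Λ : BH K → BH H, (∀ S T, Λ (S + T) = Λ S + Λ T) ∧ (∀ (c : ℂ) T, Λ (c • T) = c • Λ T) ∧ (∀ T, 0 ≤ T → 0 ≤ Λ T) ∧
      (∀ x ∈ M, Λ (π x) = F x) ∧ ∀ a ∈ Q, ∀ b ∈ Q, ∀ T, Λ (π a * T * π b) = a * Λ T * b := by
  obtain ⟨Z, hZ, hZd⟩ := cyclic Q
  choose s hs hsv using r.state hF
  let D : GD Z (BH K) :=
    { f := fun ζ => s ζ
      pos := fun ζ a => hs ζ _ (star_mul_self_nonneg a)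
      bd := fun T => ‖T‖
      bd_nonneg := fun T => norm_nonneg T
      bound := fun x ζ y => by
        have h1 := hs ζ _ (sub_nonneg.mpr (norm_conj_le x y))
        rw [map_sub, map_smul, smul_eq_mul] at h1
        have h2 := (Complex.le_def.mp h1).1
        rw [Complex.sub_re, Complex.re_ofReal_mul, Complex.zero_re] at h2
        linarith }
  have Dinn : ∀ (ζ : Z) (a b : BH K), ⟪geta D ζ a, geta D ζ b⟫_ℂ = s ζ (star a * b) := fun ζ a b => geta_inner D ζ a b
  have Dne : ∀ (ζ ζ' : Z), ζ ≠ ζ' → ∀ (a b : BH K), ⟪geta D ζ a, geta D ζ' b⟫_ℂ = 0 := fun ζ ζ' h a b => geta_inner_ne D h a b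
  have Dact := gpiHom_geta D
  have Dadd := gpiHom_add D
  have Dmul := gpiHom_mul D
  have Dsm := gpiHom_smul D
  have Dst := gpiHom_star D
  have Deadd := geta_add D
  have Desm := geta_smul D
  generalize hG : geta D = et at *
  generalize hP : (gpiHom D : BH K → BH (GK D)) = ρ at *
  clear hG hP
  let e : (Z →₀ Q.toStarSubalgebra) →ₗ[ℂ] H := Finsupp.lsum ℂ fun ζ =>
    { toFun := fun a => (a : BH H) ζ, map_add' := fun a b => rfl, map_smul' := fun c a => rfl }
  let f : (Z →₀ Q.toStarSubalgebra) →ₗ[ℂ] GK D := Finsupp.lsum ℂ fun ζ =>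
    { toFun := fun a => et ζ (π a)
      map_add' := fun a b => by
        have := r.add a (hQM _ a.2) b (hQM _ b.2)
        rw [← Deadd, ← this]; rfl
      map_smul' := fun c a => by
        have := r.smul c a (hQM _ a.2)
        rw [RingHom.id_apply, ← Desm, ← this]; rfl }
  have he : ∀ ζ a, e (Finsupp.single ζ a) = (a : BH H) ζ := fun ζ a => by simp [e]
  have hf : ∀ ζ a, f (Finsupp.single ζ a) = et ζ (π a) := fun ζ a => by
    simp only [f]; rw [Finsupp.lsum_single]; rfl
  have hin : ∀ a b, ⟪f a, f b⟫_ℂ = ⟪e a, e b⟫_ℂ := by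
    intro a b
    induction a using Finsupp.induction_linear with
    | zero => rw [map_zero, map_zero, inner_zero_left, inner_zero_left]
    | add a a' h h' => rw [map_add, map_add, inner_add_left, inner_add_left, h, h']
    | single ζ a =>
      induction b using Finsupp.induction_linear with
      | zero => rw [map_zero, map_zero, inner_zero_right, inner_zero_right]
      | add a a' h h' => rw [map_add, map_add, inner_add_right, inner_add_right, h, h']
      | single ζ' b =>
        have haQ : (a : BH H) ∈ Q := a.2
        have hbQ : (b : BH H) ∈ Q := b.2
        have haM := hQM _ haQ
        have hbM := hQM _ hbQ
        rw [he, he, hf, hf]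
        by_cases hne : ζ = ζ'
        · subst hne
          rw [Dinn, ← r.str _ haM, ← r.mul _ (star_mem haM) _ hbM, hsv _ _ (mul_mem (star_mem haM) hbM),
            hF.fixes _ (mul_mem (star_mem haQ) hbQ), ContinuousLinearMap.mul_apply, inner_star']
        · rw [Dne _ _ hne, ← inner_star', ← ContinuousLinearMap.mul_apply,
            hZ _ ζ.2 _ ζ'.2 (fun h => hne (Subtype.ext h)) _ (mul_mem (star_mem haQ) hbQ)]
  have hdense : DenseRange e := by
    have h1 : e.range.topologicalClosure = ⊤ := by
      rw [Submodule.topologicalClosure_eq_top_iff, Submodule.eq_bot_iff]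
      intro ξ hξ
      apply hZd
      intro ζ hζ a ha
      exact (Submodule.mem_orthogonal _ _).mp hξ _ ⟨Finsupp.single ⟨ζ, hζ⟩ ⟨a, ha⟩, he _ _⟩
    exact (Submodule.dense_iff_topologicalClosure_eq_top (s := e.range)).mpr h1
  have hnorm : ∀ a, ‖f a‖ = ‖e a‖ := by
    intro a
    have := hin a a
    rw [inner_self_eq_norm_sq_to_K, inner_self_eq_norm_sq_to_K] at this
    have h2 : ‖f a‖ ^ 2 = ‖e a‖ ^ 2 := by exact_mod_cast this
    exact (sq_eq_sq₀ (norm_nonneg _) (norm_nonneg _)).mp h2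
  let V : H →L[ℂ] GK D := f.extendOfNorm e
  have hV0 : ∀ a, V (e a) = f a := LinearMap.extendOfNorm_eq hdense ⟨1, fun a => by rw [hnorm, one_mul]⟩
  have hV : ∀ (ζ : Z), ∀ a ∈ Q, V (a ζ) = et ζ (π a) := by
    intro ζ a ha
    have := hV0 (Finsupp.single ζ ⟨a, ha⟩)
    rwa [he, hf] at this
  have hVa : ∀ a ∈ Q, ∀ x, V (a x) = ρ (π a) (V x) := by
    intro a ha x
    have : V ∘L a = ρ (π a) ∘L V := by
      apply cyc_ext hZd
      intro ζ hζ b hb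
      rw [ContinuousLinearMap.comp_apply, ContinuousLinearMap.comp_apply, ← ContinuousLinearMap.mul_apply a b, hV ⟨ζ, hζ⟩ _ (mul_mem ha hb),
        hV ⟨ζ, hζ⟩ _ hb, Dact, r.mul _ (hQM _ ha) _ (hQM _ hb)]
    exact congrArg (fun S : H →L[ℂ] GK D => S x) this
  refine ⟨fun T => ContinuousLinearMap.adjoint V ∘L ρ T ∘L V, ?_, ?_, ?_, ?_, ?_⟩
  · intro S T
    simp only [Dadd, ContinuousLinearMap.add_comp, ContinuousLinearMap.comp_add]
  · intro c T
    simp only [Dsm, ContinuousLinearMap.smul_comp, ContinuousLinearMap.comp_smul]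
  · intro T hT
    obtain ⟨S, rfl⟩ := CStarAlgebra.nonneg_iff_eq_star_mul_self.mp hT
    apply nonneg_of_inner
    intro x
    rw [ContinuousLinearMap.comp_apply, ContinuousLinearMap.comp_apply, ContinuousLinearMap.adjoint_inner_right, Dmul, Dst,
      ContinuousLinearMap.mul_apply, inner_star']
    exact inner_nonneg_of (zero_le_one : (0 : BH (GK D)) ≤ 1) (ρ S (V x))
  · intro x hx
    apply cyc_ext hZd
    intro ζ hζ a ha
    rw [← sub_eq_zero]
    apply hZd
    intro ζ' hζ' b hb
    have haM := hQM _ ha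
    have hbM := hQM _ hb
    rw [inner_sub_right, ContinuousLinearMap.comp_apply, ContinuousLinearMap.comp_apply, ContinuousLinearMap.adjoint_inner_right,
      hV ⟨ζ, hζ⟩ a ha, hV ⟨ζ', hζ'⟩ b hb, Dact, ← r.mul _ hx _ haM]
    have hFx := hF.maps_to x hx
    have e1 : ⟪b ζ', F x (a ζ)⟫_ℂ = ⟪ζ', (star b * F x * a) ζ⟫_ℂ := by
      rw [ContinuousLinearMap.mul_apply, ContinuousLinearMap.mul_apply, inner_star']
    rw [e1]
    by_cases hne : ζ' = ζ
    · subst hne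
      rw [Dinn, ← r.str _ hbM, ← r.mul _ (star_mem hbM) _ (mul_mem hx haM), hsv _ _ (mul_mem (star_mem hbM) (mul_mem hx haM)),
        ← mul_assoc, hF.bimod _ (star_mem hb) _ ha x hx, sub_self]
    · rw [Dne _ _ (fun h => hne (congrArg Subtype.val h)), hZ _ hζ' _ hζ hne _ (mul_mem (mul_mem (star_mem hb) hFx) ha), sub_zero]
  · intro a ha b hb T
    apply eq_of_inner
    intro x y
    rw [ContinuousLinearMap.comp_apply, ContinuousLinearMap.comp_apply, ContinuousLinearMap.adjoint_inner_right, Dmul, Dmul,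
      ContinuousLinearMap.mul_apply, ContinuousLinearMap.mul_apply, ← hVa b hb, ← inner_star, ← Dst, ← r.str _ (hQM _ ha), ← hVa _ (star_mem ha),
      ContinuousLinearMap.mul_apply, ContinuousLinearMap.mul_apply, ContinuousLinearMap.comp_apply, ContinuousLinearMap.comp_apply, ← inner_star a, ContinuousLinearMap.adjoint_inner_right]

lemma Rep.phi (r : Rep M M₁ M₂ B E π p) {Q : VonNeumannAlgebra H} (hQM : ∀ x ∈ Q, x ∈ M) {F : BH H → BH H} (hF : IsCondExp (M : Set (BH H)) Q F)
    (hQ : IsAmenableVN (Q : Set (BH H))) :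
    ∃ Φ : BH K →ₗ[ℂ] BH H, (∀ T, Φ T ∈ Q) ∧ (∀ T, 0 ≤ T → 0 ≤ Φ T) ∧
      (∀ x ∈ M, Φ (π x) = F x) ∧ ∀ a ∈ Q, ∀ b ∈ Q, ∀ T, Φ (π a * T * π b) = a * Φ T * b := by
  obtain ⟨Λ, h1, h2, h3, h4, h5⟩ := r.lam hQM hF
  obtain ⟨Ψ, hΨ⟩ := hQ
  refine ⟨⟨⟨fun T => Ψ (Λ T), fun S T => ?_⟩, fun c T => ?_⟩, ?_, ?_, ?_, ?_⟩
  · rw [h1]; exact hΨ.map_add _ (Set.mem_univ _) _ (Set.mem_univ _)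
  · change Ψ (Λ (c • T)) = c • Ψ (Λ T)
    rw [h2]; exact hΨ.map_smul _ _ (Set.mem_univ _)
  · exact fun T => hΨ.maps_to _ (Set.mem_univ _)
  · exact fun T hT => hΨ.pos _ (Set.mem_univ _) (h3 T hT)
  · intro x hx
    change Ψ (Λ (π x)) = F x
    rw [h4 x hx]; exact hΨ.fixes _ (hF.maps_to x hx)
  · intro a ha b hb T
    change Ψ (Λ _) = a * Ψ (Λ T) * b
    rw [h5 a ha b hb]; exact hΨ.bimod a ha b hb _ (Set.mem_univ _)


end phi

/-- no nonzero abelian projections -/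
lemma noab {N : VonNeumannAlgebra H} (hno : HasNoTypeIDirectSummand (N : Set (BH H))) {q : BH H}
    (hq : IsAbelianProjection (N : Set (BH H)) q) : q = 0 := by
  by_contra hq0
  obtain ⟨hqp, hqN, hqa⟩ := hq
  have hqN : q ∈ N := hqN
  let K : Submodule ℂ H := Submodule.span ℂ {k | ∃ m ∈ N, ∃ ξ, k = m (q ξ)}
  have hK : ∀ y : BH H, (∀ m ∈ N, ∀ ξ, y (m (q ξ)) ∈ K) → ∀ k ∈ K, y k ∈ K := by
    intro y hy k hk
    induction hk using Submodule.span_induction with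
    | mem k hk => obtain ⟨m, hm, ξ, rfl⟩ := hk; exact hy m hm ξ
    | zero => rw [map_zero]; exact zero_mem _
    | add a b _ _ ha hb => rw [map_add]; exact add_mem ha hb
    | smul c a _ ha => rw [map_smul]; exact Submodule.smul_mem _ _ ha
  have hzN : pr K ∈ N := by
    apply pr_mem_vn
    intro y hy
    apply hK
    intro m hm ξ
    have e1 : y (m (q ξ)) = m (q (y ξ)) := by
      have : y * (m * q) = m * q * y := (hy _ (mul_mem hm hqN)).symm
      exact congrArg (fun S : BH H => S ξ) this
    rw [e1]
    exact Submodule.subset_span ⟨m, hm, _, rfl⟩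
  have hinv : ∀ x ∈ N, ∀ k ∈ K, x k ∈ K := by
    intro x hx
    apply hK
    intro m hm ξ
    exact Submodule.subset_span ⟨x * m, mul_mem hx hm, ξ, rfl⟩
  have hzc : ∀ x ∈ N, x * pr K = pr K * x := fun x hx => pr_comm (hinv x hx) (hinv _ (star_mem hx))
  have hzq : pr K * q = q := by
    ext ξ
    exact pr_fix (Submodule.subset_span ⟨1, one_mem N, ξ, rfl⟩)
  have hzp := pr_isProj K
  generalize hz : pr K = z at *
  have hz0 : z ≠ 0 := by rintro rfl; exact hq0 (by rw [← hzq, zero_mul])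
  refine hno z ⟨hzp, hzN, fun x hx => (hzc x hx).symm⟩ hz0 ?_
  rintro t ⟨htp, ⟨htN, hzt⟩, htc⟩ ht0
  have htN : t ∈ N := htN
  have hzt1 : z * t = t := by rw [← hzt, ← mul_assoc, ← mul_assoc, hzp.2.eq]
  have hzt2 : t * z = t := by rw [hzc t htN, hzt1]
  have htc' : ∀ x ∈ N, t * x = x * t := by
    intro x hx
    have h1 := htc (z * x * z) ⟨mul_mem (mul_mem hzN hx) hzN, by
      rw [← mul_assoc, ← mul_assoc, hzp.2.eq, mul_assoc, hzp.2.eq]⟩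
    calc t * x = t * z * x * z := by rw [mul_assoc, mul_assoc, ← mul_assoc z x z, ← hzc x hx, mul_assoc, hzp.2.eq, hzc x hx, ← mul_assoc, hzt2]
      _ = z * x * z * t := by rw [← h1]; simp only [mul_assoc]
      _ = x * t := by rw [← hzc x hx, mul_assoc x, hzp.2.eq, mul_assoc, hzt1]
  have htq := htc' q hqN
  have htqp : IsProjection (t * q) := by
    refine ⟨?_, ?_⟩
    · show star (t * q) = t * q
      rw [star_mul, star_sa htp.1, star_sa hqp.1, htq]
    · show t * q * (t * q) = t * q
      calc t * q * (t * q) = (t * q) * (q * t) := by rw [← htq]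
        _ = t * (q * q) * t := by simp only [mul_assoc]
        _ = t * (t * q) := by rw [hqp.2.eq, mul_assoc, ← htq]
        _ = t * q := by rw [← mul_assoc, htp.2.eq]
  refine ⟨t * q, ⟨htqp, ⟨mul_mem htN hqN, ?_⟩, ?_⟩, ?_, ?_⟩
  · rw [← mul_assoc, hzt1, mul_assoc, hzc q hqN, hzq]
  · rintro x ⟨hx, -⟩ y ⟨hy, -⟩
    have e : ∀ x ∈ N, t * q * x * (t * q) = t * (q * x * q) := by
      intro x hx
      have : t * q * x * (t * q) = t * (q * x * t) * q := by simp only [mul_assoc]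
      rw [this, ← htc' _ (mul_mem hqN hx), ← mul_assoc, htp.2.eq]; simp only [mul_assoc]
    have hx : x ∈ N := hx
    have hy : y ∈ N := hy
    have hX : q * x * q ∈ N := mul_mem (mul_mem hqN hx) hqN
    have hY : q * y * q ∈ N := mul_mem (mul_mem hqN hy) hqN
    have e2 : ∀ X ∈ N, ∀ Y, t * X * (t * Y) = t * (X * Y) := by
      intro X hX Y
      rw [htc' X hX, mul_assoc, ← mul_assoc t t, htp.2.eq, ← mul_assoc, ← htc' X hX, mul_assoc]
    rw [e x hx, e y hy, e2 _ hX, e2 _ hY, hqa x hx y hy]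
  · intro h0
    apply ht0
    rw [← hzt2, ← hz]
    apply kill_pr
    intro k hk
    induction hk using Submodule.span_induction with
    | mem k hk =>
      obtain ⟨m, hm, ξ, rfl⟩ := hk
      have : t * (m * q) = 0 := by rw [← mul_assoc, htc' m hm, mul_assoc, h0, mul_zero]
      exact congrArg (fun S : BH H => S ξ) this
    | zero => rw [map_zero]
    | add a b _ _ ha hb => rw [map_add, ha, hb, add_zero]
    | smul c a _ ha => rw [map_smul, ha, smul_zero]
  · rw [htq, mul_assoc, htp.2.eq]

lemma halve {N : VonNeumannAlgebra H} (hno : HasNoTypeIDirectSummand (N : Set (BH H))) {e : BH H} (he : IsProjection e)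
    (heN : e ∈ N) (he0 : e ≠ 0) : ∃ b₁ ∈ N, ∃ b₂ ∈ N, ∃ q, IsProjection q ∧ q ≠ 0 ∧ e * b₁ = b₁ ∧ b₁ * e = b₁ ∧ e * b₂ = b₂ ∧ b₂ * e = b₂ ∧
      b₁ * star b₁ = q ∧ b₂ * star b₂ = q ∧ b₁ * star b₂ = 0 ∧ b₂ * star b₁ = 0 := by
  have h1 : ∃ h ∈ N, IsProjection h ∧ e * h = h ∧ ∃ y ∈ N, h * y * (e - h) ≠ 0 := by
    by_contra hcon
    push Not at hcon
    apply he0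
    apply noab hno
    refine ⟨he, heN, ?_⟩
    have hY : ∀ y ∈ N, ∀ h ∈ N, IsProjection h → e * h = h → (e * y * e) * h = h * (e * y * e) := by
      intro y hy h hh hhp heh
      have hhe := proj_mul_comm_of hhp he heh
      have e1 := hcon h hh hhp heh y hy
      have e2 := congrArg star (hcon h hh hhp heh (star y) (star_mem hy))
      simp only [star_mul, star_sub, star_star, star_zero, star_sa he.1, star_sa hhp.1] at e2
      rw [mul_sub, sub_eq_zero] at e1
      rw [sub_mul, sub_eq_zero] at e2
      calc (e * y * e) * h = e * (y * h) := by rw [mul_assoc, heh, mul_assoc]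
        _ = h * y * e := by rw [e2, ← mul_assoc, e1]
        _ = _ := by rw [← mul_assoc, ← mul_assoc, hhe]
    have hpos : ∀ y ∈ N, ∀ a ∈ N, e * a = a → 0 ≤ a → a ≤ 1 → (e * y * e) * a = a * (e * y * e) := by
      intro y hy a ha hea ha0 ha1
      set Y := e * y * e with hYd
      have := dyadic (M := N) he (fun a => - ‖Y * a - a * Y‖) (2 * ‖Y‖) (by
        intro s a _ _ _ _ _ _
        have : Y * ((1/2 : ℂ) • (s + a)) - ((1/2 : ℂ) • (s + a)) * Y = (1/2 : ℂ) • ((Y * s - s * Y) + (Y * a - a * Y)) := by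
          simp only [mul_smul_comm, smul_mul_assoc, mul_add, add_mul]; module
        rw [this, norm_smul]
        have h3 : ‖(1/2 : ℂ)‖ = 1/2 := by simp
        rw [h3]
        have := norm_add_le (Y * s - s * Y) (Y * a - a * Y)
        linarith) (by
        intro a _ _ _ h0 h1
        have hn : ‖a‖ ≤ 1 := norm_le_of_le zero_le_one h0 (by simpa using h1)
        have h2 := norm_sub_le (Y * a) (a * Y)
        have h3 := norm_mul_le Y a
        have h4 := norm_mul_le a Y
        have h5 : ‖Y‖ * ‖a‖ ≤ ‖Y‖ := mul_le_of_le_one_right (norm_nonneg _) hn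
        linarith) (by
        intro s hs hsp hes
        rw [hYd, hY y hy s hs hsp hes]; simp) a ha hea ha0 ha1
      have h2 : ‖Y * a - a * Y‖ ≤ 0 := by simpa using this
      exact sub_eq_zero.mp (norm_le_zero_iff.mp h2)
    have hsa : ∀ y ∈ N, ∀ x ∈ N, IsSelfAdjoint x → (e * y * e) * (e * x * e) = (e * x * e) * (e * y * e) := by
      intro y hy x hx hxs
      have hle := le_norm hxs
      have hle' : -x ≤ ((‖x‖ : ℝ) : ℂ) • 1 := by have := le_norm hxs.neg; rwa [norm_neg] at this
      let t : ℝ := 2 * ‖x‖ + 1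
      have ht : 0 < t := by positivity
      let A : BH H := ((t⁻¹ : ℝ) : ℂ) • (x + ((‖x‖ : ℝ) : ℂ) • 1)
      have hA0 : 0 ≤ A := nonneg_smul (by rw [neg_le_iff_add_nonneg'] at hle'; exact hle') (inv_nonneg.mpr ht.le)
      have hA1 : A ≤ 1 := by
        have h3 : x + ((‖x‖ : ℝ) : ℂ) • 1 ≤ ((t : ℝ) : ℂ) • (1 : BH H) := by
          have h4 : ((t : ℝ) : ℂ) • (1 : BH H) = ((‖x‖ : ℝ) : ℂ) • 1 + ((‖x‖ : ℝ) : ℂ) • 1 + 1 := by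
            simp only [t]; push_cast; module
          rw [h4]
          calc _ ≤ ((‖x‖ : ℝ) : ℂ) • (1 : BH H) + ((‖x‖ : ℝ) : ℂ) • 1 := by gcongr
            _ ≤ _ := le_add_of_nonneg_right zero_le_one
        have h5 := nonneg_smul (sub_nonneg.mpr h3) (inv_nonneg.mpr ht.le)
        rw [smul_sub, smul_smul, ← Complex.ofReal_mul, inv_mul_cancel₀ ht.ne', Complex.ofReal_one, one_smul] at h5
        exact sub_nonneg.mp h5
      have hAN : A ∈ N := N.smul_mem (add_mem hx (N.smul_mem (one_mem _) _)) _
      have hse : star e = e := star_sa he.1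
      have k1 : 0 ≤ e * A * e := by have := conj_nonneg hA0 e; rwa [hse] at this
      have k2 : e * A * e ≤ 1 := by
        have := conj_nonneg (sub_nonneg.mpr hA1) e
        rw [hse, mul_sub, sub_mul, mul_one, he.2.eq, sub_nonneg] at this
        exact this.trans (proj_le_one he)
      have k3 := hpos y hy (e * A * e) (mul_mem (mul_mem heN hAN) heN) (by rw [← mul_assoc, ← mul_assoc, he.2.eq]) k1 k2
      have k4 : e * A * e = ((t⁻¹ : ℝ) : ℂ) • (e * x * e + ((‖x‖ : ℝ) : ℂ) • e) := by
        simp only [A, mul_smul_comm, smul_mul_assoc, mul_add, add_mul, mul_one, he.2.eq]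
      have k5 : e * y * e * e = e * (e * y * e) := by rw [mul_assoc _ e e, he.2.eq, ← mul_assoc, ← mul_assoc, he.2.eq]
      rw [k4, mul_smul_comm, smul_mul_assoc] at k3
      have k6 := smul_right_injective (BH H) (r := ((t⁻¹ : ℝ) : ℂ)) (by exact_mod_cast (inv_pos.mpr ht).ne') k3
      simp only [mul_add, add_mul, mul_smul_comm, smul_mul_assoc, k5] at k6
      exact add_right_cancel k6
    intro x hx y hy
    have hd : y = realPart y + Complex.I • (imaginaryPart y : BH H) := (realPart_add_I_smul_imaginaryPart y).symm
    have hre : (realPart y : BH H) ∈ N := by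
      rw [realPart_apply_coe]
      exact N.smul_mem (add_mem hy (star_mem hy)) _
    have him : (imaginaryPart y : BH H) ∈ N := by
      rw [imaginaryPart_apply_coe]
      exact N.smul_mem (N.smul_mem (sub_mem hy (star_mem hy)) _) _
    have e1 := hsa x hx _ hre (realPart y).2
    have e2 := hsa x hx _ him (imaginaryPart y).2
    have e3 : e * y * e = e * (realPart y : BH H) * e + Complex.I • (e * (imaginaryPart y : BH H) * e) := by
      conv_lhs => rw [hd]
      simp only [mul_add, add_mul, mul_smul_comm, smul_mul_assoc]
    rw [e3, mul_add, add_mul, e1, mul_smul_comm, e2, smul_mul_assoc]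
  obtain ⟨h, hh, hhp, heh, y, hy, hne⟩ := h1
  have hhe := proj_mul_comm_of hhp he heh
  have hep := proj_sub hhp he heh
  obtain ⟨v, hv, hvp, hv0, hvl, hvr⟩ := PI (M := N) (mul_mem (mul_mem hh hy) (sub_mem heN hh)) hne
  have v1 : h * v = v := hvl h (by rw [← mul_assoc, ← mul_assoc, hhp.2.eq])
  have v2 : v * (e - h) = v := hvr _ hep.1 (by rw [mul_assoc, hep.2.eq])
  have v3 : v * v = 0 := by
    calc v * v = v * (e - h) * (h * v) := by rw [v1, v2]
      _ = v * ((e - h) * h) * v := by simp only [mul_assoc]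
      _ = 0 := by rw [sub_mul, heh, hhp.2.eq]; simp
  have v4 : e * v = v := by rw [← v1, ← mul_assoc, heh]
  have v5 : v * e = v := by rw [← v2, mul_assoc, sub_mul, he.2.eq, hhe]
  have s4 : star v * e = star v := by have := congrArg star v4; rwa [star_mul, star_sa he.1] at this
  have s5 : e * star v = star v := by have := congrArg star v5; rwa [star_mul, star_sa he.1] at this
  have s3 : star v * star v = 0 := by have := congrArg star v3; rwa [star_mul, star_zero] at this
  refine ⟨star v, star_mem hv, star v * v, mul_mem (star_mem hv) hv, star v * v, hvp, ?_, s5, s4, ?_, ?_, ?_, ?_, ?_, ?_⟩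
  · intro h0; exact hv0 ((CStarRing.star_mul_self_eq_zero_iff v).mp h0)
  · rw [← mul_assoc, s5]
  · rw [mul_assoc, v5]
  · rw [star_star]
  · rw [star_sa hvp.1, hvp.2.eq]
  · rw [star_sa hvp.1, ← mul_assoc, s3, zero_mul]
  · rw [star_star, mul_assoc, v3, mul_zero]

lemma divide {N : VonNeumannAlgebra H} (hno : HasNoTypeIDirectSummand (N : Set (BH H))) {e : BH H} (he : IsProjection e)
    (heN : e ∈ N) (he0 : e ≠ 0) (k : ℕ) : ∃ (ι : Type) (_ : Fintype ι) (_ : DecidableEq ι) (a : ι → BH H) (g : BH H),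
      Fintype.card ι = 2 ^ k ∧ IsProjection g ∧ g ∈ N ∧ g ≠ 0 ∧ e * g = g ∧ (∀ i, a i ∈ N) ∧ (∀ i, e * a i = a i) ∧ (∀ i, a i * e = a i) ∧
      ∀ i j, a i * star (a j) = if i = j then g else 0 := by
  induction k with
  | zero =>
    refine ⟨Unit, inferInstance, inferInstance, fun _ => e, e, by simp, he, heN, he0, he.2.eq, fun _ => heN, fun _ => he.2.eq, fun _ => he.2.eq, ?_⟩
    intro i j
    rw [star_sa he.1, he.2.eq]; simp
  | succ k ih =>
    obtain ⟨ι, _, _, a, g, hc, hg, hgN, hg0, heg, haN, hea, hae, hr⟩ := ih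
    obtain ⟨b₁, hb₁, b₂, hb₂, q, hq, hq0, l1, r1, l2, r2, h11, h22, h12, h21⟩ := halve hno hg hgN hg0
    let b : Bool → BH H := fun x => if x then b₁ else b₂
    have hb : ∀ x, b x ∈ N := fun x => by cases x <;> simpa [b]
    have hl : ∀ x, g * b x = b x := fun x => by cases x <;> simpa [b]
    have hrr : ∀ x, b x * g = b x := fun x => by cases x <;> simpa [b]
    have hbb : ∀ x y, b x * star (b y) = if x = y then q else 0 := by
      intro x y; cases x <;> cases y <;> simpa [b]
    refine ⟨Bool × ι, inferInstance, inferInstance, fun i => b i.1 * a i.2, q, ?_, hq, ?_, hq0, ?_, ?_, ?_, ?_, ?_⟩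
    · rw [Fintype.card_prod, hc, Fintype.card_bool, pow_succ]; ring
    · rw [← h11]; exact mul_mem hb₁ (star_mem hb₁)
    · rw [← h11, ← l1, ← mul_assoc, ← mul_assoc, heg]
    · exact fun i => mul_mem (hb _) (haN _)
    · intro i
      show e * (b i.1 * a i.2) = b i.1 * a i.2
      rw [← hl i.1, ← mul_assoc, ← mul_assoc, heg]
    · intro i
      show b i.1 * a i.2 * e = b i.1 * a i.2
      rw [mul_assoc, hae]
    · rintro ⟨x, i⟩ ⟨y, j⟩
      show b x * a i * star (b y * a j) = _
      have : b x * a i * star (b y * a j) = b x * (a i * star (a j)) * star (b y) := by rw [star_mul]; simp only [mul_assoc]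
      rw [this, hr]
      by_cases hij : i = j
      · subst hij
        rw [if_pos rfl, hrr, hbb]
        simp
      · rw [if_neg hij]; simp [hij]

lemma inv_vn {N : VonNeumannAlgebra H} {β : BH H} {ε : ℝ} (hε : 0 < ε) (hβ : β ∈ N) (hle : (ε : ℂ) • (1 : BH H) ≤ β) :
    ∃ γ ∈ N, β * γ = 1 ∧ γ * β = 1 ∧ star γ = γ ∧ ∀ y, y * β = β * y → y * γ = γ * y := by
  have hsa : IsSelfAdjoint β := sa_of_nonneg ((nonneg_smul zero_le_one hε.le).trans hle)
  have hu : IsUnit β := by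
    apply CStarAlgebra.isUnit_of_le _ hle
  obtain ⟨u, rfl⟩ := hu
  have h1 : (u : BH H) * ((u⁻¹ : (BH H)ˣ) : BH H) = 1 := u.mul_inv
  have h2 : ((u⁻¹ : (BH H)ˣ) : BH H) * (u : BH H) = 1 := u.inv_mul
  generalize ((u⁻¹ : (BH H)ˣ) : BH H) = γ at *
  generalize (u : BH H) = β at *
  have hc : ∀ y, y * β = β * y → y * γ = γ * y := by
    intro y hy
    calc y * γ = (γ * β) * y * γ := by rw [h2, one_mul]
      _ = γ * (y * β) * γ := by rw [hy]; simp only [mul_assoc]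
      _ = γ * y * (β * γ) := by simp only [mul_assoc]
      _ = γ * y := by rw [h1, mul_one]
  refine ⟨γ, mem_vn fun y hy => hc y (hy β hβ).symm, h1, h2, ?_, hc⟩
  have h3 : star γ * β = 1 := by
    have := congrArg star h1
    rwa [star_mul, star_one, star_sa hsa] at this
  calc star γ = star γ * (β * γ) := by rw [h1, mul_one]
    _ = γ := by rw [← mul_assoc, h3, one_mul]

lemma square_form {K : Type*} [NormedAddCommGroup K] [InnerProductSpace ℂ K] [CompleteSpace K] {α β γ b : BH K} (h1 : β * γ = 1)
    (hs : star γ = γ) (hβ : 0 ≤ β) (hα : b * γ * star b ≤ α) (x y : K) :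
    2 * (⟪y, b x⟫_ℂ).re ≤ (⟪x, β x⟫_ℂ).re + (⟪y, α y⟫_ℂ).re := by
  have h2 : γ * β = 1 := by
    have := congrArg star h1
    rwa [star_mul, star_one, hs, star_sa (sa_of_nonneg hβ)] at this
  have k1 := re_nonneg_of hβ (x - (γ * star b) y)
  have k2 := re_nonneg_of (sub_nonneg.mpr hα) y
  have e1 : β ((γ * star b) y) = star b y := by
    rw [← ContinuousLinearMap.mul_apply, ← mul_assoc, h1, one_mul]
  have e2 : ⟪(γ * star b) y, β x⟫_ℂ = ⟪y, b x⟫_ℂ := by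
    have : γ * star b = star (b * γ) := by rw [star_mul, hs]
    rw [this, inner_star, ← ContinuousLinearMap.mul_apply, mul_assoc, h2, mul_one]
  have e3 : ⟪(γ * star b) y, star b y⟫_ℂ = ⟪y, (b * γ * star b) y⟫_ℂ := by
    have : γ * star b = star (b * γ) := by rw [star_mul, hs]
    rw [this, inner_star, ← ContinuousLinearMap.mul_apply]
  have e4 : (⟪x, star b y⟫_ℂ).re = (⟪y, b x⟫_ℂ).re := by
    rw [inner_star', ← inner_conj_symm, Complex.conj_re]
  rw [map_sub, inner_sub_left, inner_sub_right, inner_sub_right, e1, e2, e3] at k1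
  simp only [Complex.sub_re, e4] at k1
  rw [ContinuousLinearMap.sub_apply, inner_sub_right, Complex.sub_re] at k2
  linarith

section mix
universe u v
variable {H : Type u} [NormedAddCommGroup H] [InnerProductSpace ℂ H] [CompleteSpace H]
variable {M M₁ M₂ B : VonNeumannAlgebra H} {E : BH H → BH H}
variable {K : Type v} [NormedAddCommGroup K] [InnerProductSpace ℂ K] [CompleteSpace K] {π : BH H → BH K} {p : BH K}

lemma Rep.zero (r : Rep M M₁ M₂ B E π p) : π 0 = 0 := by
  have := r.smul 0 0 (zero_mem M)
  simpa using this

lemma Rep.sub (r : Rep M M₁ M₂ B E π p) {x y : BH H} (hx : x ∈ M) (hy : y ∈ M) : π (x - y) = π x - π y := by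
  have h1 := r.smul (-1) y hy
  have h2 := r.add x hx _ (M.smul_mem hy (-1))
  have e : x + (-1 : ℂ) • y = x - y := by rw [neg_one_smul, sub_eq_add_neg]
  rw [e, h1, neg_one_smul, ← sub_eq_add_neg] at h2
  exact h2

lemma Rep.sum (r : Rep M M₁ M₂ B E π p) {ι : Type*} (s : Finset ι) (f : ι → BH H) (hf : ∀ i ∈ s, f i ∈ M) :
    π (∑ i ∈ s, f i) = ∑ i ∈ s, π (f i) := by
  classical
  induction s using Finset.induction_on with
  | empty => simp [r.zero]
  | insert i s hi ih =>
    rw [Finset.sum_insert hi, Finset.sum_insert hi, r.add _ (hf _ (Finset.mem_insert_self _ _)) _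
      (sum_mem fun j hj => hf j (Finset.mem_insert_of_mem hj)), ih fun j hj => hf j (Finset.mem_insert_of_mem hj)]

lemma Rep.pos (r : Rep M M₁ M₂ B E π p) {x : BH H} (hx : x ∈ M) (h0 : 0 ≤ x) : 0 ≤ π x := by
  have hsa := sa_of_nonneg h0
  have hy : cfc Real.sqrt x ∈ M := cfc_mem hx hsa _
  have hys : IsSelfAdjoint (cfc Real.sqrt x) := cfc_predicate _ _
  have e : star (cfc Real.sqrt x) * cfc Real.sqrt x = x := by
    rw [star_sa hys, ← cfc_mul _ _ x (by fun_prop) (by fun_prop)]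
    conv_rhs => rw [← cfc_id' ℝ x]
    apply cfc_congr
    intro t ht
    exact Real.mul_self_sqrt (spectrum_nonneg_of_nonneg h0 ht)
  rw [← e, r.mul _ (star_mem hy) _ hy, r.str _ hy]
  exact star_mul_self_nonneg _

lemma Rep.mono (r : Rep M M₁ M₂ B E π p) {x y : BH H} (hx : x ∈ M) (hy : y ∈ M) (h0 : x ≤ y) : π x ≤ π y := by
  rw [← sub_nonneg, ← r.sub hy hx]
  exact r.pos (sub_mem hy hx) (sub_nonneg.mpr h0)

lemma Rep.mix (r : Rep M M₁ M₂ B E π p) (h : IsAFP M M₁ M₂ B E) {f a c : BH H} (hf : IsAbelianProjection (B : Set (BH H)) f)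
    (ha : a ∈ M) (hc : c ∈ M) (haf : a * f = a) (hcf : c * f = c) (x y : K) :
    2 * (⟪y, π (E (star c * a)) x⟫_ℂ).re ≤ (⟪x, π (E (star c * c)) x⟫_ℂ).re + (⟪y, π (E (star a * a)) y⟫_ℂ).re := by
  obtain ⟨hfp, hfB, hfa⟩ := hf
  have hfB : f ∈ B := hfB
  have hsa : ∀ x : BH H, x * f = x → f * star x = star x := by
    intro x hx
    have := congrArg star hx
    rwa [star_mul, star_sa hfp.1] at this
  have hE : ∀ x y : BH H, x ∈ M → y ∈ M → x * f = x → y * f = y → f * E (star x * y) * f = E (star x * y) := by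
    intro x y hx hy hxf hyf
    rw [← h.condExp.bimod f hfB f hfB _ (mul_mem (star_mem hx) hy), ← mul_assoc, hsa x hxf, mul_assoc, hyf]
  have hB : ∀ x ∈ M, E x ∈ B := fun x hx => h.condExp.maps_to x hx
  have hBM : ∀ x ∈ B, x ∈ M := fun x hx => h.le₁M (h.le₁ hx)
  have hac := mul_mem (star_mem hc) ha
  have hca := mul_mem (star_mem ha) hc
  have hcc := mul_mem (star_mem hc) hc
  have haa := mul_mem (star_mem ha) ha
  set b := E (star c * a) with hb
  have hbs : star b = E (star a * c) := by rw [hb, ← ce_star h.condExp hac, star_mul, star_star]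
  have hbB : b ∈ B := hB _ hac
  have c1 : b * star b = star b * b := by
    have := hfa b hbB (star b) (star_mem hbB)
    rwa [hbs, hE a c ha hc haf hcf, hb, hE c a hc ha hcf haf, ← hb, ← hbs] at this
  have c2 : b * E (star c * c) = E (star c * c) * b := by
    have := hfa b hbB _ (hB _ hcc)
    rwa [hE c c hc hc hcf hcf, hb, hE c a hc ha hcf haf] at this
  have key : ∀ ε : ℝ, 0 < ε → 2 * (⟪y, π b x⟫_ℂ).re ≤ (⟪x, π (E (star c * c)) x⟫_ℂ).re + (⟪y, π (E (star a * a)) y⟫_ℂ).re + ε * ‖x‖ ^ 2 := by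
    intro ε hε
    let β : BH H := E (star c * c) + (ε : ℂ) • 1
    have hβB : β ∈ B := add_mem (hB _ hcc) (B.smul_mem (one_mem _) _)
    have hge : (ε : ℂ) • (1 : BH H) ≤ β := le_add_of_nonneg_left (h.condExp.pos _ hcc (star_mul_self_nonneg c))
    obtain ⟨γ, hγB, hβγ, hγβ, hγs, hγc⟩ := inv_vn hε hβB hge
    have hbγ : b * γ = γ * b := hγc b (by simp only [β, mul_add, add_mul, c2, mul_smul_comm, smul_mul_assoc, mul_one, one_mul])
    have hγbB : γ * b ∈ B := mul_mem hγB hbB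
    have hγbM := hBM _ hγbB
    -- Schur
    have schur : b * γ * star b ≤ E (star a * a) := by
      have hd : a - c * (γ * b) ∈ M := sub_mem ha (mul_mem hc hγbM)
      have p1 := h.condExp.pos _ (mul_mem (star_mem hd) hd) (star_mul_self_nonneg _)
      have e1 : star (a - c * (γ * b)) * (a - c * (γ * b)) = (star a * a - (star a * c) * (γ * b)) - (star (γ * b) * (star c * a) - star (γ * b) * (star c * c) * (γ * b)) := by
        rw [star_sub, star_mul c]; simp only [sub_mul, mul_sub, mul_assoc]; abel
      have m1 : star a * c * (γ * b) ∈ M := mul_mem hca hγbM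
      have m2 : star (γ * b) * (star c * a) ∈ M := mul_mem (star_mem hγbM) hac
      have m3 : star (γ * b) * (star c * c) * (γ * b) ∈ M := mul_mem (mul_mem (star_mem hγbM) hcc) hγbM
      have ce := h.condExp
      rw [e1, ce_sub ce (sub_mem haa m1) (sub_mem m2 m3), ce_sub ce haa m1, ce_sub ce m2 m3, ce_right ce hγbB hca,
        ce_left ce (star_mem hγbB) hac, ce.bimod _ (star_mem hγbB) _ hγbB _ hcc, ← hbs, ← hb, star_mul, hγs] at p1
      have e2 : star b * γ * E (star c * c) * (γ * b) = star b * (γ * b) - (ε : ℂ) • (star (γ * b) * (γ * b)) := by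
        have : E (star c * c) = β - (ε : ℂ) • 1 := by simp only [β]; abel
        rw [this, mul_sub, sub_mul]
        congr 1
        · calc star b * γ * β * (γ * b) = star b * (γ * β) * (γ * b) := by simp only [mul_assoc]
            _ = _ := by rw [hγβ, mul_one]
        · rw [star_mul, hγs, mul_smul_comm, smul_mul_assoc, mul_one]
      have e3 : b * γ * star b = star b * (γ * b) := by
        rw [hbγ, mul_assoc, c1, ← mul_assoc, ← mul_assoc]
        congr 1
        have := congrArg star hbγ
        rwa [star_mul, star_mul, hγs] at this
      rw [e2] at p1
      have p2 := nonneg_smul (star_mul_self_nonneg (γ * b)) hε.le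
      rw [e3, ← sub_nonneg]
      have e4 : E (star a * a) - star b * (γ * b) = (E (star a * a) - star b * (γ * b) - (star b * γ * b - (star b * (γ * b) - (ε : ℂ) • (star (γ * b) * (γ * b)))))
         + (ε : ℂ) • (star (γ * b) * (γ * b)) := by rw [mul_assoc]; abel
      rw [e4]
      exact add_nonneg p1 p2
    have hβM := hBM _ hβB
    have hγM := hBM _ hγB
    have hbM := hBM _ hbB
    have q1 : π β * π γ = 1 := by rw [← r.mul _ hβM _ hγM, hβγ, r.one]
    have q2 : star (π γ) = π γ := by rw [← r.str _ hγM, hγs]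
    have q3 : 0 ≤ π β := r.pos hβM ((nonneg_smul zero_le_one hε.le).trans hge)
    have q4 : π b * π γ * star (π b) ≤ π (E (star a * a)) := by
      rw [← r.mul _ hbM _ hγM, ← r.str _ hbM, ← r.mul _ (mul_mem hbM hγM) _ (star_mem hbM)]
      exact r.mono (mul_mem (mul_mem hbM hγM) (star_mem hbM)) (hBM _ (hB _ haa)) schur
    have := square_form q1 q2 q3 q4 x y
    have e5 : (⟪x, π β x⟫_ℂ).re = (⟪x, π (E (star c * c)) x⟫_ℂ).re + ε * ‖x‖ ^ 2 := by
      have : π β = π (E (star c * c)) + (ε : ℂ) • 1 := by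
        rw [r.add _ (hBM _ (hB _ hcc)) _ (M.smul_mem (one_mem _) _), r.smul _ _ (one_mem _), r.one]
      rw [this, ContinuousLinearMap.add_apply, inner_add_right, Complex.add_re, ContinuousLinearMap.smul_apply, ContinuousLinearMap.one_apply,
        inner_smul_right, Complex.re_ofReal_mul, inner_self_eq_norm_sq_to_K]
      norm_cast
    linarith
  apply le_of_forall_pos_le_add
  intro δ hδ
  have := key (δ / (‖x‖ ^ 2 + 1)) (by positivity)
  have h2 : δ / (‖x‖ ^ 2 + 1) * ‖x‖ ^ 2 ≤ δ := by
    rw [div_mul_eq_mul_div, div_le_iff₀ (by positivity)]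
    nlinarith
  linarith

end mix

section xle
universe u v
variable {H : Type u} [NormedAddCommGroup H] [InnerProductSpace ℂ H] [CompleteSpace H]
variable {M M₁ M₂ B : VonNeumannAlgebra H} {E : BH H → BH H}
variable {K : Type v} [NormedAddCommGroup K] [InnerProductSpace ℂ K] [CompleteSpace K] {π : BH H → BH K} {p : BH K}

lemma sum_le_one {ι : Type} [Fintype ι] [DecidableEq ι] {a : ι → BH H} {g : BH H} (hg : IsProjection g)
    (hr : ∀ i j, a i * star (a j) = if i = j then g else 0) : ∑ i, star (a i) * a i ≤ 1 := by
  have h1 : ∀ i, g * a i = a i := by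
    intro i
    have hii : a i * star (a i) = g := by rw [hr, if_pos rfl]
    have e : (g * a i - a i) * star (g * a i - a i) = 0 := by
      rw [star_sub, star_mul, star_sa hg.1, sub_mul, mul_sub, mul_sub]
      have e1 : g * a i * (star (a i) * g) = g := by
        rw [mul_assoc, ← mul_assoc (a i), hii, hg.2.eq, hg.2.eq]
      have e2 : g * a i * star (a i) = g := by rw [mul_assoc, hii, hg.2.eq]
      have e3 : a i * (star (a i) * g) = g := by rw [← mul_assoc, hii, hg.2.eq]
      rw [e1, e2, e3, hii]; abel
    have := (CStarRing.mul_star_self_eq_zero_iff _).mp e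
    exact sub_eq_zero.mp this
  have hP : IsProjection (∑ i, star (a i) * a i) := by
    refine ⟨?_, ?_⟩
    · show star _ = _
      rw [star_sum]
      exact Finset.sum_congr rfl fun i _ => by rw [star_mul, star_star]
    · show (∑ i, star (a i) * a i) * (∑ i, star (a i) * a i) = _
      rw [Finset.sum_mul_sum]
      apply Finset.sum_congr rfl
      intro i _
      rw [Finset.sum_eq_single i]
      · calc star (a i) * a i * (star (a i) * a i) = star (a i) * (a i * star (a i)) * a i := by simp only [mul_assoc]
          _ = _ := by rw [hr, if_pos rfl, mul_assoc, h1]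
      · intro j _ hj
        calc star (a i) * a i * (star (a j) * a j) = star (a i) * (a i * star (a j)) * a j := by simp only [mul_assoc]
          _ = _ := by rw [hr, if_neg (Ne.symm hj), mul_zero, zero_mul]
      · simp
  exact proj_le_one hP

lemma Rep.xle (r : Rep M M₁ M₂ B E π p) (h : IsAFP M M₁ M₂ B E) {f g : BH H} (hf : IsAbelianProjection (B : Set (BH H)) f)
    {ι : Type} [Fintype ι] [DecidableEq ι] {a : ι → BH H} (hg : IsProjection g) (ha : ∀ i, a i ∈ M₁) (haf : ∀ i, a i * f = a i)
    (hr : ∀ i j, a i * star (a j) = if i = j then g else 0) : ∑ i, π (a i) * p * star (π (a i)) ≤ 1 := by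
  have haM : ∀ i, a i ∈ M := fun i => h.le₁M (ha i)
  have hpp := r.proj.2.eq
  have hps := star_sa r.proj.1
  have hBM : ∀ x ∈ B, x ∈ M := fun x hx => h.le₁M (h.le₁ hx)
  set X := ∑ i, π (a i) * p * star (π (a i)) with hX
  have hXi : ∀ i, π (a i) * p * star (π (a i)) = (π (a i) * p) * star (π (a i) * p) := by
    intro i; rw [star_mul, hps, mul_assoc, mul_assoc, ← mul_assoc p p, hpp]
  have hX0 : 0 ≤ X := Finset.sum_nonneg fun i _ => by rw [hXi]; exact mul_star_self_nonneg _
  rw [← sub_nonneg]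
  apply nonneg_of_re ((IsSelfAdjoint.one _).sub (sa_of_nonneg hX0))
  intro k
  let l : ι → K := fun i => star (π (a i) * p) k
  have hpl : ∀ i, p (l i) = l i := by
    intro i
    simp only [l]
    rw [star_mul, hps, ← ContinuousLinearMap.mul_apply, ← mul_assoc, hpp]
  have hXk : X k = ∑ i, (π (a i) * p) (l i) := by
    rw [hX, ContinuousLinearMap.sum_apply]
    exact Finset.sum_congr rfl fun i _ => by rw [hXi]; rfl
  have hS : ⟪k, X k⟫_ℂ = ((∑ i, ‖l i‖ ^ 2 : ℝ) : ℂ) := by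
    rw [hXk, inner_sum, Complex.ofReal_sum]
    apply Finset.sum_congr rfl
    intro i _
    rw [← inner_star, inner_self_eq_norm_sq_to_K]
    norm_cast
  set S : ℝ := ∑ i, ‖l i‖ ^ 2 with hSd
  have hS0 : 0 ≤ S := Finset.sum_nonneg fun i _ => sq_nonneg _
  have hij : ∀ i j, ⟪(π (a j) * p) (l j), (π (a i) * p) (l i)⟫_ℂ = ⟪l j, π (E (star (a j) * a i)) (l i)⟫_ℂ := by
    intro i j
    rw [← inner_star', star_mul, hps, ← r.str _ (haM j)]
    have : p * π (star (a j)) * (π (a i) * p) = π (E (star (a j) * a i)) * p := by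
      rw [← r.comp _ (mul_mem (star_mem (ha j)) (ha i)), r.mul _ (star_mem (haM j)) _ (haM i)]; simp only [mul_assoc]
    rw [← ContinuousLinearMap.mul_apply, this, ContinuousLinearMap.mul_apply, hpl]
  have hXX : ‖X k‖ ^ 2 ≤ S := by
    have e1 : ((‖X k‖ ^ 2 : ℝ) : ℂ) = ∑ j, ∑ i, ⟪l j, π (E (star (a j) * a i)) (l i)⟫_ℂ := by
      have : ((‖X k‖ ^ 2 : ℝ) : ℂ) = ⟪X k, X k⟫_ℂ := by rw [inner_self_eq_norm_sq_to_K]; norm_cast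
      rw [this, hXk, sum_inner]
      apply Finset.sum_congr rfl
      intro j _
      rw [inner_sum]
      exact Finset.sum_congr rfl fun i _ => hij i j
    have e2 : ‖X k‖ ^ 2 = ∑ j, ∑ i, (⟪l j, π (E (star (a j) * a i)) (l i)⟫_ℂ).re := by
      have := congrArg Complex.re e1
      rw [Complex.ofReal_re, Complex.re_sum] at this
      rw [this]
      exact Finset.sum_congr rfl fun j _ => Complex.re_sum _ _
    have e3 : ∀ i j, 2 * (⟪l j, π (E (star (a j) * a i)) (l i)⟫_ℂ).re ≤
        (⟪l i, π (E (star (a j) * a j)) (l i)⟫_ℂ).re + (⟪l j, π (E (star (a i) * a i)) (l j)⟫_ℂ).re :=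
      fun i j => r.mix h hf (haM i) (haM j) (haf i) (haf j) (l i) (l j)
    have e4 : ∀ i, ∑ j, (⟪l i, π (E (star (a j) * a j)) (l i)⟫_ℂ).re ≤ ‖l i‖ ^ 2 := by
      intro i
      have hm : ∀ j ∈ Finset.univ, star (a j) * a j ∈ M := fun j _ => mul_mem (star_mem (haM j)) (haM j)
      have hEm : ∀ j ∈ Finset.univ, E (star (a j) * a j) ∈ M := fun j hj => hBM _ (h.condExp.maps_to _ (hm j hj))
      have k1 : E (∑ j, star (a j) * a j) ≤ 1 := by
        rw [← ce_one h.condExp]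
        exact ce_mono h.condExp (sum_mem hm) (one_mem M) (sum_le_one hg hr)
      rw [ce_sum h.condExp _ _ hm] at k1
      have k2 := r.mono (sum_mem hEm) (one_mem M) k1
      rw [r.sum _ _ hEm, r.one] at k2
      have k3 := re_nonneg_of (sub_nonneg.mpr k2) (l i)
      rw [ContinuousLinearMap.sub_apply, ContinuousLinearMap.one_apply, inner_sub_right, ContinuousLinearMap.sum_apply, inner_sum, Complex.sub_re, Complex.re_sum,
        inner_self_eq_norm_sq_to_K] at k3
      have k4 : (((‖l i‖ : ℂ)) ^ 2).re = ‖l i‖ ^ 2 := by norm_cast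
      have k5 : ((RCLike.ofReal ‖l i‖ : ℂ) ^ 2).re = ‖l i‖ ^ 2 := k4
      rw [k5] at k3
      linarith
    have e5 : 2 * ‖X k‖ ^ 2 ≤ S + S := by
      rw [e2, Finset.mul_sum]
      calc _ ≤ ∑ j, ∑ i, ((⟪l i, π (E (star (a j) * a j)) (l i)⟫_ℂ).re + (⟪l j, π (E (star (a i) * a i)) (l j)⟫_ℂ).re) := by
            apply Finset.sum_le_sum
            intro j _
            rw [Finset.mul_sum]
            exact Finset.sum_le_sum fun i _ => e3 i j
        _ = (∑ i, ∑ j, (⟪l i, π (E (star (a j) * a j)) (l i)⟫_ℂ).re) + ∑ j, ∑ i, (⟪l j, π (E (star (a i) * a i)) (l j)⟫_ℂ).re := by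
            simp only [Finset.sum_add_distrib]
            rw [Finset.sum_comm]
        _ ≤ _ := add_le_add (Finset.sum_le_sum fun i _ => e4 i) (Finset.sum_le_sum fun i _ => e4 i)
    linarith
  have hSle : S ≤ ‖k‖ * ‖X k‖ := by
    have := norm_inner_le_norm (𝕜 := ℂ) k (X k)
    rw [hS, Complex.norm_real, Real.norm_of_nonneg hS0] at this
    exact this
  have hfin : S ≤ ‖k‖ ^ 2 := by
    nlinarith [sq_nonneg (‖k‖ - ‖X k‖)]
  rw [ContinuousLinearMap.sub_apply, inner_sub_right, hS, ContinuousLinearMap.one_apply, inner_self_eq_norm_sq_to_K, Complex.sub_re, Complex.ofReal_re]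
  have k4 : (((‖k‖ : ℂ)) ^ 2).re = ‖k‖ ^ 2 := by norm_cast
  have k5 : ((RCLike.ofReal ‖k‖ : ℂ) ^ 2).re = ‖k‖ ^ 2 := k4
  rw [k5]
  linarith

end xle

lemma RR.sum {M M₁ M₂ B : VonNeumannAlgebra H} {E : BH H → BH H} (h : IsAFP M M₁ M₂ B E) {ι : Type*} (s : Finset ι) (x y : ι → BH H)
    (hx : ∀ i, x i ∈ M) (hxy : ∀ i, RR M₁ E (x i) (y i)) : RR M₁ E (∑ i ∈ s, x i) (∑ i ∈ s, y i) := by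
  classical
  induction s using Finset.induction_on with
  | empty => exact RR.self (zero_mem _)
  | insert i s hi ih =>
    rw [Finset.sum_insert hi, Finset.sum_insert hi]
    exact (hxy i).add h (hx i) (sum_mem fun j _ => hx j) ih

/-- an abelian projection of `B` that does not kill `c` -/
lemma abel_cut {N : VonNeumannAlgebra H} (hI : IsTypeI (N : Set (BH H))) {c : BH H} (hc : ∀ b ∈ N, b * c = c * b) (hc0 : c ≠ 0) :
    ∃ f, IsAbelianProjection (N : Set (BH H)) f ∧ f * c ≠ 0 := by
  let K : Submodule ℂ H := Submodule.span ℂ {k | ∃ m : BH H, (∀ b ∈ N, b * m = m * b) ∧ ∃ ξ, k = m (c ξ)}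
  have hK : ∀ y : BH H, (∀ m : BH H, (∀ b ∈ N, b * m = m * b) → ∀ ξ, y (m (c ξ)) ∈ K) → ∀ k ∈ K, y k ∈ K := by
    intro y hy k hk
    induction hk using Submodule.span_induction with
    | mem k hk => obtain ⟨m, hm, ξ, rfl⟩ := hk; exact hy m hm ξ
    | zero => rw [map_zero]; exact zero_mem _
    | add a b _ _ ha hb => rw [map_add]; exact add_mem ha hb
    | smul c a _ ha => rw [map_smul]; exact Submodule.smul_mem _ _ ha
  have hzN : pr K ∈ N := by
    apply pr_mem_vn
    intro y hy
    apply hK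
    intro m hm ξ
    exact Submodule.subset_span ⟨y * m, fun b hb => by rw [← mul_assoc, hy b hb, mul_assoc, hm b hb, mul_assoc], ξ, rfl⟩
  have hinv : ∀ x ∈ N, ∀ k ∈ K, x k ∈ K := by
    intro x hx
    apply hK
    intro m hm ξ
    have e1 : x * (m * c) = m * c * x := by rw [← mul_assoc, hm x hx, mul_assoc, hc x hx, mul_assoc]
    have e2 : x (m (c ξ)) = m (c (x ξ)) := congrArg (fun S : BH H => S ξ) e1
    rw [e2]
    exact Submodule.subset_span ⟨m, hm, _, rfl⟩
  have hzc : ∀ x ∈ N, pr K * x = x * pr K := fun x hx => (pr_comm (hinv x hx) (hinv _ (star_mem hx))).eq.symm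
  have hz0 : pr K ≠ 0 := by
    intro h0
    apply hc0
    ext ξ
    have : pr K (c ξ) = c ξ := pr_fix (Submodule.subset_span ⟨1, fun b _ => by simp, ξ, rfl⟩)
    rw [← this, h0]; rfl
  obtain ⟨f, hf, hf0, hfz⟩ := hI (pr K) ⟨pr_isProj K, hzN, hzc⟩ hz0
  refine ⟨f, hf, fun h0 => hf0 ?_⟩
  rw [← hfz]
  apply kill_pr
  intro k hk
  induction hk using Submodule.span_induction with
  | mem k hk =>
    obtain ⟨m, hm, ξ, rfl⟩ := hk
    have : f * (m * c) = 0 := by rw [← mul_assoc, hm f hf.2.1, mul_assoc, h0, mul_zero]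
    exact congrArg (fun S : BH H => S ξ) this
  | zero => rw [map_zero]
  | add a b _ _ ha hb => rw [map_add, ha, hb, add_zero]
  | smul c a _ ha => rw [map_smul, ha, smul_zero]

section fin
universe u v
variable {H : Type u} [NormedAddCommGroup H] [InnerProductSpace ℂ H] [CompleteSpace H]
variable {M M₁ M₂ B : VonNeumannAlgebra H} {E : BH H → BH H}
variable {K : Type v} [NormedAddCommGroup K] [InnerProductSpace ℂ K] [CompleteSpace K] {π : BH H → BH K} {p : BH K}

lemma Rep.phi_p (r : Rep M M₁ M₂ B E π p) (h : IsAFP M M₁ M₂ B E) (hI : IsTypeI (B : Set (BH H)))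
    (hno : HasNoTypeIDirectSummand (M₁ : Set (BH H))) {Q : VonNeumannAlgebra H} (hQM : ∀ x ∈ Q, x ∈ M) (hMQ : ∀ x ∈ M₁, x ∈ Q)
    (Φ : BH K →ₗ[ℂ] BH H) (hΦQ : ∀ T, Φ T ∈ Q) (hΦ0 : ∀ T, 0 ≤ T → 0 ≤ Φ T) (hΦ1 : Φ 1 = 1)
    (hΦb : ∀ a ∈ Q, ∀ b ∈ Q, ∀ T, Φ (π a * T * π b) = a * Φ T * b) : Φ p = 0 := by
  have hpM : Φ p ∈ M := hQM _ (hΦQ p)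
  have hp0 : 0 ≤ Φ p := hΦ0 p (proj_nonneg r.proj)
  obtain ⟨c, hc⟩ := RR.exists h hpM
  have hcM := hc.1
  have hc0 : 0 ≤ c := hc.nonneg h hpM hp0
  have hcB : ∀ b ∈ B, b * c = c * b := by
    intro b hb
    have hbM₁ : b ∈ M₁ := h.le₁ hb
    have e1 := hΦb b (hMQ _ hbM₁) 1 (one_mem Q) p
    have e2 := hΦb 1 (one_mem Q) b (hMQ _ hbM₁) p
    rw [r.one, mul_one, mul_one] at e1
    rw [r.one, one_mul, one_mul, ← r.comm b hb, e1] at e2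
    have k1 := hc.bimod hbM₁ (one_mem M₁)
    have k2 := hc.bimod (one_mem M₁) hbM₁
    rw [mul_one, mul_one] at k1
    rw [one_mul, one_mul, ← e2] at k2
    exact k1.unique h (mul_mem (h.le₁M hbM₁) hpM) k2
  suffices hcz : c = 0 by
    rw [hcz] at hc
    exact hc.eq_zero h hpM hp0
  by_contra hcne
  obtain ⟨f, hf, hfc⟩ := abel_cut hI hcB hcne
  have hfp := hf.1
  have hfB : f ∈ B := hf.2.1
  have hfM₁ : f ∈ M₁ := h.le₁ hfB
  have hA0 : 0 ≤ f * c := le_one_mul_proj hc0 hfp (hcB f hfB)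
  have hAM : f * c ∈ M₁ := mul_mem hfM₁ hcM
  have hn : 0 < ‖f * c‖ := norm_pos_iff.mpr hfc
  set δ : ℝ := ‖f * c‖ / 2 with hδd
  have hδ : 0 < δ := by positivity
  obtain ⟨e, hep, hecomm, hle, -, hezero, -⟩ := SP (sa_of_nonneg hA0) δ
  have heM : e ∈ M₁ := SP_mem hAM hecomm
  have he0 : e ≠ 0 := by
    intro h0
    have := norm_le_of_le hδ.le hA0 (hezero h0)
    linarith
  have hcf : f * c * f = f * c := by rw [hcB f hfB, mul_assoc, hfp.2.eq]
  have hfe : f * e = e := SP_supp δ hδ hep hfp hle hcf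
  have hef : e * f = e := proj_mul_comm_of hep hfp hfe
  have hece : (δ : ℂ) • e ≤ e * c * e := by
    have hce := (hecomm (f * c) (Commute.refl _)).eq
    have : e * c * e = e * (f * c) := by
      calc e * c * e = e * f * c * e := by rw [hef]
        _ = e * ((f * c) * e) := by simp only [mul_assoc]
        _ = e * (f * c) := by rw [hce, ← mul_assoc, hep.2.eq]
    rw [this]; exact hle
  obtain ⟨k, hk⟩ := pow_unbounded_of_one_lt (1 / δ) (one_lt_two)
  obtain ⟨ι, _, _, a, g, hcard, hg, hgM, hg0, heg, haM, hea, hae, hr⟩ := divide hno hep heM he0 k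
  have haf : ∀ i, a i * f = a i := fun i => by rw [← hae i, mul_assoc, hef]
  have hX := r.xle h hf hg haM haf hr
  have hX' : ∑ i, a i * Φ p * star (a i) ≤ 1 := by
    have h1 := hΦ0 _ (sub_nonneg.mpr hX)
    rw [map_sub, hΦ1, map_sum, sub_nonneg] at h1
    refine le_of_eq_of_le ?_ h1
    apply Finset.sum_congr rfl
    intro i _
    rw [← r.str _ (h.le₁M (haM i)), hΦb _ (hMQ _ (haM i)) _ (hMQ _ (star_mem (haM i)))]
  have hmemM : ∀ i, a i * Φ p * star (a i) ∈ M := fun i => mul_mem (mul_mem (h.le₁M (haM i)) hpM) (star_mem (h.le₁M (haM i)))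
  have hY : ∑ i, a i * c * star (a i) ≤ 1 := by
    have k1 := RR.sum h Finset.univ _ _ hmemM (fun i => hc.bimod (haM i) (star_mem (haM i)))
    have k2 := (RR.self (E := E) (one_mem M₁)).add h (one_mem M) (M.smul_mem (sum_mem fun i _ => hmemM i) _) (k1.smul h (sum_mem fun i _ => hmemM i) (-1))
    rw [neg_one_smul, neg_one_smul, ← sub_eq_add_neg, ← sub_eq_add_neg] at k2
    exact sub_nonneg.mp (k2.nonneg h (sub_mem (one_mem M) (sum_mem fun i _ => hmemM i)) (sub_nonneg.mpr hX'))
  have hZ : ((2 ^ k * δ : ℝ) : ℂ) • g ≤ 1 := by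
    refine le_trans ?_ hY
    have e1 : ((2 ^ k * δ : ℝ) : ℂ) • g = ∑ i : ι, (δ : ℂ) • g := by
      rw [Finset.sum_const, Finset.card_univ, hcard, ← Nat.cast_smul_eq_nsmul ℂ, smul_smul]
      push_cast; rfl
    rw [e1]
    apply Finset.sum_le_sum
    intro i _
    have k1 := conj_nonneg (sub_nonneg.mpr hece) (a i)
    have e2 : a i * (e * c * e - (δ : ℂ) • e) * star (a i) = a i * c * star (a i) - (δ : ℂ) • g := by
      have s1 : e * star (a i) = star (a i) := by
        have := congrArg star (hae i); rwa [star_mul, star_sa hep.1] at this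
      rw [mul_sub, sub_mul, mul_smul_comm, smul_mul_assoc, hae, hr, if_pos rfl]
      congr 1
      calc a i * (e * c * e) * star (a i) = (a i * e) * c * (e * star (a i)) := by simp only [mul_assoc]
        _ = _ := by rw [hae, s1]
    rw [e2] at k1
    exact sub_nonneg.mp k1
  have hgn : ‖g‖ = 1 := by
    have h1 := CStarRing.norm_star_mul_self (x := g)
    rw [star_sa hg.1, hg.2.eq] at h1
    have h2 : ‖g‖ ≠ 0 := norm_ne_zero_iff.mpr hg0
    exact (mul_left_cancel₀ h2 (by rw [mul_one]; exact h1)).symm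
  have hpos : (0:ℝ) ≤ 2 ^ k * δ := by positivity
  have hfin := norm_le_of_le zero_le_one (nonneg_smul (proj_nonneg hg) hpos) (by simpa using hZ)
  rw [norm_smul, hgn, mul_one, Complex.norm_real, Real.norm_of_nonneg hpos] at hfin
  rw [div_lt_iff₀ hδ] at hk
  linarith

lemma Rep.phi_kill {p : BH K} (hp : IsProjection p) (Φ : BH K →ₗ[ℂ] BH H) (hΦ0 : ∀ T, 0 ≤ T → 0 ≤ Φ T) (hΦp : Φ p = 0) {W : BH K} (hW : (1 - p) * W * (1 - p) = 0) :
    Φ W = 0 := by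
  let s : H → BH K →ₗ[ℂ] ℂ := fun ξ =>
    { toFun := fun T => ⟪ξ, Φ T ξ⟫_ℂ
      map_add' := fun S T => by rw [map_add, ContinuousLinearMap.add_apply, inner_add_right]
      map_smul' := fun c T => by rw [map_smul, ContinuousLinearMap.smul_apply, inner_smul_right]; rfl }
  have hs0 : ∀ ξ, ∀ a, 0 ≤ s ξ (star a * a) := fun ξ a => inner_nonneg_of (hΦ0 _ (star_mul_self_nonneg a)) ξ
  have hpz : ∀ ξ, s ξ (star p * p) = 0 := by
    intro ξ
    rw [star_sa hp.1, hp.2.eq]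
    change ⟪ξ, Φ p ξ⟫_ℂ = 0
    rw [hΦp]; simp
  have hz : ∀ T, (∀ ξ, s ξ T = 0) → Φ T = 0 := by
    intro T hT
    have h1 : ∀ ξ, ⟪ξ, Φ T ξ⟫_ℂ = 0 := hT
    have := nonneg_of_inner (a := Φ T) (fun x => by rw [h1])
    have h2 := nonneg_of_inner (a := - Φ T) (fun x => by rw [ContinuousLinearMap.neg_apply, inner_neg_right, h1, neg_zero])
    exact le_antisymm (neg_nonneg.mp h2) this
  have hr : ∀ T, Φ (T * p) = 0 := by
    intro T
    apply hz
    intro ξ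
    have := CS (s ξ) (hs0 ξ) p (star T)
    rw [hpz, star_star, Complex.zero_re, mul_zero] at this
    exact norm_eq_zero.mp (pow_eq_zero_iff (two_ne_zero) |>.mp (le_antisymm this (sq_nonneg _)))
  have hl : ∀ T, Φ (p * T) = 0 := by
    intro T
    apply hz
    intro ξ
    have := CS (s ξ) (hs0 ξ) T p
    rw [hpz, star_sa hp.1, Complex.zero_re, zero_mul] at this
    exact norm_eq_zero.mp (pow_eq_zero_iff (two_ne_zero) |>.mp (le_antisymm this (sq_nonneg _)))
  have e : W = p * W + W * p - p * (W * p) := by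
    have : (1 - p) * W * (1 - p) = W - (p * W + W * p - p * (W * p)) := by
      simp only [sub_mul, mul_sub, one_mul, mul_one, mul_assoc]; abel
    rw [this] at hW
    exact sub_eq_zero.mp hW
  rw [e, map_sub, map_add, hl, hr, hl]; simp

lemma final (h : IsAFP M M₁ M₂ B E) (hI : IsTypeI (B : Set (BH H)))
    (hno : HasNoTypeIDirectSummand (M₁ : Set (BH H))) (Q : VonNeumannAlgebra H) (hQM : (Q : Set (BH H)) ⊆ (M : Set (BH H)))
    (hQexp : WithExpectation (M : Set (BH H)) (Q : Set (BH H)))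
    (hQamen : IsAmenableVN (Q : Set (BH H)))
    (hM₁Q : (M₁ : Set (BH H)) ⊆ (Q : Set (BH H))) :
    (Q : Set (BH H)) = (M₁ : Set (BH H)) := by
  classical
  obtain ⟨F, hF, -, hFn⟩ := hQexp
  have r := h.grep.rep h
  obtain ⟨Φ, h1, h2, h3, h4⟩ := r.phi (fun x hx => hQM hx) hF hQamen
  have hΦ1 : Φ 1 = 1 := by rw [← r.one, h3 1 (one_mem M), ce_one hF]
  have hp := r.phi_p h hI hno (fun x hx => hQM hx) (fun x hx => hM₁Q hx) Φ h1 h2 hΦ1 h4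
  have hw : ∀ w, Red M₁ M₂ E false false w → F w = 0 := by
    intro w hw
    rw [← h3 w (hw.memM h)]
    exact Rep.phi_kill r.proj Φ h2 hp (r.kill w hw)
  have hg : ∀ x ∈ G3 M₁ M₂ E, x ∈ M ∧ F x ∈ M₁ := by
    rintro x (hx | ⟨a, ha, b, hb, w, hwr, rfl⟩)
    · exact ⟨h.le₁M hx, by rw [hF.fixes x (hM₁Q hx)]; exact hx⟩
    · have hwM := hwr.memM h
      refine ⟨mul_mem (mul_mem (h.le₁M ha) hwM) (h.le₁M hb), ?_⟩
      rw [hF.bimod a (hM₁Q ha) b (hM₁Q hb) w hwM, hw w hwr, mul_zero, zero_mul]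
      exact zero_mem _
  have halg : ∀ x ∈ Malg M₁ M₂, F x ∈ M₁ := by
    intro x hx0
    have hx := h.malg_g3 hx0
    have : x ∈ M ∧ F x ∈ M₁ := by
      clear hx0
      induction hx using Submodule.span_induction with
      | mem x hx => exact hg x hx
      | zero => exact ⟨zero_mem _, by rw [ce_zero hF]; exact zero_mem _⟩
      | add x y _ _ hx hy => exact ⟨add_mem hx.1 hy.1, by rw [hF.map_add _ hx.1 _ hy.1]; exact add_mem hx.2 hy.2⟩
      | smul c x _ hx => exact ⟨M.smul_mem hx.1 c, by rw [hF.map_smul _ _ hx.1]; exact M₁.smul_mem hx.2 c⟩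
    exact this.2
  refine Set.Subset.antisymm ?_ hM₁Q
  intro x hx
  obtain ⟨C, z, k1, k2, k3⟩ := h.net (hQM hx)
  have k4 := ce_tendsto hF hFn C (fun i => h.malgM (k1 i)) (hQM hx) k2 k3
  rw [hF.fixes x hx] at k4
  exact lim_mem_vn (fun i => halg _ (k1 i)) k4

end fin

/-- If `M = M₁ *_B M₂` is an amalgamated free product of σ-finite von Neumann algebras,
`B` is of type I and `M₁` is amenable with no type I direct summand, then `M₁` is maximal
amenable with expectation inside `M`. -/
theorem maximal_amenable_typeI_amalgam
    {H : Type*} [NormedAddCommGroup H] [InnerProductSpace ℂ H] [CompleteSpace H]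
    (M M₁ M₂ B : VonNeumannAlgebra H) (E : BH H → BH H)
    (hAFP : IsAFP M M₁ M₂ B E)
    (hσB : SigmaFinite (B : Set (BH H))) (hσ₁ : SigmaFinite (M₁ : Set (BH H)))
    (hσ₂ : SigmaFinite (M₂ : Set (BH H))) (hσM : SigmaFinite (M : Set (BH H)))
    (hBtypeI : IsTypeI (B : Set (BH H)))
    (hM₁amen : IsAmenableVN (M₁ : Set (BH H)))
    (hM₁noI : HasNoTypeIDirectSummand (M₁ : Set (BH H)))
    (Q : VonNeumannAlgebra H) (hQM : (Q : Set (BH H)) ⊆ (M : Set (BH H)))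
    (hQexp : WithExpectation (M : Set (BH H)) (Q : Set (BH H)))
    (hQamen : IsAmenableVN (Q : Set (BH H)))
    (hM₁Q : (M₁ : Set (BH H)) ⊆ (Q : Set (BH H))) :
    (Q : Set (BH H)) = (M₁ : Set (BH H)) := by
  exact final hAFP hBtypeI hM₁noI Q hQM hQexp hQamen hM₁Q

end AFP
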